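/- arXiv:1004.3603 — 3 statements merged into one kernel-verified Lean document; each statement's English description precedes it below -/
import Mathlib

section
/- Let F be a field of characteristic different from 2 and let M be an n×n matrix over F. Then M ∈ Ξ_n(F) (i.e., every invertible S with SᵀMS = M has det S = 1) if and only if M is not congruent to a block-diagonal direct sum A ⊕ B in which A is a square matrix of odd size. -/
open Matrix Polynomial

variable {F : Type*} [Field F]

/-- `M ∈ Ξ_n(F)`: every invertible `S` with `SᵀMS = M` has `det S = 1`. -/
def XiMem {n : ℕ} (M : Matrix (Fin n) (Fin n) F) : Prop :=
  ∀ S : Matrix (Fin n) (Fin n) F, IsUnit S → Sᵀ * M * S = M → S.det = 1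

/-- Congruence of square matrices: `SᵀAS = B` for some invertible `S`. -/
def MatCongruent {n : ℕ} (A B : Matrix (Fin n) (Fin n) F) : Prop :=
  ∃ S : Matrix (Fin n) (Fin n) F, IsUnit S ∧ Sᵀ * A * S = B

/-- Similarity of square matrices: `S⁻¹AS = B` for some invertible `S`. -/
def MatSimilar {n : ℕ} (A B : Matrix (Fin n) (Fin n) F) : Prop :=
  ∃ S : Matrix (Fin n) (Fin n) F, IsUnit S ∧ S⁻¹ * A * S = B

/-- Block-diagonal direct sum `A ⊕ B`. -/
def dSum {a b : ℕ} (A : Matrix (Fin a) (Fin a) F) (B : Matrix (Fin b) (Fin b) F) :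
    Matrix (Fin (a + b)) (Fin (a + b)) F :=
  Matrix.reindex finSumFinEquiv finSumFinEquiv (Matrix.fromBlocks A 0 0 B)

/-- Skew sum `[A ╲ B] = [[0, B], [A, 0]]` of two `m × m` matrices. -/
def skewSum {m : ℕ} (A B : Matrix (Fin m) (Fin m) F) :
    Matrix (Fin (m + m)) (Fin (m + m)) F :=
  Matrix.reindex finSumFinEquiv finSumFinEquiv (Matrix.fromBlocks 0 B A 0)

/-- `A` is a direct summand of `M` for congruence. -/
def CongSummand {n r : ℕ} (M : Matrix (Fin n) (Fin n) F)
    (A : Matrix (Fin r) (Fin r) F) : Prop :=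
  ∃ (s : ℕ) (h : r + s = n) (B : Matrix (Fin s) (Fin s) F),
    MatCongruent M (Matrix.reindex (finCongr h) (finCongr h) (dSum A B))

/-- `A` is a direct summand of `M` for similarity. -/
def SimSummand {n r : ℕ} (M : Matrix (Fin n) (Fin n) F)
    (A : Matrix (Fin r) (Fin r) F) : Prop :=
  ∃ (s : ℕ) (h : r + s = n) (B : Matrix (Fin s) (Fin s) F),
    MatSimilar M (Matrix.reindex (finCongr h) (finCongr h) (dSum A B))

/-- `(A, B)` is a direct summand of the pair `(M, N)` for equivalence:
`(M, N)` is equivalent to `(A, B) ⊕ (C, D)` for some pair `(C, D)`. -/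
def PairSummand {n a b : ℕ} (M N : Matrix (Fin n) (Fin n) F)
    (A B : Matrix (Fin a) (Fin b) F) : Prop :=
  ∃ (c d : ℕ) (hc : a + c = n) (hd : b + d = n)
    (C D : Matrix (Fin c) (Fin d) F)
    (R S : Matrix (Fin n) (Fin n) F), IsUnit R ∧ IsUnit S ∧
      R * M * S = Matrix.reindex (finSumFinEquiv.trans (finCongr hc))
          (finSumFinEquiv.trans (finCongr hd)) (Matrix.fromBlocks A 0 0 C) ∧
      R * N * S = Matrix.reindex (finSumFinEquiv.trans (finCongr hc))
          (finSumFinEquiv.trans (finCongr hd)) (Matrix.fromBlocks B 0 0 D)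

/-- The `r × r` Jordan block `J_r(λ)`: `λ` on the diagonal, `1` on the subdiagonal. -/
def jordanBlock (r : ℕ) (lam : F) : Matrix (Fin r) (Fin r) F :=
  Matrix.of fun i j =>
    if (i : ℕ) = (j : ℕ) then lam else if (i : ℕ) = (j : ℕ) + 1 then 1 else 0

/-- The matrix `Γ_r`: with 1-based indices, entry `(i, j)` is `(-1)^(r - i)` if
`i + j = r + 1` or `i + j = r + 2`, and `0` otherwise. -/
def Gam (r : ℕ) : Matrix (Fin r) (Fin r) F :=
  Matrix.of fun i j =>
    if (i : ℕ) + (j : ℕ) = r - 1 ∨ (i : ℕ) + (j : ℕ) = r then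
      (-1 : F) ^ (r - 1 - (i : ℕ)) else 0

/-- Companion matrix of a monic polynomial `x^m + c₁x^(m-1) + ⋯ + c_m`:
`1`'s on the subdiagonal, last column `(-c_m, …, -c₂, -c₁)ᵀ`. -/
def companion (q : Polynomial F) : Matrix (Fin q.natDegree) (Fin q.natDegree) F :=
  Matrix.of fun i j =>
    if (j : ℕ) = q.natDegree - 1 then -q.coeff (i : ℕ)
    else if (i : ℕ) = (j : ℕ) + 1 then 1 else 0

/-- A Frobenius block: the companion matrix of `p^l` with `p` monic irreducible, `l ≥ 1`. -/
def IsFrobeniusBlock {m : ℕ} (A : Matrix (Fin m) (Fin m) F) : Prop :=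
  ∃ (p : Polynomial F) (l : ℕ), p.Monic ∧ Irreducible p ∧ 1 ≤ l ∧
    ∃ h : (p ^ l).natDegree = m,
      A = Matrix.reindex (finCongr h) (finCongr h) (companion (p ^ l))

/-- `Φ` is a cosquare: `Φ = A⁻ᵀA` for some invertible `A`. -/
def IsCosquare {m : ℕ} (A : Matrix (Fin m) (Fin m) F) : Prop :=
  ∃ Q : Matrix (Fin m) (Fin m) F, IsUnit Q ∧ Q⁻¹ᵀ * Q = A

/-- The `(t-1) × t` matrix `F_t` with `F_t(i, j) = 1` iff `j = i`. -/
def Fmat (t : ℕ) : Matrix (Fin (t - 1)) (Fin t) F :=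
  Matrix.of fun i j => if (j : ℕ) = (i : ℕ) then 1 else 0

/-- The `(t-1) × t` matrix `G_t` with `G_t(i, j) = 1` iff `j = i + 1`. -/
def Gmat (t : ℕ) : Matrix (Fin (t - 1)) (Fin t) F :=
  Matrix.of fun i j => if (j : ℕ) = (i : ℕ) + 1 then 1 else 0

open Module

/-- An orthogonal splitting of the space of `M.toBilin'` whose first summand has odd dimension
gives a congruence of `M` to a direct sum whose first block has odd size. -/
theorem exists_congruent_dSum_of_isCompl {F : Type*} [Field F] {n : ℕ}
    (M : Matrix (Fin n) (Fin n) F) {U W : Submodule F (Fin n → F)} (hUW : IsCompl U W)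
    (h₁ : ∀ u ∈ U, ∀ w ∈ W, M.toBilin' u w = 0) (h₂ : ∀ u ∈ U, ∀ w ∈ W, M.toBilin' w u = 0)
    (hU : Odd (finrank F U)) :
    ∃ (r s : ℕ) (h : r + s = n) (A : Matrix (Fin r) (Fin r) F)
      (B : Matrix (Fin s) (Fin s) F), Odd r ∧
        MatCongruent M (Matrix.reindex (finCongr h) (finCongr h) (dSum A B)) := by
  have hn : finrank F U + finrank F W = n := by
    rw [Submodule.finrank_add_eq_of_isCompl hUW, finrank_fin_fun]
  set r := finrank F U
  set s := finrank F W
  let bU : Basis (Fin r) F U := finBasis F U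
  let bW : Basis (Fin s) F W := finBasis F W
  let e : Fin r ⊕ Fin s ≃ Fin n := finSumFinEquiv.trans (finCongr hn)
  let b : Basis (Fin n) F (Fin n → F) :=
    ((bU.prod bW).map (Submodule.prodEquivOfIsCompl U W hUW)).reindex e
  have hl (i : Fin r) : b (e (Sum.inl i)) = bU i := by simp [b]
  have hr (i : Fin s) : b (e (Sum.inr i)) = bW i := by simp [b]
  let S : Matrix (Fin n) (Fin n) F := (Pi.basisFun F (Fin n)).toMatrix b
  have hS : IsUnit S := by
    have := (Pi.basisFun F (Fin n)).invertibleToMatrix b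
    exact isUnit_of_invertible S
  refine ⟨r, s, hn, Matrix.of fun i j => M.toBilin' (bU i) (bU j),
    Matrix.of fun i j => M.toBilin' (bW i) (bW j), hU, S, hS, ?_⟩
  have key (i j : Fin n) : (Sᵀ * M * S) i j = M.toBilin' (b i) (b j) := by
    rw [Matrix.toBilin'_apply', Matrix.mul_assoc]
    rfl
  ext i j
  obtain ⟨i, rfl⟩ := e.surjective i
  obtain ⟨j, rfl⟩ := e.surjective j
  rw [key]
  have he (x) : (finCongr hn).symm (e x) = finSumFinEquiv x := by simp [e]
  simp only [dSum, Matrix.reindex_apply, Matrix.submatrix_apply, he, Equiv.symm_apply_apply]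
  rcases i with i | i <;> rcases j with j | j
  · simp [hl]
  · simpa [hl, hr] using h₁ _ (bU i).2 _ (bW j).2
  · simpa [hl, hr] using h₂ _ (bU j).2 _ (bW i).2
  · simp [hr]

/-- A matrix congruent to a direct sum with a first block of odd size has a self-congruence of
determinant `-1`. -/
theorem not_xiMem_of_congruent_dSum {F : Type*} [Field F] (hchar : (2 : F) ≠ 0) {n r s : ℕ}
    (M : Matrix (Fin n) (Fin n) F) (h : r + s = n) (A : Matrix (Fin r) (Fin r) F)
    (B : Matrix (Fin s) (Fin s) F) (hr : Odd r)
    (hM : MatCongruent M (Matrix.reindex (finCongr h) (finCongr h) (dSum A B))) : ¬ XiMem M := by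
  subst h
  obtain ⟨T, hT, hTM⟩ := hM
  intro hXi
  let D : Matrix (Fin (r + s)) (Fin (r + s)) F := dSum (-1) 1
  have hD : Dᵀ * (Tᵀ * M * T) * D = Tᵀ * M * T := by
    rw [hTM]
    simp only [D, dSum, finCongr_refl, Matrix.reindex_apply, Matrix.transpose_submatrix,
      Matrix.fromBlocks_transpose, Equiv.refl_symm, Matrix.submatrix_submatrix]
    simp [Matrix.fromBlocks_multiply]
  have hdet : D.det = -1 := by
    simp [D, dSum, Matrix.det_neg, hr.neg_one_pow]
  have hTd : IsUnit T.det := (Matrix.isUnit_iff_isUnit_det T).1 hT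
  have hdetS : (T * D * T⁻¹).det = -1 := by
    rw [Matrix.det_mul, Matrix.det_mul, hdet, mul_right_comm, ← Matrix.det_mul,
      Matrix.mul_nonsing_inv T hTd, Matrix.det_one, one_mul]
  have := hXi (T * D * T⁻¹) (by rw [Matrix.isUnit_iff_isUnit_det, hdetS]; simp) (by
    have hT' : T⁻¹ᵀ * Tᵀ = 1 := by
      rw [← Matrix.transpose_mul, Matrix.mul_nonsing_inv T hTd, Matrix.transpose_one]
    calc (T * D * T⁻¹)ᵀ * M * (T * D * T⁻¹)
        = T⁻¹ᵀ * (Dᵀ * (Tᵀ * M * T) * D) * T⁻¹ := by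
          simp only [Matrix.transpose_mul, Matrix.mul_assoc]
      _ = (T⁻¹ᵀ * Tᵀ) * M * (T * T⁻¹) := by rw [hD]; simp only [Matrix.mul_assoc]
      _ = M := by rw [hT', Matrix.mul_nonsing_inv T hTd]; simp)
  rw [hdetS] at this
  apply hchar
  linear_combination -this

section

variable {V : Type*} [AddCommGroup V] [Module F V]

/-- Moving `(f + 1) ^ k` across a bilinear form preserved by `f`. -/
theorem isometry_pow_adjoint (B : LinearMap.BilinForm F V) (f : Module.End F V)
    (hf : ∀ x y, B (f x) (f y) = B x y) (k : ℕ) (x y : V) :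
    B x (((f + 1) ^ k) y) = B (((f + 1) ^ k) x) ((f ^ k) y) := by
  have h1 (x y : V) : B x ((f + 1) y) = B ((f + 1) x) (f y) := by simp [hf, add_comm]
  induction k generalizing x y with
  | zero => simp
  | succ k ih =>
    rw [pow_succ' (f + 1), Module.End.mul_apply, h1, ← Module.End.mul_apply f,
      (((Commute.refl f).add_right (Commute.one_right f)).pow_right k).eq, Module.End.mul_apply, ih,
      ← Module.End.mul_apply, ← pow_succ, ← Module.End.mul_apply, ← pow_succ]
    simp [pow_succ']

/-- The generalized eigenspace at `-1` of an isometry is an orthogonal summand. -/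
theorem exists_isCompl_of_isometry [FiniteDimensional F V]
    (B : LinearMap.BilinForm F V) (f : Module.End F V)
    (hf : ∀ x y, B (f x) (f y) = B x y) :
    ∃ W, IsCompl (f.maxGenEigenspace (-1)) W ∧
      (∀ u ∈ f.maxGenEigenspace (-1), ∀ w ∈ W, B u w = 0) ∧
      ∀ u ∈ f.maxGenEigenspace (-1), ∀ w ∈ W, B w u = 0 := by
  have hU : f.maxGenEigenspace (-1) = ⨆ k : ℕ, LinearMap.ker ((f + 1) ^ k) := by
    simp [← Module.End.iSup_genEigenspace_eq, Module.End.genEigenspace_nat]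
  refine ⟨⨅ k : ℕ, LinearMap.range ((f + 1) ^ k), ?_, ?_⟩
  · rw [hU]
    exact LinearMap.isCompl_iSup_ker_pow_iInf_range_pow (f + 1)
  have key (B : LinearMap.BilinForm F V) (hf : ∀ x y, B (f x) (f y) = B x y) (u)
      (hu : u ∈ f.maxGenEigenspace (-1)) (w)
      (hw : w ∈ ⨅ k : ℕ, LinearMap.range ((f + 1) ^ k)) : B u w = 0 := by
    obtain ⟨k, hk⟩ := (Module.End.mem_maxGenEigenspace f (-1) u).1 hu
    obtain ⟨w, rfl⟩ := (Submodule.mem_iInf _).1 hw k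
    have hk' : ((f + 1) ^ k) u = 0 := by simpa using hk
    rw [isometry_pow_adjoint B f hf, hk', map_zero, LinearMap.zero_apply]
  exact ⟨key B hf, key B.flip fun x y => hf y x⟩

/-- The characteristic polynomial of a self-congruence of a matrix with nonzero determinant is
self-reciprocal up to a scalar. -/
theorem charpolyRev_eq_of_congr_self {R : Type*} [CommRing R] [IsDomain R] {n : ℕ}
    (P S : Matrix (Fin n) (Fin n) R) (hP : P.det ≠ 0) (h : Sᵀ * P * S = P) :
    S.charpolyRev = C ((-1) ^ n * S.det) * S.charpoly := by
  have hmat : (S.map C)ᵀ * P.map C * S.charmatrix =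
      -((1 - (X : R[X]) • (S.map C)ᵀ) * P.map C) := by
    have h' : (S.map C)ᵀ * P.map C * S.map C = P.map (C : R →+* R[X]) := by
      rw [← Matrix.transpose_map, ← Matrix.map_mul, ← Matrix.map_mul, h]
    rw [Matrix.charmatrix, Matrix.mul_sub, RingHom.mapMatrix_apply, h', sub_mul, one_mul,
      Matrix.smul_mul, neg_sub, (Matrix.scalar_commute X (mul_comm X) _).symm.eq,
      Matrix.scalar_apply, ← Matrix.smul_eq_diagonal_mul]
  have hdet := congrArg Matrix.det hmat
  have hrev : (1 - (X : R[X]) • (S.map C)ᵀ).det = S.charpolyRev := by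
    rw [Matrix.charpolyRev, ← Matrix.det_transpose]
    simp
  rw [Matrix.det_mul, Matrix.det_mul, Matrix.det_neg, Matrix.det_mul, hrev, Matrix.det_transpose,
    ← RingHom.mapMatrix_apply, ← RingHom.mapMatrix_apply, ← RingHom.map_det, ← RingHom.map_det,
    ← Matrix.charpoly, Fintype.card_fin] at hdet
  have hP' : (C P.det : R[X]) ≠ 0 := by simpa using hP
  apply mul_right_cancel₀ hP'
  simp only [map_mul, map_pow, map_neg, map_one]
  have h1 : ((-1 : R[X]) ^ n) * (-1) ^ n = 1 := by rw [← mul_pow]; simp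
  linear_combination (-(-1 : R[X]) ^ n) * hdet - (S.charpolyRev * C P.det) * h1

/-- If the pencil `M - X • Mᵀ` is regular, the determinant of a self-congruence of `M` is determined
by the multiplicity of its eigenvalue `-1`. -/
theorem det_eq_of_regular {n : ℕ} (M S : Matrix (Fin n) (Fin n) F)
    (hM : (M.map C - (X : F[X]) • Mᵀ.map C).det ≠ 0) (h : Sᵀ * M * S = M) :
    S.det = (-1) ^ (S.charpoly.rootMultiplicity (-1)) := by
  have h' : Sᵀ * Mᵀ * S = Mᵀ := by
    conv_rhs => rw [← h]
    simp [Matrix.mul_assoc]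
  have hrev : S.charpolyRev = C ((-1) ^ n * S.det) * S.charpoly := by
    have := charpolyRev_eq_of_congr_self _ (S.map C) hM (by
      rw [Matrix.mul_sub, Matrix.sub_mul, Matrix.mul_smul, Matrix.smul_mul, ← Matrix.transpose_map,
        ← Matrix.map_mul, ← Matrix.map_mul, ← Matrix.map_mul, ← Matrix.map_mul, h, h'])
    apply Polynomial.map_injective (C : F →+* F[X]) C_injective
    have hr : (S.map (C : F → F[X])).charpolyRev = S.charpolyRev.map C := by
      rw [Matrix.charpolyRev, Matrix.charpolyRev, ← coe_mapRingHom, RingHom.map_det]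
      congr 1
      ext1 i j
      by_cases hij : i = j <;> simp [hij]
    rw [Polynomial.map_mul, ← Matrix.charpoly_map, map_C, map_mul, RingHom.map_det, ← hr, this]
    simp
  rw [← Matrix.reverse_charpoly] at hrev
  obtain ⟨q, hq, hq1⟩ := S.charpoly.exists_eq_pow_rootMultiplicity_mul_and_not_dvd
    S.charpoly_monic.ne_zero (-1)
  set d := S.charpoly.rootMultiplicity (-1)
  have hdeg : n = d + q.natDegree := by
    have hq0 : q ≠ 0 := by rintro rfl; exact hq1 (dvd_zero _)
    have hnat := S.charpoly_natDegree_eq_dim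
    rw [hq, Polynomial.natDegree_mul (pow_ne_zero _ (X_sub_C_ne_zero _)) hq0,
      Polynomial.natDegree_pow, natDegree_X_sub_C, Fintype.card_fin, mul_one] at hnat
    exact hnat.symm
  have hq2 : q.eval (-1) ≠ 0 := fun h0 => hq1 (Polynomial.dvd_iff_isRoot.2 h0)
  have hXr : ((X - C (-1 : F)) : F[X]).reverse = X - C (-1) := by
    rw [Polynomial.reverse, natDegree_X_sub_C, Polynomial.reflect_sub, Polynomial.reflect_C]
    simp [Polynomial.reflect_one_X, add_comm]
  have hpow (k : ℕ) : ((X - C (-1 : F)) ^ k : F[X]).reverse = (X - C (-1)) ^ k := by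
    induction k with
    | zero => simpa using Polynomial.reverse_C (1 : F)
    | succ k ih => rw [pow_succ, Polynomial.reverse_mul_of_domain, ih, hXr]
  rw [hq, Polynomial.reverse_mul_of_domain, hpow, mul_left_comm] at hrev
  have hX0 : (X - C (-1 : F)) ^ d ≠ 0 := pow_ne_zero _ (X_sub_C_ne_zero _)
  have hrq := congrArg (eval (-1)) (mul_left_cancel₀ hX0 hrev)
  have hre : q.reverse.eval (-1) * (-1) ^ q.natDegree = q.eval (-1) := by
    let : Invertible (-1 : F) := ⟨-1, by simp, by simp⟩
    have : _ = eval (-1) q := Polynomial.eval₂_reverse_mul_pow (RingHom.id F) (-1) q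
    rwa [show ⅟(-1 : F) = -1 from rfl] at this
  rw [eval_mul, eval_C] at hrq
  have hsign : (-1 : F) ^ n = (-1) ^ d * (-1) ^ q.natDegree := by
    rw [← pow_add, ← hdeg]
  rw [hrq, hsign] at hre
  have hsq (k : ℕ) : ((-1 : F) ^ k) * (-1) ^ k = 1 := by rw [← mul_pow]; simp
  apply mul_right_cancel₀ hq2
  linear_combination (-1) ^ d * hre - S.det * eval (-1) q * (-1) ^ q.natDegree *
    (-1) ^ q.natDegree * hsq d - S.det * eval (-1) q * hsq q.natDegree

/-- A sequence in `V` forming a polynomial null vector `∑ x i * t ^ i` of the pencil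
`(v, x) ↦ B v x - t * B x v`, with coefficients vanishing from index `l` on. -/
structure IsNullChain (B : LinearMap.BilinForm F V) (l : ℕ) (x : ℕ → V) : Prop where
  zero (v : V) : B v (x 0) = 0
  succ (i : ℕ) (v : V) : B (x i) v = B v (x (i + 1))
  bound (i : ℕ) : l ≤ i → x i = 0

/-- The terms of a null chain span a totally isotropic subspace. -/
theorem IsNullChain.apply_apply {B : LinearMap.BilinForm F V} {l : ℕ} {x : ℕ → V}
    (hx : IsNullChain B l x) (i j : ℕ) : B (x i) (x j) = 0 := by
  have h (p : ℕ) : B (x i) (x j) = B (x (i + p)) (x (j + p)) := by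
    induction p with
    | zero => rfl
    | succ p ih => rw [ih, hx.succ, hx.succ]; rfl
  rw [h l, hx.bound (i + l) (by omega), map_zero, LinearMap.zero_apply]

/-- If the bilinear form has no nonzero null chain with `m + 1` terms, then a nonzero vector of the
right kernel pairs nontrivially with the start of a chain `y 0, …, y m`. -/
theorem exists_dual_chain [FiniteDimensional F V] (B : LinearMap.BilinForm F V) (m : ℕ)
    (hmin : ∀ x, IsNullChain B (m + 1) x → x 0 = 0) (x₀ : V) (hx₀ : x₀ ≠ 0)
    (hker : ∀ v, B v x₀ = 0) :
    ∃ y : ℕ → V, B x₀ (y 0) = 1 ∧ ∀ j < m, ∀ v, B (y j) v = B v (y (j + 1)) := by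
  let T : (ℕ → V) →ₗ[F] (Fin m → Dual F V) × F :=
    (LinearMap.pi fun j : Fin m => B ∘ₗ LinearMap.proj (j : ℕ) -
      B.flip ∘ₗ LinearMap.proj ((j : ℕ) + 1)).prod (B x₀ ∘ₗ LinearMap.proj 0)
  by_cases hT : ((0, 1) : (Fin m → Dual F V) × F) ∈ LinearMap.range T
  · obtain ⟨y, hy⟩ := hT
    refine ⟨y, congrArg Prod.snd hy, fun j hj v => ?_⟩
    have := LinearMap.congr_fun (congrFun (congrArg Prod.fst hy) (⟨j, hj⟩ : Fin m)) v
    simpa [T, sub_eq_zero] using this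
  exfalso
  obtain ⟨L, hL0, hL⟩ := Submodule.exists_le_ker_of_notMem hT
  let w (j : ℕ) : V := if h : j < m then
    (evalEquiv F V).symm (L ∘ₗ LinearMap.inl F _ F ∘ₗ
      LinearMap.single F (fun _ => Dual F V) (⟨j, h⟩ : Fin m)) else 0
  have hw (j : Fin m) (φ : Dual F V) : φ (w j) = L (Pi.single j φ, 0) := by
    simp [w]
  let u : ℕ → V := fun i => Nat.casesOn i (L (0, 1) • x₀) (fun j => -w j)
  have hu0 : u 0 = L (0, 1) • x₀ := rfl
  have hus (j : ℕ) : u (j + 1) = -w j := rfl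
  have hub (i : ℕ) (hi : m + 1 ≤ i) : u i = 0 := by
    obtain ⟨j, rfl⟩ : ∃ j, i = j + 1 := ⟨i - 1, by omega⟩
    rw [hus]
    simp [w, show ¬ j < m by omega]
  have hLformula (g : Fin m → Dual F V) (c : F) :
      L (g, c) = ∑ j : Fin m, g j (w j) + c * L (0, 1) := by
    have hdecomp : (g, c) = ∑ j : Fin m, ((Pi.single j (g j), 0) : (Fin m → Dual F V) × F) +
        c • ((0, 1) : (Fin m → Dual F V) × F) := by
      ext1
      · simp [Prod.fst_sum, Finset.univ_sum_single]
      · simp [Prod.snd_sum]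
    rw [hdecomp, map_add, map_sum, map_smul, smul_eq_mul]
    simp [hw]
  have hsum (y : ℕ → V) :
      ∑ j ∈ Finset.range (m + 1), (B (u j) (y j) - B (y j) (u (j + 1))) = 0 := by
    have h0 : L (T y) = 0 := hL ⟨y, rfl⟩
    have h1 : T y = (fun j : Fin m => B (y j) - B.flip (y (j + 1)), B x₀ (y 0)) := rfl
    rw [h1, hLformula,
      ← Finset.sum_range (fun j => (B (y j) - B.flip (y (j + 1))) (w j))]
      at h0
    rw [Finset.sum_sub_distrib, Finset.sum_range_succ', Finset.sum_range_succ _ m, hu0,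
      hub (m + 1) le_rfl]
    simp only [LinearMap.sub_apply, LinearMap.BilinForm.flip_apply, Finset.sum_sub_distrib] at h0
    simp only [hus, map_neg, LinearMap.neg_apply, Finset.sum_neg_distrib, map_smul,
      LinearMap.smul_apply, smul_eq_mul, map_zero]
    linear_combination h0
  have hchain : IsNullChain B (m + 1) u := by
    refine ⟨fun v => by rw [hu0, map_smul, hker, smul_zero], fun i v => ?_, hub⟩
    by_cases hi : i < m + 1
    · have h := hsum (Pi.single i v)
      rw [Finset.sum_eq_single_of_mem i (Finset.mem_range.2 hi)] at h
      · simpa [sub_eq_zero] using h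
      · intro j _ hj
        simp [Pi.single_eq_of_ne hj]
    · rw [hub i (by omega), hub (i + 1) (by omega)]
      simp
  rcases smul_eq_zero.1 (hmin u hchain) with h | h
  exacts [hL0 h, hx₀ h]

/-- The range of `p` and the kernel of `q` are complementary when `q ∘ p` is injective. -/
theorem isCompl_range_ker {E : Type*} [AddCommGroup E] [Module F E] [FiniteDimensional F E]
    (p : E →ₗ[F] V) (q : V →ₗ[F] E) (h : Function.Injective (q ∘ₗ p)) :
    IsCompl (LinearMap.range p) (LinearMap.ker q) := by
  have hs := LinearMap.surjective_of_injective h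
  refine ⟨?_, ?_⟩
  · rw [Submodule.disjoint_def]
    rintro _ ⟨e, rfl⟩ he
    rw [h (by simpa using he : (q ∘ₗ p) e = (q ∘ₗ p) 0), map_zero]
  · rw [Submodule.codisjoint_iff_exists_add_eq]
    intro v
    obtain ⟨e, he⟩ := hs (q v)
    exact ⟨p e, v - p e, ⟨e, rfl⟩, by simpa [sub_eq_zero] using he.symm, by simp⟩

/-- A bilinear form with a nonzero null chain splits off an orthogonal summand of odd dimension. -/
theorem exists_isCompl_of_isNullChain [FiniteDimensional F V] (B : LinearMap.BilinForm F V)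
    {l : ℕ} {x : ℕ → V} (hx : IsNullChain B l x) (hx0 : x ≠ 0) :
    ∃ U W : Submodule F V, IsCompl U W ∧ (∀ u ∈ U, ∀ w ∈ W, B u w = 0) ∧
      (∀ u ∈ U, ∀ w ∈ W, B w u = 0) ∧ Odd (finrank F U) := by
  classical
  have hex : ∃ l x, IsNullChain B l x ∧ x ≠ 0 := ⟨l, x, hx, hx0⟩
  clear! l x
  obtain ⟨x, hx, hx0⟩ := Nat.find_spec hex
  have hmin (l' : ℕ) (hl' : l' < Nat.find hex) (z : ℕ → V) (hz : IsNullChain B l' z) : z = 0 := by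
    by_contra h
    exact Nat.find_min hex hl' ⟨z, hz, h⟩
  generalize Nat.find hex = l at hx hmin
  obtain _ | l := l
  · exact absurd (funext fun i => hx.bound i (Nat.zero_le i)) hx0
  have hx00 : x 0 ≠ 0 := by
    intro h
    have hshift := hmin l (Nat.lt_succ_self l) (fun i => x (i + 1))
      ⟨fun v => by rw [← hx.succ, h, map_zero, LinearMap.zero_apply], fun i v => hx.succ _ v,
        fun i hi => hx.bound _ (by omega)⟩
    refine hx0 (funext fun i => ?_)
    cases i with
    | zero => exact h
    | succ i => exact congrFun hshift i
  obtain _ | m := l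
  · obtain ⟨W, hW⟩ := Submodule.exists_isCompl (F ∙ x 0)
    refine ⟨F ∙ x 0, W, hW, ?_, ?_, by rw [finrank_span_singleton hx00]; exact odd_one⟩
    all_goals
      intro u hu w _
      obtain ⟨c, rfl⟩ := Submodule.mem_span_singleton.1 hu
      simp [hx.zero, hx.succ, hx.bound 1 le_rfl]
  obtain ⟨y, hy0, hy⟩ := exists_dual_chain B m
    (fun z hz => congrFun (hmin (m + 1) (Nat.lt_succ_self _) z hz) 0) (x 0) hx00 hx.zero
  have hxy_last (i : ℕ) (hi : m + 1 ≤ i) (v : V) : B (x i) v = 0 := by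
    rw [hx.succ, hx.bound (i + 1) (by omega), map_zero]
  have hxy_step (i j : ℕ) (hj : j < m) : B (x i) (y j) = B (x (i + 1)) (y (j + 1)) := by
    rw [hx.succ, hy j hj]
  have hxy_add (p i j : ℕ) (hj : j + p ≤ m) : B (x i) (y j) = B (x (i + p)) (y (j + p)) := by
    induction p with
    | zero => rfl
    | succ p ih => rw [ih (by omega), hxy_step _ _ (by omega)]; rfl
  have hxy (i j : ℕ) (hj : j ≤ m) : B (x i) (y j) = if i = j then 1 else 0 := by
    rcases lt_trichotomy i j with h | rfl | h
    · obtain ⟨d, rfl⟩ := Nat.exists_eq_add_of_lt h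
      have := hxy_add i 0 (d + 1) (by omega)
      rw [Nat.zero_add, show d + 1 + i = i + d + 1 by omega] at this
      rw [if_neg h.ne, ← this, ← hy d (by omega), hx.zero]
    · have := hxy_add i 0 0 (by omega)
      rw [Nat.zero_add] at this
      rw [if_pos rfl, ← this, hy0]
    · rw [if_neg h.ne', hxy_add (m - j) i j (by omega), hxy_last _ (by omega)]
  let ψ (i : ℕ) : Dual F V := Nat.casesOn i (B.flip (y 0)) fun j => B (y j)
  have hψ_succ (j : ℕ) : ψ (j + 1) = B (y j) := rfl
  have hψ (j : ℕ) (hj : j ≤ m) (v : V) : ψ j v = B v (y j) := by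
    cases j with
    | zero => rfl
    | succ j => rw [hψ_succ, hy j (by omega)]
  have hψx (i j : ℕ) (hi : i ≤ m + 1) : ψ i (x j) = if j = i then 1 else 0 := by
    cases i with
    | zero => rw [hψ 0 (by omega), hxy _ _ (by omega)]
    | succ i =>
      rw [hψ_succ]
      cases j with
      | zero => simp [hx.zero]
      | succ j => rw [← hx.succ, hxy _ _ (by omega)]; simp
  let p : ((Fin (m + 2) → F) × (Fin (m + 1) → F)) →ₗ[F] V :=
    (Fintype.linearCombination F fun i : Fin (m + 2) => x i).coprod
      (Fintype.linearCombination F fun j : Fin (m + 1) => y j)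
  let q : V →ₗ[F] ((Fin (m + 2) → F) × (Fin (m + 1) → F)) :=
    (LinearMap.pi fun i : Fin (m + 2) => ψ i).prod (LinearMap.pi fun j : Fin (m + 1) => B (x j))
  have hp (a : Fin (m + 2) → F) (e : Fin (m + 1) → F) :
      p (a, e) = ∑ i, a i • x i + ∑ j, e j • y j := rfl
  have hinj : Function.Injective (q ∘ₗ p) := by
    rw [← LinearMap.ker_eq_bot, LinearMap.ker_eq_bot']
    rintro ⟨a, e⟩ h
    have he : e = 0 := by
      funext j
      have hj : B (x j) (p (a, e)) = 0 := congrFun (congrArg Prod.snd h) j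
      have hxy' (k : Fin (m + 1)) : B (x j) (y k) = if k = j then 1 else 0 := by
        rw [hxy _ _ (by omega)]
        simp [Fin.ext_iff, eq_comm]
      simpa [hp, hx.apply_apply, hxy'] using hj
    have ha : a = 0 := by
      funext i
      have hi : ψ i (p (a, e)) = 0 := congrFun (congrArg Prod.fst h) i
      have hψx' (k : Fin (m + 2)) : ψ i (x k) = if k = i then 1 else 0 := by
        rw [hψx _ _ (by omega)]
        simp [Fin.ext_iff]
      simpa [hp, he, hψx'] using hi
    rw [ha, he, Prod.mk_zero_zero]
  have hpinj : Function.Injective p := Function.Injective.of_comp (f := q) hinj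
  have hq (w : V) (hw : w ∈ LinearMap.ker q) :
      (∀ i ≤ m + 1, ψ i w = 0) ∧ ∀ i, B (x i) w = 0 := by
    refine ⟨fun i hi => congrFun (congrArg Prod.fst (LinearMap.mem_ker.1 hw))
      (⟨i, by omega⟩ : Fin (m + 2)), fun i => ?_⟩
    by_cases hi : i < m + 1
    · exact congrFun (congrArg Prod.snd (LinearMap.mem_ker.1 hw)) (⟨i, hi⟩ : Fin (m + 1))
    · exact hxy_last i (by omega) w
  refine ⟨LinearMap.range p, LinearMap.ker q, isCompl_range_ker p q hinj, ?_, ?_, ?_⟩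
  · rintro _ ⟨⟨a, e⟩, rfl⟩ w hw
    obtain ⟨h₁, h₂⟩ := hq w hw
    have h₃ (j : Fin (m + 1)) : B (y j) w = 0 := h₁ (j + 1) (by omega)
    simp [hp, h₂, h₃]
  · rintro _ ⟨⟨a, e⟩, rfl⟩ w hw
    obtain ⟨h₁, h₂⟩ := hq w hw
    have h₃ (j : Fin (m + 1)) : B w (y j) = 0 := by
      rw [← hψ j (by omega), h₁ j (by omega)]
    have h₄ (i : ℕ) : B w (x i) = 0 := by
      cases i with
      | zero => exact hx.zero w
      | succ i => rw [← hx.succ, h₂]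
    simp [hp, h₃, h₄]
  · rw [LinearMap.finrank_range_of_inj hpinj, finrank_prod, finrank_fin_fun, finrank_fin_fun]
    exact ⟨m + 1, by ring⟩

/-- A null vector of the pencil `M - X • Mᵀ` yields a null chain. -/
theorem exists_isNullChain_of_det_eq_zero {n : ℕ} (M : Matrix (Fin n) (Fin n) F)
    (hM : (M.map C - (X : F[X]) • Mᵀ.map C).det = 0) :
    ∃ l x, IsNullChain M.toBilin' l x ∧ x ≠ 0 := by
  obtain ⟨v, hv0, hv⟩ := Matrix.exists_mulVec_eq_zero_iff.2 hM
  let x (k : ℕ) : Fin n → F := fun i => (v i).coeff k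
  have hC (N : Matrix (Fin n) (Fin n) F) (i : Fin n) (k : ℕ) :
      ((N.map C *ᵥ v) i).coeff k = (N *ᵥ x k) i := by
    simp [Matrix.mulVec, dotProduct, x]
  have hv' : M.map C *ᵥ v = (X : F[X]) • (Mᵀ.map C *ᵥ v) := by
    rwa [Matrix.sub_mulVec, sub_eq_zero, Matrix.smul_mulVec] at hv
  have h0 : M *ᵥ x 0 = 0 := by
    ext i
    rw [← hC, hv']
    simp
  have hs (k : ℕ) : Mᵀ *ᵥ x k = M *ᵥ x (k + 1) := by
    ext i
    rw [← hC, ← hC, hv']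
    simp
  refine ⟨Finset.univ.sup (fun i => (v i).natDegree) + 1, x, ⟨fun w => ?_, fun k w => ?_, ?_⟩, ?_⟩
  · rw [Matrix.toBilin'_apply', h0, dotProduct_zero]
  · rw [Matrix.toBilin'_apply', Matrix.toBilin'_apply', ← hs, Matrix.mulVec_transpose,
      Matrix.dotProduct_mulVec, dotProduct_comm]
  · intro k hk
    funext i
    have : (v i).natDegree ≤ _ := Finset.le_sup (f := fun i => (v i).natDegree) (Finset.mem_univ i)
    exact Polynomial.coeff_eq_zero_of_natDegree_lt (by omega)
  · intro h
    refine hv0 (funext fun i => Polynomial.ext fun k => ?_)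
    exact congrFun (congrFun h k) i

end

/-- `M ∈ Ξ_n(F)` iff `M` is not congruent to `A ⊕ B` with `A` square of odd size. -/
theorem stmt_0 {F : Type*} [Field F] (hchar : (2 : F) ≠ 0) {n : ℕ}
    (M : Matrix (Fin n) (Fin n) F) :
    XiMem M ↔
      ¬ ∃ (r s : ℕ) (h : r + s = n) (A : Matrix (Fin r) (Fin r) F)
          (B : Matrix (Fin s) (Fin s) F), Odd r ∧
          MatCongruent M (Matrix.reindex (finCongr h) (finCongr h) (dSum A B)) := by
  refine ⟨fun hXi => ?_, fun h => ?_⟩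
  · rintro ⟨r, s, h, A, B, hr, hM⟩
    exact not_xiMem_of_congruent_dSum hchar M h A B hr hM hXi
  · by_contra hXi
    apply h
    by_cases hM : (M.map C - (X : F[X]) • Mᵀ.map C).det = 0
    · obtain ⟨l, x, hx, hx0⟩ := exists_isNullChain_of_det_eq_zero M hM
      obtain ⟨U, W, hUW, h₁, h₂, hU⟩ := exists_isCompl_of_isNullChain M.toBilin' hx hx0
      exact exists_congruent_dSum_of_isCompl M hUW h₁ h₂ hU
    · unfold XiMem at hXi
      push Not at hXi
      obtain ⟨S, -, hS, hdet⟩ := hXi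
      have hf (x y : Fin n → F) :
          M.toBilin' (Matrix.toLin' S x) (Matrix.toLin' S y) = M.toBilin' x y := by
        rw [Matrix.toBilin'_apply', Matrix.toBilin'_apply', Matrix.toLin'_apply,
          Matrix.toLin'_apply]
        conv_rhs => rw [← hS, ← Matrix.mulVec_mulVec, ← Matrix.mulVec_mulVec,
          Matrix.dotProduct_mulVec, Matrix.vecMul_transpose]
      obtain ⟨W, hUW, h₁, h₂⟩ := exists_isCompl_of_isometry M.toBilin' (Matrix.toLin' S) hf
      refine exists_congruent_dSum_of_isCompl M hUW h₁ h₂ ?_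
      rw [LinearMap.finrank_maxGenEigenspace_eq, Matrix.charpoly_toLin']
      rw [det_eq_of_regular M S hM hS] at hdet
      by_contra hodd
      exact hdet (Nat.not_odd_iff_even.1 hodd).neg_one_pow
end

section
/- Let F be a field of characteristic different from 2 and let M be an n×n matrix over F. Then M ∉ Ξ_n(F) if and only if M has a direct summand for congruence that is either (a) an invertible matrix Q such that Q^{-T}Q is similar to the Jordan block J_r(1) with r odd, or (b) the singular Jordan block J_s(0) with s odd. -/
open Matrix Polynomial

variable {F : Type*} [Field F]

open LinearMap (BilinForm)
open Module (finrank Dual End)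

section Asymmetry

variable {V : Type*} [AddCommGroup V] [Module F V] {f : BilinForm F V} {A : End F V}

theorem apply_asymmetry_asymmetry (hA : ∀ x y, f x y = f (A y) x) (x y : V) :
    f (A x) (A y) = f x y := by
  rw [hA x y, hA (A y) x]

theorem asymmetry_sub_one_pow_comm (A : End F V) (k l : ℕ) (x : V) :
    ((A - 1) ^ k) ((A ^ l) x) = (A ^ l) (((A - 1) ^ k) x) := by
  have h : Commute ((A - 1) ^ k) (A ^ l) :=
    (((Commute.refl A).sub_left (Commute.one_left A)).pow_pow k l)
  exact congrArg (fun g : End F V => g x) h.eq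

theorem apply_sub_one_pow (hA : ∀ x y, f x y = f (A y) x) (k : ℕ) (x y : V) :
    f x (((A - 1) ^ k) y) = (-1) ^ k * f (((A - 1) ^ k) x) ((A ^ k) y) := by
  have h1 (x y : V) : f x ((A - 1) y) = - f ((A - 1) x) (A y) := by
    simp [apply_asymmetry_asymmetry hA]
  induction k generalizing y with
  | zero => simp
  | succ k ih =>
    rw [pow_succ, Module.End.mul_apply, ih]
    have := asymmetry_sub_one_pow_comm A 1 k y
    rw [pow_one] at this
    rw [← this, h1, ← Module.End.mul_apply (A - 1), ← pow_succ', ← Module.End.mul_apply A,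
      ← pow_succ', pow_succ, pow_succ]
    ring

theorem asymmetry_apply_of_sub_one_apply_eq_zero {y : V} (hy : (A - 1) y = 0) : A y = y := by
  simpa [sub_eq_zero] using hy

theorem apply_pow_of_sub_one_apply_eq_zero (hA : ∀ x y, f x y = f (A y) x) {y : V}
    (hy : (A - 1) y = 0) (k : ℕ) (x : V) : f y ((A ^ k) x) = f y x := by
  induction k with
  | zero => simp
  | succ k ih =>
    rw [pow_succ', Module.End.mul_apply, ← ih]
    conv_lhs => rw [← asymmetry_apply_of_sub_one_apply_eq_zero hy]
    exact apply_asymmetry_asymmetry hA _ _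

/-- On `ker (A - 1) ^ (k + 1)` the form `f x ((A - 1) ^ k y)` is symmetric for even `k`. -/
theorem apply_sub_one_pow_symm (hA : ∀ x y, f x y = f (A y) x) {k : ℕ} (hk : Even k) {x y : V}
    (hy : ((A - 1) ^ (k + 1)) y = 0) :
    f x (((A - 1) ^ k) y) = f y (((A - 1) ^ k) x) ∧
      f x (((A - 1) ^ k) y) = f (((A - 1) ^ k) y) x := by
  have h0 : (A - 1) (((A - 1) ^ k) y) = 0 := by
    rwa [← Module.End.mul_apply, ← pow_succ']
  have h1 : f x (((A - 1) ^ k) y) = f (((A - 1) ^ k) y) x := by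
    rw [hA, asymmetry_apply_of_sub_one_apply_eq_zero h0]
  refine ⟨?_, h1⟩
  rw [h1, apply_sub_one_pow hA k y x, hk.neg_one_pow, one_mul,
    apply_pow_of_sub_one_apply_eq_zero hA h0]

/-- A finite-dimensional space with a nondegenerate alternating form has even dimension. -/
theorem even_finrank_of_skew [FiniteDimensional F V] (hchar : (2 : F) ≠ 0) (g : BilinForm F V)
    (hg : LinearMap.SeparatingLeft g) (hskew : ∀ x y, g x y = - g y x) :
    Even (finrank F V) := by
  by_contra hodd
  rw [Nat.not_even_iff_odd] at hodd
  let b := Module.finBasis F V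
  have hG := (LinearMap.BilinForm.nondegenerate_iff_det_ne_zero b).1 (.ofSeparatingLeft hg)
  have hT : (LinearMap.BilinForm.toMatrix b g)ᵀ = - LinearMap.BilinForm.toMatrix b g := by
    ext i j
    simpa [LinearMap.BilinForm.toMatrix_apply] using hskew (b j) (b i)
  have hdet := congrArg Matrix.det hT
  rw [Matrix.det_transpose, Matrix.det_neg, Fintype.card_fin, hodd.neg_one_pow] at hdet
  exact mul_ne_zero hchar hG (by linear_combination hdet)

/-- `f` is the orthogonal sum of a form with Gram matrix `Q` and some other form. -/
def OrthSummand (f : BilinForm F V) {r : ℕ} (Q : Matrix (Fin r) (Fin r) F) : Prop :=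
  ∃ (e : Fin r → V) (Z : Submodule F V), LinearIndependent F e ∧
    (∀ i j, f (e i) (e j) = Q i j) ∧ IsCompl (Submodule.span F (Set.range e)) Z ∧
    ∀ i, ∀ z ∈ Z, f (e i) z = 0 ∧ f z (e i) = 0

theorem OrthSummand.of_sup_eq_top {r : ℕ} {Q : Matrix (Fin r) (Fin r) F} {e : Fin r → V}
    {Z : Submodule F V} (hli : LinearIndependent F e) (hQ : ∀ i j, f (e i) (e j) = Q i j)
    (hsup : Submodule.span F (Set.range e) ⊔ Z = ⊤)
    (horth : ∀ i, ∀ z ∈ Z, f (e i) z = 0 ∧ f z (e i) = 0) : OrthSummand f Q := by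
  set W := Submodule.span F (Set.range e)
  obtain ⟨C, hC⟩ := Submodule.exists_isCompl (W ⊓ Z)
  refine ⟨e, C ⊓ Z, hli, hQ, ⟨?_, ?_⟩, fun i z hz => horth i z hz.2⟩
  · rw [disjoint_iff, inf_comm C, ← inf_assoc]
    exact hC.inf_eq_bot
  · have hZ : W ⊓ Z ⊔ C ⊓ Z = Z := by
      rw [← sup_inf_assoc_of_le _ inf_le_right, hC.sup_eq_top, top_inf_eq]
    rw [codisjoint_iff, eq_top_iff, ← hsup]
    refine sup_le le_sup_left ?_
    conv_lhs => rw [← hZ]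
    exact sup_le_sup_right inf_le_left _

theorem OrthSummand.of_restrict {r : ℕ} {Q : Matrix (Fin r) (Fin r) F} {W Z : Submodule F V}
    (hWZ : W ⊔ Z = ⊤) (horth : ∀ w ∈ W, ∀ z ∈ Z, f w z = 0 ∧ f z w = 0)
    (h : OrthSummand (f.restrict W) Q) : OrthSummand f Q := by
  obtain ⟨e, Y, hli, hQ, hc, he⟩ := h
  refine .of_sup_eq_top (e := fun i => (e i : V)) (Z := Y.map W.subtype ⊔ Z)
    (hli.map' W.subtype W.ker_subtype) hQ ?_ ?_
  · have : Submodule.span F (Set.range fun i => (e i : V)) =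
        (Submodule.span F (Set.range e)).map W.subtype := by
      rw [Submodule.map_span, ← Set.range_comp]; rfl
    rw [this, ← sup_assoc, ← Submodule.map_sup, hc.sup_eq_top, Submodule.map_subtype_top, hWZ]
  · intro i z hz
    obtain ⟨_, ⟨y, hy, rfl⟩, z, hz', rfl⟩ := Submodule.mem_sup.1 hz
    have h1 := he i y hy
    have h2 := horth _ (e i).2 z hz'
    simp only [LinearMap.BilinForm.restrict_apply, LinearMap.domRestrict_apply] at h1
    simp [h1.1, h1.2, h2.1, h2.2]

/-- A form of odd order Jordan type splits off `f`. -/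
def HasOddSummand (f : BilinForm F V) : Prop :=
  (∃ r : ℕ, Odd r ∧ ∃ Q : Matrix (Fin r) (Fin r) F, IsUnit Q ∧
    MatSimilar (Q⁻¹ᵀ * Q) (jordanBlock r (1 : F)) ∧ OrthSummand f Q) ∨
  (∃ s : ℕ, Odd s ∧ OrthSummand f (jordanBlock s (0 : F)))

theorem HasOddSummand.of_restrict {W Z : Submodule F V} (hWZ : W ⊔ Z = ⊤)
    (horth : ∀ w ∈ W, ∀ z ∈ Z, f w z = 0 ∧ f z w = 0) (h : HasOddSummand (f.restrict W)) :
    HasOddSummand f := by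
  rcases h with ⟨r, hr, Q, hQ, hs, h⟩ | ⟨s, hs, h⟩
  · exact .inl ⟨r, hr, Q, hQ, hs, h.of_restrict hWZ horth⟩
  · exact .inr ⟨s, hs, h.of_restrict hWZ horth⟩

theorem hasOddSummand_of_block (hA : ∀ x y, f x y = f (A y) x) {k : ℕ} {x : V} (hk : Even k)
    (hx : ((A - 1) ^ (k + 1)) x = 0) (hne : f x (((A - 1) ^ k) x) ≠ 0) : HasOddSummand f := by
  set N := A - 1 with hN
  let e : Fin (k + 1) → V := fun i => (N ^ (i : ℕ)) x
  let Q : Matrix (Fin (k + 1)) (Fin (k + 1)) F := Matrix.of fun i j => f (e i) (e j)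
  have hN0 (l : ℕ) (hl : k + 1 ≤ l) : (N ^ l) x = 0 := by
    rw [← Nat.sub_add_cancel hl, pow_add, Module.End.mul_apply, hx, map_zero]
  have hNe (j : Fin (k + 1)) (m : ℕ) : (N ^ m) (e j) = (N ^ (m + j)) x := by
    rw [pow_add, Module.End.mul_apply]
  have hAe (j : Fin (k + 1)) : A (e j) = ∑ l, jordanBlock (k + 1) (1 : F) l j • e l := by
    have h1 : A (e j) = e j + (N ^ (j + 1 : ℕ)) x := by
      have : (N ^ (j + 1 : ℕ)) x = N (e j) := by rw [pow_succ', Module.End.mul_apply]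
      rw [this]; simp [hN]
    have h2 (l : Fin (k + 1)) : jordanBlock (k + 1) (1 : F) l j • e l =
        (if l = j then e j else 0) + if (l : ℕ) = j + 1 then e l else 0 := by
      by_cases hl : l = j
      · subst hl; simp [jordanBlock]
      · have hl' : (l : ℕ) ≠ j := fun h => hl (Fin.ext h)
        simp [jordanBlock, hl, hl', ite_smul]
    rw [h1, Finset.sum_congr rfl fun l _ => h2 l, Finset.sum_add_distrib]
    congr 1
    · simp
    · by_cases hj : (j : ℕ) + 1 < k + 1
      · rw [Finset.sum_eq_single ⟨j + 1, hj⟩]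
        · simp [e]
        · intro b _ hb
          rw [if_neg fun h => hb (Fin.ext h)]
        · simp
      · rw [hN0 _ (by omega), Finset.sum_eq_zero]
        intro l _
        rw [if_neg (by omega)]
  have hAspan : ∀ w ∈ Submodule.span F (Set.range e), A w ∈ Submodule.span F (Set.range e) := by
    intro w hw
    rw [← Submodule.mem_comap]
    refine (Submodule.span_le.2 ?_) hw
    rintro _ ⟨j, rfl⟩
    rw [SetLike.mem_coe, Submodule.mem_comap, hAe]
    exact Submodule.sum_mem _ fun l _ => Submodule.smul_mem _ _ (Submodule.subset_span ⟨l, rfl⟩)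
  have hker (c : Fin (k + 1) → F) (hc : ∀ j, f (∑ i, c i • e i) (e j) = 0) : c = 0 := by
    by_contra hc0
    classical
    obtain ⟨i₀, hi₀, hmin⟩ : ∃ i₀, c i₀ ≠ 0 ∧ ∀ i < i₀, c i = 0 := by
      have hne : (Finset.univ.filter fun i => c i ≠ 0).Nonempty := by
        obtain ⟨i, hi⟩ := Function.ne_iff.1 hc0
        exact ⟨i, by simpa using hi⟩
      refine ⟨_, (Finset.mem_filter.1 (Finset.min'_mem _ hne)).2, fun i hi => ?_⟩
      by_contra h
      exact absurd (Finset.min'_le _ i (by simpa using h)) (not_le.2 hi)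
    set w := ∑ i, c i • e i with hw
    set m := k - i₀ with hm
    have h1 : (N ^ m) w = c i₀ • (N ^ k) x := by
      rw [hw, map_sum, Finset.sum_eq_single i₀]
      · rw [map_smul, hNe, show m + (i₀ : ℕ) = k by omega]
      · intro i _ hi
        rcases lt_or_gt_of_ne hi with h | h
        · rw [hmin i h, zero_smul, map_zero]
        · rw [map_smul, hNe, hN0 _ (by have : (i₀ : ℕ) < i := h; omega), smul_zero]
      · simp
    have h2 : f w ((N ^ m) x) = 0 := by
      have := hc ⟨m, by omega⟩
      exact this
    have h0 : N ((N ^ k) x) = 0 := by rwa [← Module.End.mul_apply, ← pow_succ']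
    rw [apply_sub_one_pow hA, h1, map_smul, LinearMap.smul_apply,
      apply_pow_of_sub_one_apply_eq_zero hA h0, ← (apply_sub_one_pow_symm hA hk hx).2] at h2
    simp only [smul_eq_mul, mul_eq_zero, hi₀, false_or] at h2
    exact hne (h2.resolve_left (pow_ne_zero _ (by simp)))
  have hcQ (c : Fin (k + 1) → F) (j : Fin (k + 1)) :
      (c ᵥ* Q) j = f (∑ i, c i • e i) (e j) := by
    simp [Matrix.vecMul, dotProduct, Q]
  have hQ : IsUnit Q := by
    rw [← Matrix.vecMul_injective_iff_isUnit]
    rw [← Matrix.coe_vecMulLinear, ← LinearMap.ker_eq_bot, LinearMap.ker_eq_bot']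
    intro c hc
    refine hker c fun j => ?_
    rw [← hcQ]
    exact congrFun hc j
  have hQdet : IsUnit Q.det := (Matrix.isUnit_iff_isUnit_det Q).1 hQ
  refine .inl ⟨k + 1, hk.add_one, Q, hQ, ⟨1, isUnit_one, ?_⟩, ?_⟩
  · have hQJ : Q = Qᵀ * jordanBlock (k + 1) (1 : F) := by
      ext i j
      rw [Matrix.mul_apply]
      change f (e i) (e j) = ∑ l, f (e l) (e i) * _
      rw [hA, hAe, map_sum, LinearMap.sum_apply]
      simp [mul_comm]
    rw [inv_one, one_mul, mul_one]
    nth_rewrite 2 [hQJ]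
    rw [← Matrix.mul_assoc, Matrix.transpose_nonsing_inv,
      Matrix.nonsing_inv_mul _ (by rwa [Matrix.det_transpose]), Matrix.one_mul]
  · refine .of_sup_eq_top (e := e)
      (Z := { carrier := {z | ∀ i, f (e i) z = 0}, zero_mem' := by simp,
              add_mem' := fun ha hb i => by simp [ha i, hb i],
              smul_mem' := fun a x hx i => by simp [hx i] }) ?_ (fun _ _ => rfl) ?_ ?_
    · rw [Fintype.linearIndependent_iff]
      intro c hc
      exact congrFun (hker c fun j => by rw [hc, map_zero, LinearMap.zero_apply])
    · rw [eq_top_iff]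
      rintro v -
      let c := Q⁻¹ *ᵥ fun i => f (e i) v
      have hc : Q *ᵥ c = fun i => f (e i) v := by
        rw [Matrix.mulVec_mulVec, Matrix.mul_nonsing_inv _ hQdet, Matrix.one_mulVec]
      refine Submodule.mem_sup.2 ⟨∑ i, c i • e i, ?_, v - ∑ i, c i • e i, fun i => ?_, by simp⟩
      · exact Submodule.sum_mem _ fun l _ =>
          Submodule.smul_mem _ _ (Submodule.subset_span ⟨l, rfl⟩)
      · have := congrFun hc i
        simp only [Matrix.mulVec, dotProduct, Q, Matrix.of_apply] at this
        rw [map_sub, ← this, map_sum, sub_eq_zero]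
        simp [mul_comm]
    · intro i z hz
      refine ⟨hz i, ?_⟩
      have hz' : ∀ w ∈ Submodule.span F (Set.range e), f w z = 0 := by
        intro w hw
        have : Submodule.span F (Set.range e) ≤ LinearMap.ker (f.flip z) := by
          rw [Submodule.span_le]
          rintro _ ⟨j, rfl⟩
          exact hz j
        exact this hw
      rw [hA]
      exact hz' _ (hAspan _ (Submodule.subset_span ⟨i, rfl⟩))

variable [FiniteDimensional F V]

theorem exists_asymmetry (f : BilinForm F V) (hf : LinearMap.SeparatingLeft f) :
    ∃ A : End F V, Function.Surjective A ∧ ∀ x y, f x y = f (A y) x := by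
  have hinj : Function.Injective f := by
    rw [← LinearMap.ker_eq_bot, LinearMap.ker_eq_bot']
    intro x hx
    exact hf x fun y => by rw [hx]; rfl
  let e : V ≃ₗ[F] Dual F V :=
    LinearEquiv.ofInjectiveOfFinrankEq f hinj (Subspace.dual_finrank_eq).symm
  have he (x : V) : e x = f x := rfl
  refine ⟨e.symm.toLinearMap ∘ₗ f.flip, ?_, ?_⟩
  · rw [← LinearMap.injective_iff_surjective, ← LinearMap.ker_eq_bot, LinearMap.ker_eq_bot']
    intro y hy
    have hy' : f.flip y = 0 := by simpa using hy
    refine (Module.forall_dual_apply_eq_zero_iff F y).1 fun φ => ?_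
    obtain ⟨x, rfl⟩ := e.surjective φ
    exact LinearMap.congr_fun hy' x
  · intro x y
    have := he (e.symm (f.flip y))
    rw [LinearEquiv.apply_symm_apply] at this
    exact LinearMap.congr_fun this x

theorem mem_range_sub_one_pow (hA : ∀ x y, f x y = f (A y) x)
    (hf : LinearMap.SeparatingLeft f) (hsurj : Function.Surjective A) {k : ℕ} {y : V}
    (hy : ∀ z, ((A - 1) ^ k) z = 0 → f z y = 0) : y ∈ LinearMap.range ((A - 1) ^ k) := by
  by_contra hmem
  obtain ⟨φ, hφ, hle⟩ := Submodule.exists_le_ker_of_notMem hmem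
  have hinj : Function.Injective f := by
    rw [← LinearMap.ker_eq_bot, LinearMap.ker_eq_bot']
    intro x hx
    exact hf x fun y => by rw [hx]; rfl
  obtain ⟨z, rfl⟩ := (LinearMap.injective_iff_surjective_of_finrank_eq_finrank
    (Subspace.dual_finrank_eq (K := F) (V := V)).symm).1 hinj φ
  refine hφ (hy z (hf _ fun v => ?_))
  have hs : Function.Surjective (A ^ k) := by
    rw [Module.End.coe_pow]; exact hsurj.iterate k
  obtain ⟨w, rfl⟩ := hs v
  have h : f z (((A - 1) ^ k) w) = 0 := hle (LinearMap.mem_range_self _ w)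
  rw [apply_sub_one_pow hA] at h
  exact (mul_eq_zero.1 h).resolve_left (pow_ne_zero _ (by simp))

theorem finrank_map_add_finrank_ker_inf {V' : Type*} [AddCommGroup V'] [Module F V']
    (N : V →ₗ[F] V') (W : Submodule F V) :
    finrank F (W.map N) + finrank F (LinearMap.ker N ⊓ W : Submodule F V) = finrank F W := by
  rw [← (N.domRestrict W).finrank_range_add_finrank_ker, LinearMap.range_domRestrict,
    LinearMap.ker_domRestrict, inf_comm, ← Submodule.map_comap_subtype,
    Submodule.finrank_map_subtype_eq]

theorem exists_odd_block (hchar : (2 : F) ≠ 0) (hA : ∀ x y, f x y = f (A y) x)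
    (hf : LinearMap.SeparatingLeft f) (hsurj : Function.Surjective A)
    (hodd : Odd (finrank F V)) :
    ∃ (k : ℕ) (x : V), Even k ∧ ((A - 1) ^ (k + 1)) x = 0 ∧ f x (((A - 1) ^ k) x) ≠ 0 := by
  by_contra! H
  set N := A - 1 with hN
  have hpol (k : ℕ) (hk : Even k) (x y : V) (hx : (N ^ (k + 1)) x = 0)
      (hy : (N ^ (k + 1)) y = 0) : f x ((N ^ k) y) = 0 := by
    have h := H k (x + y) hk (by rw [map_add, hx, hy, add_zero])
    simp only [map_add, LinearMap.add_apply, H k x hk hx, H k y hk hy] at h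
    have h' : (2 : F) * f x ((N ^ k) y) = 0 := by
      linear_combination h + (apply_sub_one_pow_symm hA hk hy).1
    exact (mul_eq_zero.1 h').resolve_left hchar
  have hmap (k : ℕ) : (LinearMap.range (N ^ k)).map N = LinearMap.range (N ^ (k + 1)) := by
    rw [pow_succ', Module.End.mul_eq_comp, LinearMap.range_comp]
  have hker (k : ℕ) (hk : Even k) : (LinearMap.ker N ⊓ LinearMap.range (N ^ k) : Submodule F V) =
      LinearMap.ker N ⊓ LinearMap.range (N ^ (k + 1)) := by
    apply le_antisymm
    · rintro _ ⟨hx, x, rfl⟩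
      refine ⟨hx, mem_range_sub_one_pow hA hf hsurj fun z hz => hpol k hk z x hz ?_⟩
      rwa [pow_succ', Module.End.mul_apply]
    · refine inf_le_inf_left _ ?_
      rw [pow_succ, Module.End.mul_eq_comp]
      exact LinearMap.range_comp_le_range _ _
  have hstep (k : ℕ) : Even (finrank F (LinearMap.range (N ^ (2 * k)))) ↔
      Even (finrank F V) := by
    induction k with
    | zero => rw [mul_zero, pow_zero, Module.End.one_eq_id, LinearMap.range_id, finrank_top]
    | succ k ih =>
      have h1 := finrank_map_add_finrank_ker_inf N (LinearMap.range (N ^ (2 * k)))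
      have h2 := finrank_map_add_finrank_ker_inf N (LinearMap.range (N ^ (2 * k + 1)))
      rw [hmap, hker _ (even_two_mul k)] at h1
      rw [hmap] at h2
      rw [← ih, show 2 * (k + 1) = 2 * k + 1 + 1 by ring]
      simp only [Nat.even_iff]
      omega
  obtain ⟨K, hK⟩ := Filter.eventually_atTop.1 N.eventually_isCompl_ker_pow_range_pow
  have hcompl := hK (2 * (K + 1)) (by omega)
  refine Nat.not_even_iff_odd.2 hodd ((hstep (K + 1)).1 ?_)
  set W := LinearMap.range (N ^ (2 * (K + 1))) with hW
  have hNW (w : V) (hw : w ∈ W) : N w ∈ W := by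
    obtain ⟨v, rfl⟩ := hw
    exact ⟨N v, by rw [← Module.End.mul_apply, ← Module.End.mul_apply, pow_mul_comm']⟩
  have hNinj (w : V) (hw : w ∈ W) (h0 : (N ^ (2 * (K + 1))) w = 0) : w = 0 :=
    (Submodule.disjoint_def.1 hcompl.disjoint) w h0 hw
  have hWsep (w : V) (hw : w ∈ W) (h : ∀ v ∈ W, f w v = 0) : w = 0 := by
    refine hNinj w hw (hf _ fun v => ?_)
    have hs : Function.Surjective (A ^ (2 * (K + 1))) := by
      rw [Module.End.coe_pow]; exact hsurj.iterate _
    obtain ⟨v, rfl⟩ := hs v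
    have := h _ (LinearMap.mem_range_self (N ^ (2 * (K + 1))) v)
    rw [apply_sub_one_pow hA] at this
    exact (mul_eq_zero.1 this).resolve_left (pow_ne_zero _ (by simp))
  refine even_finrank_of_skew hchar ((f - f.flip).restrict W) ?_ ?_
  · rintro ⟨y, hy⟩ h
    have h1 : N y = 0 := by
      refine hWsep _ (hNW y hy) fun v hv => ?_
      have := h ⟨v, hv⟩
      simp only [LinearMap.BilinForm.restrict_apply, LinearMap.domRestrict_apply,
        LinearMap.sub_apply, LinearMap.BilinForm.flip_apply, hA v y] at this
      simp only [hN, LinearMap.sub_apply, map_sub, Module.End.one_apply]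
      linear_combination -this
    refine Subtype.ext (hNinj y hy ?_)
    rw [← Nat.sub_add_cancel (by omega : 1 ≤ 2 * (K + 1)), pow_succ, Module.End.mul_apply, h1,
      map_zero]
  · rintro ⟨x, hx⟩ ⟨y, hy⟩
    simp

theorem hasOddSummand_of_odd_finrank (hchar : (2 : F) ≠ 0) (hf : LinearMap.SeparatingLeft f)
    (hodd : Odd (finrank F V)) : HasOddSummand f := by
  obtain ⟨A, hsurj, hA⟩ := exists_asymmetry f hf
  obtain ⟨k, x, hk, hx, hne⟩ := exists_odd_block hchar hA hf hsurj hodd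
  exact hasOddSummand_of_block hA hk hx hne

end Asymmetry

section Isometry

variable {V : Type*} [AddCommGroup V] [Module F V] {f : BilinForm F V} {S : End F V}

theorem det_eq_mul_of_isCompl [FiniteDimensional F V] {W Z : Submodule F V} (h : IsCompl W Z)
    (hW : ∀ w ∈ W, S w ∈ W) (hZ : ∀ z ∈ Z, S z ∈ Z) :
    LinearMap.det S = LinearMap.det (S.restrict hW) * LinearMap.det (S.restrict hZ) := by
  rw [← LinearMap.det_prodMap, ← LinearMap.det_conj _ (Submodule.prodEquivOfIsCompl W Z h)]
  congr 1
  ext v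
  obtain ⟨⟨w, z⟩, rfl⟩ := (Submodule.prodEquivOfIsCompl W Z h).surjective v
  simp

theorem det_eq_neg_one_pow [FiniteDimensional F V] {K : ℕ} (h : (S + 1) ^ K = 0) :
    LinearMap.det S = (-1) ^ finrank F V := by
  have h1 := IsNilpotent.charpoly_eq_X_pow_finrank (R := F) (φ := S + 1) ⟨K, h⟩
  have h2 := LinearMap.eval_charpoly (S + 1) (1 : F)
  rw [h1] at h2
  have h3 : algebraMap F (End F V) 1 - (S + 1) = (-1 : F) • S := by simp
  rw [h3, LinearMap.det_smul] at h2
  simp only [eval_pow, eval_X, one_pow] at h2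
  have h4 : ((-1 : F) ^ finrank F V) * (-1) ^ finrank F V = 1 := by
    rw [← mul_pow]; simp
  linear_combination -LinearMap.det S * h4 - (-1) ^ finrank F V * h2

theorem det_isometry_eq_one [FiniteDimensional F V] (hf : LinearMap.SeparatingLeft f)
    (hS : ∀ x y, f (S x) (S y) = f x y) (h : LinearMap.det (S + 1) ≠ 0) :
    LinearMap.det S = 1 := by
  let b := Module.finBasis F V
  have hG := (LinearMap.BilinForm.nondegenerate_iff_det_ne_zero b).1 (.ofSeparatingLeft hf)
  set G := LinearMap.BilinForm.toMatrix b f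
  set T := LinearMap.toMatrix b b S with hT
  have h1 : Tᵀ * G * T = G := by
    rw [← LinearMap.BilinForm.toMatrix_comp]
    congr 1
    ext x y
    exact hS x y
  have h2 : (T + 1)ᵀ * G * T = G * (T + 1) := by
    rw [transpose_add, transpose_one, Matrix.add_mul, Matrix.add_mul, h1, Matrix.one_mul,
      Matrix.mul_add, Matrix.mul_one, add_comm]
  have h3 : LinearMap.det (S + 1) = (T + 1).det := by
    rw [← LinearMap.det_toMatrix b, map_add, LinearMap.toMatrix_one]
  have h4 := congrArg Matrix.det h2
  rw [det_mul, det_mul, det_mul, det_transpose, ← h3, hT, LinearMap.det_toMatrix] at h4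
  refine mul_left_cancel₀ (mul_ne_zero h hG) ?_
  linear_combination h4

theorem separatingLeft_restrict (hf : LinearMap.SeparatingLeft f) {W Z : Submodule F V}
    (h : W ⊔ Z = ⊤) (horth : ∀ w ∈ W, ∀ z ∈ Z, f w z = 0) :
    LinearMap.SeparatingLeft (f.restrict W) := by
  rintro ⟨w, hw⟩ hw0
  refine Subtype.ext (hf w fun v => ?_)
  obtain ⟨w', hw', z, hz, rfl⟩ := Submodule.mem_sup.1 (h ▸ Submodule.mem_top : v ∈ W ⊔ Z)
  rw [map_add, horth w hw z hz, add_zero]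
  exact hw0 ⟨w', hw'⟩

/-- A nondegenerate form with an isometry of determinant different from `1` has an odd block. -/
theorem hasOddSummand_of_isometry [FiniteDimensional F V] (hchar : (2 : F) ≠ 0)
    (hf : LinearMap.SeparatingLeft f) (hS : ∀ x y, f (S x) (S y) = f x y)
    (hdet : LinearMap.det S ≠ 1) : HasOddSummand f := by
  set N := S + 1 with hN
  have hSN (x : V) : S x = N x - x := by simp [hN]
  have hr (x y : V) : f x (N y) = f (N x) (S y) := by
    simp [hN, hS]; ring
  have hl (x y : V) : f (N x) y = f (S x) (N y) := by
    simp [hN, hS]; ring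
  have hcomm (k : ℕ) (x : V) : (N ^ k) (S x) = S ((N ^ k) x) := by
    rw [hSN, hSN, map_sub, ← Module.End.mul_apply, ← Module.End.mul_apply, pow_mul_comm']
  have hrk (k : ℕ) (x y : V) : f x ((N ^ k) y) = f ((N ^ k) x) ((S ^ k) y) := by
    induction k generalizing x y with
    | zero => simp
    | succ k ih =>
      rw [pow_succ' N, Module.End.mul_apply, hr, ← hcomm, ih, ← pow_succ', pow_succ,
        pow_succ, Module.End.mul_apply, Module.End.mul_apply]
  have hlk (k : ℕ) (x y : V) : f ((N ^ k) x) y = f ((S ^ k) x) ((N ^ k) y) := by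
    induction k generalizing x y with
    | zero => simp
    | succ k ih =>
      rw [pow_succ' N, Module.End.mul_apply, hl, ← hcomm, ih, ← pow_succ', pow_succ,
        pow_succ, Module.End.mul_apply, Module.End.mul_apply]
  obtain ⟨K, hK⟩ := Filter.eventually_atTop.1 N.eventually_isCompl_ker_pow_range_pow
  have hc := hK (K + 1) (by omega)
  set W := LinearMap.ker (N ^ (K + 1)) with hW
  set Z := LinearMap.range (N ^ (K + 1)) with hZ
  have horth : ∀ w ∈ W, ∀ z ∈ Z, f w z = 0 ∧ f z w = 0 := by
    rintro w hw _ ⟨z, rfl⟩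
    rw [hW, LinearMap.mem_ker] at hw
    exact ⟨by rw [hrk, hw, map_zero, LinearMap.zero_apply], by rw [hlk, hw, map_zero]⟩
  have hSW : ∀ w ∈ W, S w ∈ W := by
    intro w hw
    rw [hW, LinearMap.mem_ker] at hw ⊢
    rw [hcomm, hw, map_zero]
  have hSZ : ∀ z ∈ Z, S z ∈ Z := by
    rintro _ ⟨z, rfl⟩
    exact ⟨S z, hcomm _ _⟩
  have hsepW : LinearMap.SeparatingLeft (f.restrict W) :=
    separatingLeft_restrict hf hc.sup_eq_top fun w hw z hz => (horth w hw z hz).1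
  have hsepZ : LinearMap.SeparatingLeft (f.restrict Z) :=
    separatingLeft_restrict hf (sup_comm W Z ▸ hc.sup_eq_top)
      fun z hz w hw => (horth w hw z hz).2
  have hdZ : LinearMap.det (S.restrict hSZ) = 1 := by
    refine det_isometry_eq_one hsepZ (fun x y => hS x y) ?_
    rw [Ne, LinearMap.det_eq_zero_iff_ker_ne_bot, not_not, LinearMap.ker_eq_bot']
    rintro ⟨z, hz⟩ h
    have h1 : N z = 0 := by simpa [hN, Subtype.ext_iff] using h
    refine Subtype.ext (Submodule.disjoint_def.1 hc.disjoint z ?_ hz)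
    rw [hW, LinearMap.mem_ker, pow_succ, Module.End.mul_apply, h1, map_zero]
  have hdW : LinearMap.det (S.restrict hSW) = (-1) ^ finrank F W := by
    refine det_eq_neg_one_pow (K := K + 1) ?_
    have h1 (k : ℕ) (w : W) : (((S.restrict hSW + 1) ^ k) w : V) = (N ^ k) w := by
      induction k generalizing w with
      | zero => simp
      | succ k ih =>
        rw [pow_succ, pow_succ, Module.End.mul_apply, Module.End.mul_apply, ih]
        simp [hN]
    ext w
    rw [h1]
    exact w.2
  refine .of_restrict hc.sup_eq_top horth (hasOddSummand_of_odd_finrank hchar hsepW ?_)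
  by_contra hev
  rw [Nat.not_odd_iff_even] at hev
  rw [det_eq_mul_of_isCompl hc hSW hSZ, hdZ, hdW, hev.neg_one_pow, one_mul] at hdet
  exact hdet rfl

end Isometry

section NilChain

variable {V : Type*} [AddCommGroup V] [Module F V] {f : BilinForm F V} {u w : ℕ → V}

/-- A finite sequence of vectors, each representing on the right the functional its predecessor
represents on the left. -/
def IsNilChain (f : BilinForm F V) (u : ℕ → V) : Prop :=
  (∀ i x, f (u i) x = f x (u (i + 1))) ∧ ∃ N, ∀ i, N ≤ i → u i = 0

namespace IsNilChain

theorem shift (hu : IsNilChain f u) (k : ℕ) : IsNilChain f fun i => u (i + k) := by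
  obtain ⟨h, N, hN⟩ := hu
  exact ⟨fun i x => by rw [h, add_right_comm], N, fun i hi => hN _ (by omega)⟩

theorem cons (hu : IsNilChain f u) {x : V} (hx : ∀ z, f x z = f z (u 0)) :
    IsNilChain f fun i => Nat.casesOn i x u := by
  obtain ⟨h, N, hN⟩ := hu
  refine ⟨fun i z => ?_, N + 1, fun i hi => ?_⟩
  · cases i with
    | zero => exact hx z
    | succ i => exact h i z
  · cases i with
    | zero => omega
    | succ i => exact hN i (by omega)

protected theorem zero : IsNilChain f (0 : ℕ → V) := ⟨by simp, 0, by simp⟩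

theorem add (hu : IsNilChain f u) (hw : IsNilChain f w) : IsNilChain f (u + w) := by
  obtain ⟨h, N, hN⟩ := hu
  obtain ⟨h', N', hN'⟩ := hw
  exact ⟨fun i x => by simp [h, h'], max N N', fun i hi => by
    simp [hN i (le_of_max_le_left hi), hN' i (le_of_max_le_right hi)]⟩

theorem smul (hu : IsNilChain f u) (c : F) : IsNilChain f (c • u) := by
  obtain ⟨h, N, hN⟩ := hu
  exact ⟨fun i x => by simp [h], N, fun i hi => by simp [hN i hi]⟩

theorem apply_add (hu : ∀ i x, f (u i) x = f x (u (i + 1)))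
    (hw : ∀ i x, f (w i) x = f x (w (i + 1))) (i j k : ℕ) :
    f (u (i + k)) (w (j + k)) = f (u i) (w j) := by
  induction k with
  | zero => rfl
  | succ k ih => rw [← ih, hu (i + k), hw (j + k)]; rfl

theorem apply_eq_zero (hu : IsNilChain f u) (hw : IsNilChain f w) (i j : ℕ) :
    f (u i) (w j) = 0 := by
  obtain ⟨N, hN⟩ := hu.2
  rw [← apply_add hu.1 hw.1 i j N, hN _ (by omega), map_zero, LinearMap.zero_apply]

theorem map (hu : IsNilChain f u) (S : V ≃ₗ[F] V) (hS : ∀ x y, f (S x) (S y) = f x y) :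
    IsNilChain f fun i => S (u i) := by
  obtain ⟨h, N, hN⟩ := hu
  refine ⟨fun i x => ?_, N, fun i hi => by simp [hN i hi]⟩
  obtain ⟨x, rfl⟩ := S.surjective x
  rw [hS, hS, h]

theorem reverse (hu : IsNilChain f u) (h0 : u 0 = 0) {N : ℕ} :
    IsNilChain f.flip fun i => u (N - i) := by
  refine ⟨fun i x => ?_, N, fun i hi => by simp [Nat.sub_eq_zero_of_le hi, h0]⟩
  simp only [LinearMap.BilinForm.flip_apply]
  rcases lt_or_ge i N with hi | hi
  · rw [hu.1, show N - (i + 1) + 1 = N - i by omega]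
  · rw [Nat.sub_eq_zero_of_le hi, Nat.sub_eq_zero_of_le (hi.trans i.le_succ), h0]
    simp

end IsNilChain

/-- The starting vectors of nilpotent chains. -/
def leftNil (f : BilinForm F V) : Submodule F V where
  carrier := {x | ∃ u, IsNilChain f u ∧ u 0 = x}
  zero_mem' := ⟨0, .zero, rfl⟩
  add_mem' := by
    rintro _ _ ⟨u, hu, rfl⟩ ⟨w, hw, rfl⟩
    exact ⟨u + w, hu.add hw, rfl⟩
  smul_mem' := by
    rintro c _ ⟨u, hu, rfl⟩
    exact ⟨c • u, hu.smul c, rfl⟩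

theorem exists_mem_leftNil {x : V} (hx : x ∈ leftNil f) :
    ∃ y ∈ leftNil f, ∀ z, f x z = f z y := by
  obtain ⟨u, hu, rfl⟩ := hx
  exact ⟨u 1, ⟨_, hu.shift 1, rfl⟩, hu.1 0⟩

theorem mem_leftNil_of_apply_eq {x y : V} (hy : y ∈ leftNil f) (h : ∀ z, f x z = f z y) :
    x ∈ leftNil f := by
  obtain ⟨u, hu, rfl⟩ := hy
  exact ⟨_, hu.cons h, rfl⟩

theorem apply_eq_zero_of_mem_leftNil {x y : V} (hx : x ∈ leftNil f) (hy : y ∈ leftNil f) :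
    f x y = 0 := by
  obtain ⟨u, hu, rfl⟩ := hx
  obtain ⟨w, hw, rfl⟩ := hy
  exact hu.apply_eq_zero hw 0 0

theorem map_mem_leftNil {x : V} (hx : x ∈ leftNil f) (S : V ≃ₗ[F] V)
    (hS : ∀ x y, f (S x) (S y) = f x y) : S x ∈ leftNil f := by
  obtain ⟨u, hu, rfl⟩ := hx
  exact ⟨_, hu.map S hS, rfl⟩

theorem flip_nilChain_eq_zero (hf : ∀ u, IsNilChain f u → u 0 = 0 → u = 0) (u : ℕ → V)
    (hu : IsNilChain f.flip u) (h0 : u 0 = 0) : u = 0 := by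
  obtain ⟨N, hN⟩ := hu.2
  have h := hf _ (hu.reverse h0 (N := N)) (hN _ le_rfl)
  ext i
  rcases lt_or_ge i N with hi | hi
  · simpa [show N - (N - i) = i by omega] using congrFun h (N - i)
  · exact hN i hi

theorem disjoint_leftNil_flip (hf : ∀ u, IsNilChain f u → u 0 = 0 → u = 0) :
    Disjoint (leftNil f) (leftNil f.flip) := by
  rw [Submodule.disjoint_def]
  rintro _ ⟨a, ha, rfl⟩ ⟨b, hb, hab⟩
  obtain ⟨N, hN⟩ := hb.2
  have h := hf (fun i => if i ≤ N then b (N - i) else a (i - N)) ⟨fun i x => ?_, ?_⟩ ?_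
  · simpa [hab] using congrFun h N
  · have hb1 := hb.1
    simp only [LinearMap.BilinForm.flip_apply] at hb1
    beta_reduce
    rcases lt_trichotomy i N with hi | rfl | hi
    · rw [if_pos hi.le, if_pos (show i + 1 ≤ N from hi), hb1, show N - (i + 1) + 1 = N - i by omega]
    · simp [hab, ha.1]
    · rw [if_neg (by omega), if_neg (by omega), ha.1, show i - N + 1 = i + 1 - N by omega]
  · obtain ⟨N', hN'⟩ := ha.2
    exact ⟨N + N' + 1, fun i hi => by
      beta_reduce; rw [if_neg (by omega), hN' _ (by omega)]⟩
  · simp [hN]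

variable [FiniteDimensional F V]

theorem range_sup_map_leftNil (hf : ∀ u, IsNilChain f u → u 0 = 0 → u = 0) :
    LinearMap.range f ⊔ (leftNil f).map f.flip = ⊤ := by
  apply Submodule.eq_top_of_finrank_eq
  have hker : LinearMap.ker f ≤ leftNil f := fun x hx =>
    mem_leftNil_of_apply_eq (Submodule.zero_mem _) fun z => by
      rw [LinearMap.mem_ker.1 hx]; simp
  have hinj : (LinearMap.ker f.flip ⊓ leftNil f : Submodule F V) = ⊥ := by
    rw [eq_bot_iff, ← (disjoint_leftNil_flip hf).eq_bot, inf_comm]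
    refine inf_le_inf_left _ fun x hx => ?_
    exact mem_leftNil_of_apply_eq (Submodule.zero_mem _) fun z => by
      rw [LinearMap.mem_ker.1 hx]; simp
  have hinf : LinearMap.range f ⊓ (leftNil f).map f.flip = (leftNil f).map f := by
    ext φ
    constructor
    · rintro ⟨⟨x, rfl⟩, y, hy, hxy⟩
      exact ⟨x, mem_leftNil_of_apply_eq hy fun z => (LinearMap.congr_fun hxy z).symm, rfl⟩
    · rintro ⟨x, hx, rfl⟩
      obtain ⟨y, hy, h⟩ := exists_mem_leftNil hx
      exact ⟨⟨x, rfl⟩, y, hy, LinearMap.ext fun z => (h z).symm⟩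
  have h1 := Submodule.finrank_sup_add_finrank_inf_eq (LinearMap.range f)
    ((leftNil f).map f.flip)
  have h2 := finrank_map_add_finrank_ker_inf f (leftNil f)
  have h3 := finrank_map_add_finrank_ker_inf f.flip (leftNil f)
  have h4 := f.finrank_range_add_finrank_ker
  rw [hinf] at h1
  rw [hinj, finrank_bot] at h3
  rw [inf_eq_left.2 hker] at h2
  rw [Subspace.dual_finrank_eq]
  omega

theorem eq_zero_of_mem_leftNil_flip (hf : ∀ u, IsNilChain f u → u 0 = 0 → u = 0) {r : V}
    (hr : r ∈ leftNil f.flip) (h : ∀ l ∈ leftNil f, f r l = 0) : r = 0 := by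
  obtain ⟨b, hb, rfl⟩ := hr
  have hb1 := hb.1
  simp only [LinearMap.BilinForm.flip_apply] at hb1
  have hbl (i : ℕ) : ∀ l ∈ leftNil f, f (b i) l = 0 := by
    induction i with
    | zero => exact h
    | succ i ih =>
      intro l hl
      obtain ⟨l', hl', hll⟩ := exists_mem_leftNil hl
      rw [← hb1, hll, ih l' hl']
  obtain ⟨N, hN⟩ := hb.2
  have hstep (i : ℕ) (hi : b (i + 1) = 0) : b i = 0 := by
    refine (Module.forall_dual_apply_eq_zero_iff F _).1 fun φ => ?_
    obtain ⟨_, ⟨v, rfl⟩, _, ⟨l, hl, rfl⟩, rfl⟩ := Submodule.mem_sup.1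
      (range_sup_map_leftNil hf ▸ Submodule.mem_top : φ ∈ _)
    simp [hb1, hi, hbl i l hl]
  have hdown (k : ℕ) (hk : k ≤ N) : b (N - k) = 0 := by
    induction k with
    | zero => exact hN _ le_rfl
    | succ k ih =>
      refine hstep _ ?_
      rw [show N - (k + 1) + 1 = N - k by omega, ih (by omega)]
  simpa using hdown N le_rfl

/-- A form without nonzero closed nilpotent chains is nondegenerate on the complement of its
totally isotropic nilpotent part, on which isometries have determinant `1`. -/
theorem hasOddSummand_of_isometry_of_nilChain_eq_zero (hchar : (2 : F) ≠ 0)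
    (hf : ∀ u, IsNilChain f u → u 0 = 0 → u = 0) (S : V ≃ₗ[F] V)
    (hS : ∀ x y, f (S x) (S y) = f x y) (hdet : LinearMap.det (S : End F V) ≠ 1) :
    HasOddSummand f := by
  have hf' := flip_nilChain_eq_zero hf
  set L := leftNil f with hL
  set R := leftNil f.flip with hR
  have hRL : ∀ r ∈ R, (∀ l ∈ L, f r l = 0) → r = 0 := fun r hr h =>
    eq_zero_of_mem_leftNil_flip hf hr h
  have hLR : ∀ l ∈ L, (∀ r ∈ R, f r l = 0) → l = 0 := fun l hl h =>
    eq_zero_of_mem_leftNil_flip (f := f.flip) hf' hl h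
  have hLL : ∀ l ∈ L, ∀ l' ∈ L, f l l' = 0 := fun l hl l' hl' =>
    apply_eq_zero_of_mem_leftNil hl hl'
  have hRR : ∀ r ∈ R, ∀ r' ∈ R, f r r' = 0 := fun r hr r' hr' =>
    apply_eq_zero_of_mem_leftNil (f := f.flip) hr' hr
  let p : R →ₗ[F] Dual F L := (Dual.transpose (R := F) L.subtype) ∘ₗ f ∘ₗ R.subtype
  let q : L →ₗ[F] Dual F R := (Dual.transpose (R := F) R.subtype) ∘ₗ f.flip ∘ₗ L.subtype
  have hpinj : Function.Injective p := by
    rw [← LinearMap.ker_eq_bot, LinearMap.ker_eq_bot']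
    intro r h
    exact Subtype.ext (hRL r r.2 fun l hl => LinearMap.congr_fun h ⟨l, hl⟩)
  have hqinj : Function.Injective q := by
    rw [← LinearMap.ker_eq_bot, LinearMap.ker_eq_bot']
    intro l h
    exact Subtype.ext (hLR l l.2 fun r hr => LinearMap.congr_fun h ⟨r, hr⟩)
  have hfin : finrank F R = finrank F L := by
    have h1 := LinearMap.finrank_le_finrank_of_injective hpinj
    have h2 := LinearMap.finrank_le_finrank_of_injective hqinj
    rw [Subspace.dual_finrank_eq] at h1 h2
    omega
  have hpsurj : Function.Surjective p :=
    (LinearMap.injective_iff_surjective_of_finrank_eq_finrank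
      (hfin.trans Subspace.dual_finrank_eq.symm)).1 hpinj
  have hqsurj : Function.Surjective q :=
    (LinearMap.injective_iff_surjective_of_finrank_eq_finrank
      (hfin.symm.trans Subspace.dual_finrank_eq.symm)).1 hqinj
  let Y : Submodule F V :=
    { carrier := {y | (∀ l ∈ L, f y l = 0) ∧ ∀ r ∈ R, f r y = 0}
      zero_mem' := by simp
      add_mem' := fun ha hb =>
        ⟨fun l hl => by simp [ha.1 l hl, hb.1 l hl], fun r hr => by simp [ha.2 r hr, hb.2 r hr]⟩
      smul_mem' := fun c x hx =>
        ⟨fun l hl => by simp [hx.1 l hl], fun r hr => by simp [hx.2 r hr]⟩ }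
  have hdecomp (v : V) : ∃ l ∈ L, ∃ r ∈ R, ∃ y ∈ Y, v = l + r + y := by
    obtain ⟨⟨l, hl⟩, hlv⟩ := hqsurj (Dual.transpose (R := F) R.subtype (f.flip v))
    obtain ⟨⟨r, hr⟩, hrv⟩ := hpsurj (Dual.transpose (R := F) L.subtype (f v))
    have h1 (r' : V) (hr' : r' ∈ R) : f r' l = f r' v := LinearMap.congr_fun hlv ⟨r', hr'⟩
    have h2 (l' : V) (hl' : l' ∈ L) : f r l' = f v l' := LinearMap.congr_fun hrv ⟨l', hl'⟩
    refine ⟨l, hl, r, hr, v - (l + r), ⟨fun l' hl' => ?_, fun r' hr' => ?_⟩, by abel⟩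
    · simp [h2 l' hl', hLL l hl l' hl']
    · simp [h1 r' hr', hRR r' hr' r hr]
  have hindep (l r y : V) (hl : l ∈ L) (hr : r ∈ R) (hy : y ∈ Y) (h : l + r + y = 0) :
      l = 0 ∧ r = 0 ∧ y = 0 := by
    have h1 : l = 0 := hLR l hl fun r' hr' => by
      have := congrArg (f r') h
      simpa [hRR r' hr' r hr, hy.2 r' hr'] using this
    have h2 : r = 0 := hRL r hr fun l' hl' => by
      have := congrArg (fun v => f v l') h
      simpa [hLL l hl l' hl', hy.1 l' hl'] using this
    exact ⟨h1, h2, by simpa [h1, h2] using h⟩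
  have hYL (y l : V) (hy : y ∈ Y) (hl : l ∈ L) : f l y = 0 := by
    obtain ⟨l', hl', h⟩ := exists_mem_leftNil hl
    rw [h, hy.1 l' hl']
  have hYR (y r : V) (hy : y ∈ Y) (hr : r ∈ R) : f y r = 0 := by
    obtain ⟨r', hr', h⟩ := exists_mem_leftNil hr
    exact (h y).trans (hy.2 r' hr')
  have hS' (x y : V) : f (S.symm x) (S.symm y) = f x y := by
    rw [← hS, S.apply_symm_apply, S.apply_symm_apply]
  have hSL : ∀ l ∈ L, (S : End F V) l ∈ L := fun l hl => map_mem_leftNil hl S hS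
  have hSR : ∀ r ∈ R, (S : End F V) r ∈ R := fun r hr =>
    map_mem_leftNil hr S fun x y => hS y x
  have hSY : ∀ y ∈ Y, (S : End F V) y ∈ Y := by
    refine fun y hy => ⟨fun l hl => ?_, fun r hr => ?_⟩
    · rw [← hy.1 _ (map_mem_leftNil hl S.symm hS'), ← hS y, S.apply_symm_apply]; rfl
    · rw [← hy.2 _ (map_mem_leftNil (f := f.flip) hr S.symm fun x y => hS' y x), ← hS _ y,
        S.apply_symm_apply]; rfl
  have hdual : LinearMap.det ((S : End F V).restrict hSL) *
      LinearMap.det ((S : End F V).restrict hSR) = 1 := by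
    let e : R ≃ₗ[F] Dual F L := LinearEquiv.ofBijective p ⟨hpinj, hpsurj⟩
    rw [← LinearMap.det_dualMap, ← LinearMap.det_conj ((S : End F V).restrict hSR) e,
      ← map_mul, ← LinearMap.det_id (A := F) (M := Dual F L)]
    congr 1
    ext φ l
    obtain ⟨r, rfl⟩ := e.surjective φ
    have he (r : R) (l : L) : e r l = f r l := rfl
    simpa [he] using hS r l
  let P : ((L × R) × Y) →ₗ[F] V := (L.subtype.coprod R.subtype).coprod Y.subtype
  let E : ((L × R) × Y) ≃ₗ[F] V := LinearEquiv.ofBijective P <| by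
    constructor
    · rw [← LinearMap.ker_eq_bot, LinearMap.ker_eq_bot']
      rintro ⟨⟨l, r⟩, y⟩ h
      obtain ⟨h1, h2, h3⟩ := hindep l r y l.2 r.2 y.2 h
      exact Prod.ext (Prod.ext (Subtype.ext h1) (Subtype.ext h2)) (Subtype.ext h3)
    · intro v
      obtain ⟨l, hl, r, hr, y, hy, rfl⟩ := hdecomp v
      exact ⟨((⟨l, hl⟩, ⟨r, hr⟩), ⟨y, hy⟩), rfl⟩
  have hE (l : L) (r : R) (y : Y) : E ((l, r), y) = l + r + y := rfl
  have hdetE : LinearMap.det (S : End F V) = LinearMap.det ((S : End F V).restrict hSY) := by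
    rw [← one_mul (LinearMap.det ((S : End F V).restrict hSY)), ← hdual,
      ← LinearMap.det_prodMap, ← LinearMap.det_prodMap, ← LinearMap.det_conj _ E]
    congr 1
    ext v
    obtain ⟨⟨⟨l, r⟩, y⟩, rfl⟩ := E.surjective v
    simp only [LinearMap.comp_apply, LinearEquiv.coe_coe, LinearEquiv.symm_apply_apply,
      LinearMap.prodMap_apply]
    simp [hE]
  have hsup : Y ⊔ (L ⊔ R) = ⊤ := by
    rw [eq_top_iff]
    rintro v -
    obtain ⟨l, hl, r, hr, y, hy, rfl⟩ := hdecomp v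
    rw [add_comm]
    exact Submodule.add_mem_sup hy (Submodule.add_mem_sup hl hr)
  have horth : ∀ y ∈ Y, ∀ z ∈ L ⊔ R, f y z = 0 ∧ f z y = 0 := by
    intro y hy z hz
    obtain ⟨l, hl, r, hr, rfl⟩ := Submodule.mem_sup.1 hz
    simp [hYL y l hy hl, hYR y r hy hr, hy.1 l hl, hy.2 r hr]
  rw [hdetE] at hdet
  refine .of_restrict hsup horth
    (hasOddSummand_of_isometry hchar ?_ (fun x y => hS x y) hdet)
  rintro ⟨y, hy⟩ h
  have hyL : y ∈ L := by
    refine mem_leftNil_of_apply_eq (Submodule.zero_mem _) fun v => ?_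
    obtain ⟨l, hl, r, hr, z, hz, rfl⟩ := hdecomp v
    have := h ⟨z, hz⟩
    simp only [LinearMap.BilinForm.restrict_apply, LinearMap.domRestrict_apply] at this
    simp [hy.1 l hl, hYR y r hy hr, this]
  have := hindep (-y) 0 y (neg_mem hyL) (zero_mem _) hy (by simp)
  exact Subtype.ext this.2.2

end NilChain

section JordanSummand

variable {V : Type*} [AddCommGroup V] [Module F V] {f : BilinForm F V}

/-- Two dual chains `u`, `v` span an orthogonal summand with Gram matrix `J_{2m+1}(0)`. -/
theorem orthSummand_jordanBlock {m : ℕ} {u v : ℕ → V} (hu : ∀ i x, f (u i) x = f x (u (i + 1)))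
    (h0 : u 0 = 0) (h1 : u 1 ≠ 0) (hum : ∀ i, m + 1 < i → u i = 0)
    (huu : ∀ i j, f (u i) (u j) = 0) (hv : ∀ i x, i + 1 < m → f (v i) x = f x (v (i + 1)))
    (huv : ∀ j i, i < m → f (u j) (v i) = if j = i + 1 then 1 else 0)
    (hvv : ∀ i j, i < m → j < m → f (v i) (v j) = 0) :
    OrthSummand f (jordanBlock (2 * m + 1) (0 : F)) := by
  let e : ℕ → V := fun i => if Even i then u (m + 1 - i / 2) else v (m - 1 - i / 2)
  have he0 (i : ℕ) : e (2 * i) = u (m + 1 - i) := by simp [e]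
  have he1 (i : ℕ) : e (2 * i + 1) = v (m - 1 - i) := by
    simp [e, show (2 * i + 1) / 2 = i by omega]
  have hvu (i j : ℕ) (hi : i < m) : f (v i) (u (j + 1)) = if j = i + 1 then 1 else 0 := by
    rw [← hu, huv j i hi]
  have hQ (a b : Fin (2 * m + 1)) : f (e a) (e b) = jordanBlock (2 * m + 1) (0 : F) a b := by
    obtain ⟨a, ha⟩ := a
    obtain ⟨b, hb⟩ := b
    simp only [jordanBlock, Matrix.of_apply]
    obtain ⟨i, rfl | rfl⟩ := Nat.even_or_odd' a <;> obtain ⟨j, rfl | rfl⟩ := Nat.even_or_odd' b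
    · rw [he0, he0, huu]
      split_ifs <;> first | rfl | omega
    · rw [he0, he1, huv _ _ (by omega)]
      split_ifs <;> first | rfl | omega
    · rw [he0, he1, show m + 1 - j = m - j + 1 by omega, hvu _ _ (by omega)]
      split_ifs <;> first | rfl | omega
    · rw [he1, he1, hvv _ _ (by omega) (by omega)]
      split_ifs <;> first | rfl | omega
  have humem (k : ℕ) (hk : k ≤ m) :
      u (k + 1) ∈ Submodule.span F (Set.range fun i : Fin (2 * m + 1) => e i) :=
    Submodule.subset_span ⟨⟨2 * (m - k), by omega⟩, by
      simp only [he0]; congr 1; omega⟩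
  have hvmem (k : ℕ) (hk : k < m) :
      v k ∈ Submodule.span F (Set.range fun i : Fin (2 * m + 1) => e i) :=
    Submodule.subset_span ⟨⟨2 * (m - 1 - k) + 1, by omega⟩, by
      simp only [he1]; congr 1; omega⟩
  have hlast (x : V) : f (u (m + 1)) x = 0 := by rw [hu, hum _ (by omega), map_zero]
  refine .of_sup_eq_top (e := fun i : Fin (2 * m + 1) => e i)
    (Z := { carrier := {z | ∀ i : Fin (2 * m + 1), f (e i) z = 0 ∧ f z (e i) = 0}
            zero_mem' := by simp
            add_mem' := fun ha hb i => by simp [(ha i).1, (ha i).2, (hb i).1, (hb i).2]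
            smul_mem' := fun a x hx i => by simp [(hx i).1, (hx i).2] }) ?_ hQ ?_
    fun i z hz => hz i
  · rw [Fintype.linearIndependent_iff]
    intro c hc
    have hc0 (a : Fin (2 * m + 1)) (ha : (a : ℕ) < 2 * m) : c a = 0 := by
      have h := congrArg (f (e (a + 1))) hc
      rw [map_sum, map_zero, Finset.sum_eq_single a] at h
      · have hq := hQ ⟨a + 1, by omega⟩ a
        simp only [jordanBlock, Matrix.of_apply] at hq
        rw [if_neg (by omega), if_pos trivial] at hq
        rwa [map_smul, hq, smul_eq_mul, mul_one] at h
      · intro b _ hb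
        have hq := hQ ⟨a + 1, by omega⟩ b
        have hb' : (a : ℕ) ≠ b := fun h => hb (Fin.ext h.symm)
        simp only [jordanBlock, Matrix.of_apply] at hq
        rw [map_smul, hq]
        split_ifs <;> first | omega | simp
      · simp
    intro a
    rcases Nat.lt_succ_iff_lt_or_eq.1 a.2 with ha | ha
    · exact hc0 a ha
    · rw [Finset.sum_eq_single a (fun b _ hb => by
        rw [hc0 b (by have := Fin.val_ne_of_ne hb; omega), zero_smul]) (by simp)] at hc
      refine (smul_eq_zero.1 hc).resolve_right ?_
      rwa [ha, he0, Nat.add_sub_cancel_left]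
  · rw [eq_top_iff]
    rintro x -
    set y := ∑ k ∈ Finset.range m, f (u (k + 1)) x • v k +
      ∑ k ∈ Finset.range m, f x (v k) • u (k + 1) + f (v (m - 1)) x • u (m + 1) with hy
    have hymem : y ∈ Submodule.span F (Set.range fun i : Fin (2 * m + 1) => e i) :=
      add_mem (add_mem
        (sum_mem fun k hk => Submodule.smul_mem _ _ (hvmem k (Finset.mem_range.1 hk)))
        (sum_mem fun k hk => Submodule.smul_mem _ _ (humem k (Finset.mem_range.1 hk).le)))
        (Submodule.smul_mem _ _ (humem m le_rfl))
    have huz (j : ℕ) : f (u j) (x - y) = 0 := by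
      rw [map_sub, sub_eq_zero, hy]
      simp only [map_add, map_sum, map_smul, huu, smul_eq_mul, mul_zero, Finset.sum_const_zero,
        add_zero]
      rw [Finset.sum_congr rfl fun k hk => by rw [huv j k (Finset.mem_range.1 hk)]]
      rcases j with _ | j
      · simp [h0]
      · simp only [add_left_inj, mul_ite, mul_one, mul_zero, Finset.sum_ite_eq, Finset.mem_range]
        split_ifs with hj
        · rfl
        · rcases eq_or_lt_of_le (not_lt.1 hj) with rfl | hj
          · exact hlast x
          · rw [hum _ (by omega), map_zero, LinearMap.zero_apply]
    have hzu (j : ℕ) : f (x - y) (u j) = 0 := by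
      rcases j with _ | j
      · rw [h0, map_zero]
      · rw [← hu, huz]
    have hzv (j : ℕ) (hj : j < m) : f (x - y) (v j) = 0 := by
      rw [map_sub, LinearMap.sub_apply, sub_eq_zero, hy]
      simp only [map_add, map_sum, map_smul, LinearMap.add_apply, LinearMap.sum_apply,
        LinearMap.smul_apply, smul_eq_mul, huv _ j hj]
      rw [Finset.sum_eq_zero fun k hk => by rw [hvv k j (Finset.mem_range.1 hk) hj, mul_zero]]
      simp only [add_left_inj, mul_ite, mul_one, mul_zero, Finset.sum_ite_eq', Finset.mem_range]
      rw [if_pos hj, if_neg (by omega), zero_add, add_zero]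
    have hvz (j : ℕ) (hj : j < m) : f (v j) (x - y) = 0 := by
      rcases eq_or_lt_of_le (Nat.succ_le_of_lt hj) with h | h
      · obtain rfl : j = m - 1 := by omega
        rw [map_sub, sub_eq_zero, hy]
        simp only [map_add, map_sum, map_smul, smul_eq_mul, hvu _ _ hj]
        rw [Finset.sum_eq_zero fun k hk => by
            rw [hvv _ k hj (Finset.mem_range.1 hk), mul_zero],
          Finset.sum_eq_zero fun k hk => by
            rw [if_neg (by have := Finset.mem_range.1 hk; omega), mul_zero],
          if_pos (by omega)]
        simp
      · rw [hv j _ h, hzv _ h]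
    refine Submodule.mem_sup.2 ⟨y, hymem, x - y, fun i => ?_, by abel⟩
    obtain ⟨i, hi⟩ := i
    obtain ⟨k, rfl | rfl⟩ := Nat.even_or_odd' i
    · simp only [he0]
      exact ⟨huz _, hzu _⟩
    · simp only [he1]
      exact ⟨hvz _ (by omega), hzv _ (by omega)⟩

theorem exists_forall_apply_sub_eq [FiniteDimensional F V] {m : ℕ}
    (hm : ∀ u, IsNilChain f u → u 0 = 0 → (∀ i, m < i → u i = 0) → u = 0)
    (ψ : Fin m → Dual F V) :
    ∃ y : ℕ → V, ∀ (i : Fin m) x, f x (y (i + 1)) - f (y i) x = ψ i x := by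
  let T : (ℕ → V) →ₗ[F] Fin m → Dual F V := LinearMap.pi fun i =>
    f.flip ∘ₗ LinearMap.proj ((i : ℕ) + 1) - f ∘ₗ LinearMap.proj (i : ℕ)
  have hT (y : ℕ → V) (i : Fin m) (x : V) : T y i x = f x (y (i + 1)) - f (y i) x := by simp [T]
  suffices h : ψ ∈ LinearMap.range T by
    obtain ⟨y, rfl⟩ := h
    exact ⟨y, fun i x => (hT y i x).symm⟩
  by_contra hψ
  obtain ⟨φ, hφ, hle⟩ := Submodule.exists_le_ker_of_notMem hψ
  choose z hz using fun i : Fin m => (Module.evalEquiv F V).surjective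
    (φ ∘ₗ LinearMap.single F (fun _ => Dual F V) i)
  have hφz (χ : Fin m → Dual F V) : φ χ = ∑ i, χ i (z i) := by
    conv_lhs => rw [← Finset.univ_sum_single χ, map_sum]
    exact Finset.sum_congr rfl fun i _ => (LinearMap.congr_fun (hz i) (χ i)).symm
  let w : ℕ → V := fun i => if h : i - 1 < m ∧ 0 < i then z ⟨i - 1, h.1⟩ else 0
  have hw1 (i : Fin m) : w (i + 1) = z i := by simp [w]
  have hw0 : w 0 = 0 := by simp [w]
  have hwm (i : ℕ) (hi : m < i) : w i = 0 := dif_neg (by omega)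
  have hsum (j : ℕ) (x : V) : ∑ i ∈ Finset.range m,
      (f (w (i + 1)) (Pi.single (M := fun _ => V) j x (i + 1)) -
        f (Pi.single (M := fun _ => V) j x i) (w (i + 1))) = 0 := by
    have h : φ (T (Pi.single j x)) = 0 := hle (LinearMap.mem_range_self T _)
    rw [hφz, Finset.sum_congr rfl fun i _ => by rw [hT, ← hw1]] at h
    rw [← h, Finset.sum_range]
  have hw : w = 0 := by
    refine hm w ⟨fun j x => ?_, m + 1, fun i hi => hwm i (by omega)⟩ hw0 hwm
    have h := hsum j x
    have h1 : ∑ i ∈ Finset.range m, f (w (i + 1)) (Pi.single (M := fun _ => V) j x (i + 1)) =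
        f (w j) x := by
      rcases j with _ | j
      · simp [hw0]
      · simp only [Pi.single_apply, add_left_inj, apply_ite (f _), map_zero,
          Finset.sum_ite_eq', Finset.mem_range]
        split_ifs with hj
        · rfl
        · rw [hwm _ (by omega), map_zero, LinearMap.zero_apply]
    have h2 : ∑ i ∈ Finset.range m, f (Pi.single (M := fun _ => V) j x i) (w (i + 1)) =
        f x (w (j + 1)) := by
      rw [Finset.sum_eq_single j (fun i _ hi => by simp [hi])
        (fun hj => by rw [hwm _ (by rw [Finset.mem_range] at hj; omega), map_zero])]
      simp
    rwa [Finset.sum_sub_distrib, h1, h2, sub_eq_zero] at h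
  refine hφ ?_
  rw [hφz]
  exact Finset.sum_eq_zero fun i _ => by rw [← hw1, hw]; simp

theorem exists_dual_chain_s7 [FiniteDimensional F V] {m : ℕ} {u : ℕ → V}
    (hm : ∀ u, IsNilChain f u → u 0 = 0 → (∀ i, m < i → u i = 0) → u = 0)
    (hu : IsNilChain f u) (h0 : u 0 = 0) (hum : ∀ i, m + 1 < i → u i = 0)
    (hne : u (m + 1) ≠ 0) :
    ∃ y : ℕ → V, (∀ i x, i + 1 < m → f (y i) x = f x (y (i + 1))) ∧
      ∀ j i, i < m → f (u j) (y i) = if j = i + 1 then 1 else 0 := by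
  obtain ⟨ψ, hψ⟩ : ∃ ψ : Dual F V, ψ (u (m + 1)) = -1 := by
    by_contra! h
    refine hne ((Module.forall_dual_apply_eq_zero_iff F _).1 fun φ => ?_)
    by_contra hφ
    exact h (-(φ (u (m + 1)))⁻¹ • φ) (by simp [hφ])
  obtain ⟨y, hy⟩ := exists_forall_apply_sub_eq hm fun i => if (i : ℕ) + 1 = m then ψ else 0
  have hyc (i : ℕ) (x : V) (hi : i + 1 < m) : f (y i) x = f x (y (i + 1)) := by
    have h := hy ⟨i, by omega⟩ x
    simp only [if_neg hi.ne, LinearMap.zero_apply] at h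
    exact (sub_eq_zero.1 h).symm
  have hstep (i j : ℕ) (hi : i + 1 < m) : f (u (j + 1)) (y (i + 1)) = f (u j) (y i) := by
    rw [← hyc i _ hi, ← hu.1]
  have hshift (k i : ℕ) (hi : i < m) : f (u (k + i)) (y i) = f (u k) (y 0) := by
    induction i with
    | zero => rfl
    | succ i ih => rw [← add_assoc, hstep _ _ hi, ih (by omega)]
  refine ⟨y, hyc, fun j i hi => ?_⟩
  induction i generalizing j with
  | zero =>
    rcases j with _ | _ | j
    · simp [h0]
    · have h := hy ⟨m - 1, by omega⟩ (u (m + 1))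
      simp only [if_pos (show m - 1 + 1 = m by omega), hψ] at h
      rw [hu.1, hum _ (by omega), map_zero, zero_sub, neg_inj, ← hu.1] at h
      rw [← hshift _ (m - 1) (by omega), show 0 + 1 + (m - 1) = m by omega, h]
      simp
    · rw [← hshift _ (m - 1) (by omega), hu.1, hum _ (by omega), map_zero]
      simp
  | succ i ih =>
    rcases j with _ | j
    · simp [h0]
    · rw [hstep _ _ hi, ih _ (by omega)]
      simp

/-- A shortest nonzero closed nilpotent chain yields a singular Jordan block summand. -/
theorem exists_orthSummand_jordanBlock [FiniteDimensional F V] {u : ℕ → V}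
    (hu : IsNilChain f u) (h0 : u 0 = 0) (hne : u ≠ 0) :
    ∃ m : ℕ, OrthSummand f (jordanBlock (2 * m + 1) (0 : F)) := by
  classical
  have hex : ∃ s, ∃ u, IsNilChain f u ∧ u 0 = 0 ∧ (∀ i, s < i → u i = 0) ∧ u ≠ 0 := by
    obtain ⟨N, hN⟩ := hu.2
    exact ⟨N, u, hu, h0, fun i hi => hN i hi.le, hne⟩
  have hmin := fun s => Nat.find_min (H := hex) (m := s)
  obtain ⟨u, hu, h0, hus, hne⟩ := Nat.find_spec hex
  obtain ⟨m, hm⟩ : ∃ m, Nat.find hex = m + 1 := by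
    refine Nat.exists_eq_succ_of_ne_zero fun h => hne (funext fun i => ?_)
    rcases Nat.eq_zero_or_pos i with rfl | hi
    · exact h0
    · exact hus i (by omega)
  rw [hm] at hmin hus
  have hm : ∀ u, IsNilChain f u → u 0 = 0 → (∀ i, m < i → u i = 0) → u = 0 := by
    intro u hu h0 hum
    by_contra hne
    exact hmin m (by omega) ⟨u, hu, h0, hum, hne⟩
  have hlast : u (m + 1) ≠ 0 := by
    refine fun h => hne (hm u hu h0 fun i hi => ?_)
    rcases eq_or_lt_of_le (Nat.succ_le_of_lt hi) with rfl | hi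
    · exact h
    · exact hus i hi
  have h1 : u 1 ≠ 0 := by
    refine fun h => hne (funext fun i => ?_)
    have := hm _ (hu.shift 1) h fun i hi => hus _ (by omega)
    rcases i with _ | i
    · exact h0
    · exact congrFun this i
  have huu := hu.apply_eq_zero hu
  obtain ⟨y, hyc, huy⟩ := exists_dual_chain_s7 hm hu h0 hus hlast
  let v : ℕ → V := fun i => y i - ∑ p ∈ Finset.range (i + 1), f (y p) (y 0) • u (i + 1 - p)
  have hv (i : ℕ) : v i = y i - ∑ p ∈ Finset.range (i + 1), f (y p) (y 0) • u (i + 1 - p) := rfl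
  have hvc (i : ℕ) (x : V) (hi : i + 1 < m) : f (v i) x = f x (v (i + 1)) := by
    have hx : f x (u 1) = 0 := by rw [← hu.1, h0, map_zero, LinearMap.zero_apply]
    rw [hv, hv, Finset.sum_range_succ _ (i + 1), Nat.add_sub_cancel_left]
    simp only [map_sub, map_add, map_sum, map_smul, LinearMap.sub_apply, LinearMap.sum_apply,
      LinearMap.smul_apply, hx, hyc i x hi, smul_zero, add_zero]
    refine congrArg _ (Finset.sum_congr rfl fun p hp => ?_)
    rw [hu.1, show i + 1 - p + 1 = i + 1 + 1 - p by
      have := Finset.mem_range.1 hp; omega]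
  have huv (j i : ℕ) (hi : i < m) : f (u j) (v i) = if j = i + 1 then 1 else 0 := by
    rw [hv, map_sub, map_sum, huy j i hi, Finset.sum_eq_zero, sub_zero]
    intro p _
    rw [map_smul, huu, smul_zero]
  have hv0 (k : ℕ) (hk : k < m) : f (v k) (v 0) = 0 := by
    have hk1 : f (v k) (u 1) = 0 := by rw [← hu.1, h0, map_zero, LinearMap.zero_apply]
    have h : f (v k) (v 0) = f (v k) (y 0) := by
      rw [hv 0]
      simp [hk1]
    rw [h, hv, map_sub, map_sum, LinearMap.sub_apply, LinearMap.sum_apply,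
      Finset.sum_eq_single k, Nat.add_sub_cancel_left, map_smul, LinearMap.smul_apply,
      huy _ _ (by omega)]
    · simp
    · intro p hp hpk
      rw [map_smul, LinearMap.smul_apply, huy _ _ (by omega), if_neg, smul_zero]
      have := Finset.mem_range.1 hp
      omega
    · simp
  refine ⟨m, orthSummand_jordanBlock hu.1 h0 h1 hus huu hvc huv fun i j hi hj => ?_⟩
  induction j generalizing i with
  | zero => exact hv0 i hi
  | succ j ih =>
    rw [← hvc j _ hj]
    rcases i with _ | i
    · exact hv0 j (by omega)
    · rw [← hvc i _ hi]
      exact ih i (by omega) (by omega)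

end JordanSummand

section Matrix

theorem not_xiMem_of_congSummand (hchar : (2 : F) ≠ 0) {n r : ℕ} {M : Matrix (Fin n) (Fin n) F}
    {Q : Matrix (Fin r) (Fin r) F} (hr : Odd r) (h : CongSummand M Q) : ¬ XiMem M := by
  obtain ⟨s, hn, B, P, hP, hD⟩ := h
  set D := Matrix.reindex (finCongr hn) (finCongr hn) (dSum Q B) with hDdef
  have hPdet : IsUnit P.det := (Matrix.isUnit_iff_isUnit_det P).1 hP
  let T : Matrix (Fin n) (Fin n) F :=
    Matrix.reindex (finCongr hn) (finCongr hn) 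
      (dSum (-1 : Matrix (Fin r) (Fin r) F) (1 : Matrix (Fin s) (Fin s) F))
  have hT : Tᵀ * D * T = D := by
    simp only [T, hDdef, dSum, Matrix.reindex_apply, Matrix.transpose_submatrix,
      Matrix.submatrix_mul_equiv, Matrix.fromBlocks_transpose, Matrix.fromBlocks_multiply]
    simp
  have hTdet : T.det = -1 := by
    simp only [T, dSum, Matrix.det_reindex_self]
    simp [Matrix.det_neg, hr.neg_one_pow]
  intro hM
  have hTu : IsUnit (P * T * P⁻¹) := by
    rw [Matrix.isUnit_iff_isUnit_det, Matrix.det_mul, Matrix.det_mul, hTdet]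
    exact (hPdet.mul isUnit_one.neg).mul (Matrix.isUnit_nonsing_inv_det _ hPdet)
  have hMD : M = P⁻¹ᵀ * D * P⁻¹ := by
    rw [← hD, Matrix.transpose_nonsing_inv]
    simp only [Matrix.mul_assoc]
    rw [Matrix.mul_nonsing_inv _ hPdet, Matrix.mul_one, ← Matrix.mul_assoc,
      Matrix.nonsing_inv_mul _ (by rwa [Matrix.det_transpose]), Matrix.one_mul]
  have h := hM (P * T * P⁻¹) hTu (by
    calc (P * T * P⁻¹)ᵀ * M * (P * T * P⁻¹) = P⁻¹ᵀ * (Tᵀ * (Pᵀ * M * P) * T) * P⁻¹ := by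
          simp only [Matrix.transpose_mul, Matrix.mul_assoc]
      _ = M := by rw [hD, hT, ← hMD])
  rw [Matrix.det_mul, Matrix.det_mul, hTdet, Matrix.det_nonsing_inv, mul_neg_one, neg_mul,
    Ring.mul_inverse_cancel _ hPdet] at h
  exact hchar (by linear_combination -h)

theorem OrthSummand.congSummand {n r : ℕ} {M : Matrix (Fin n) (Fin n) F}
    {Q : Matrix (Fin r) (Fin r) F} (h : OrthSummand (Matrix.toBilin' M) Q) : CongSummand M Q := by
  obtain ⟨e, Z, hli, hQ, hc, horth⟩ := h
  let b := Module.finBasis F Z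
  let b₀ := (Module.Basis.span hli).prod b |>.map (Submodule.prodEquivOfIsCompl _ Z hc)
  have hb₀l (i : Fin r) : b₀ (.inl i) = e i := by simp [b₀, Module.Basis.span_apply]
  have hb₀r (i : Fin (finrank F Z)) : b₀ (.inr i) = b i := by simp [b₀]
  have hn : r + finrank F Z = n := by
    have := Module.finrank_eq_card_basis b₀
    simpa using this.symm
  let σ : Fin r ⊕ Fin (finrank F Z) ≃ Fin n := finSumFinEquiv.trans (finCongr hn)
  let P : Matrix (Fin n) (Fin n) F := (Pi.basisFun F (Fin n)).toMatrix (b₀.reindex σ)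
  have hP : Pᵀ * M * P = Matrix.of fun i j =>
      Matrix.toBilin' M (b₀ (σ.symm i)) (b₀ (σ.symm j)) := by
    have hM := LinearMap.BilinForm.toMatrix'_toBilin' M
    rw [← LinearMap.BilinForm.toMatrix_basisFun] at hM
    have := LinearMap.BilinForm.toMatrix_mul_basis_toMatrix (Pi.basisFun F (Fin n))
      (b₀.reindex σ) (Matrix.toBilin' M)
    rw [hM] at this
    rw [this]
    ext i j
    simp [LinearMap.BilinForm.toMatrix_apply]
  refine ⟨finrank F Z, hn, Matrix.of fun i j => Matrix.toBilin' M (b i) (b j), P, ?_, ?_⟩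
  · have := (Pi.basisFun F (Fin n)).invertibleToMatrix (b₀.reindex σ)
    exact isUnit_of_invertible P
  · rw [hP]
    ext i j
    obtain ⟨i, rfl⟩ := σ.surjective i
    obtain ⟨j, rfl⟩ := σ.surjective j
    have hD : Matrix.reindex (finCongr hn) (finCongr hn)
      (dSum Q (Matrix.of fun i j => Matrix.toBilin' M (b i) (b j))) (σ i) (σ j) =
        Matrix.fromBlocks Q 0 0 (Matrix.of fun i j => Matrix.toBilin' M (b i) (b j)) i j := by
      simp [σ, dSum]
    rw [hD, Matrix.of_apply, σ.symm_apply_apply, σ.symm_apply_apply]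
    rcases i with i | i <;> rcases j with j | j
    · rw [hb₀l, hb₀l, hQ, Matrix.fromBlocks_apply₁₁]
    · rw [hb₀l, hb₀r, (horth i _ (b j).2).1]; rfl
    · rw [hb₀l, hb₀r, (horth j _ (b i).2).2]; rfl
    · rw [hb₀r, hb₀r]; rfl

theorem hasOddSummand_of_not_xiMem (hchar : (2 : F) ≠ 0) {n : ℕ} {M : Matrix (Fin n) (Fin n) F}
    (h : ¬ XiMem M) : HasOddSummand (Matrix.toBilin' M) := by
  by_cases hf : ∀ u, IsNilChain (Matrix.toBilin' M) u → u 0 = 0 → u = 0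
  · simp only [XiMem, not_forall] at h
    obtain ⟨S, hS, hSM, hdet⟩ := h
    have hSdet := (Matrix.isUnit_iff_isUnit_det S).1 hS
    refine hasOddSummand_of_isometry_of_nilChain_eq_zero hchar hf
      (Matrix.toLinearEquiv' S (S.invertibleOfIsUnitDet hSdet)) (fun x y => ?_) ?_
    · conv_rhs => rw [← hSM, ← Matrix.toBilin'_comp]
      rfl
    · rwa [Matrix.toLinearEquiv'_apply, LinearMap.det_toLin']
  · push Not at hf
    obtain ⟨u, hu, h0, hne⟩ := hf
    obtain ⟨m, hm⟩ := exists_orthSummand_jordanBlock hu h0 hne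
    exact .inr ⟨2 * m + 1, odd_two_mul_add_one m, hm⟩

end Matrix

/-- `M ∉ Ξ_n(F)` iff `M` has a direct summand for congruence that is
either an invertible `Q` with `Q⁻ᵀQ` similar to `J_r(1)`, `r` odd, or `J_s(0)`, `s` odd. -/
theorem stmt_7 {F : Type*} [Field F] (hchar : (2 : F) ≠ 0) {n : ℕ}
    (M : Matrix (Fin n) (Fin n) F) :
    ¬ XiMem M ↔
      (∃ r : ℕ, Odd r ∧ ∃ Q : Matrix (Fin r) (Fin r) F, IsUnit Q ∧
          MatSimilar (Q⁻¹ᵀ * Q) (jordanBlock r (1 : F)) ∧ CongSummand M Q) ∨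
      (∃ s : ℕ, Odd s ∧ CongSummand M (jordanBlock s (0 : F))) := by
  constructor
  · intro h
    rcases hasOddSummand_of_not_xiMem hchar h with ⟨r, hr, Q, hQ, hs, h⟩ | ⟨s, hs, h⟩
    · exact .inl ⟨r, hr, Q, hQ, hs, h.congSummand⟩
    · exact .inr ⟨s, hs, h.congSummand⟩
  · rintro (⟨r, hr, Q, -, -, h⟩ | ⟨s, hs, h⟩)
    · exact not_xiMem_of_congSummand hchar hr h
    · exact not_xiMem_of_congSummand hchar hs h
end

section
/- Let F be a field of characteristic different from 2 and let M be an n×n matrix over F. Then M ∉ Ξ_n(F) if and only if the pair (Mᵀ, M) has a direct summand for equivalence that is either (I_r, J_r(1)) with r odd, or (F_t, G_t) for some t ≥ 1. -/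
open Matrix Polynomial

variable {F : Type*} [Field F]

section Alternating

variable {V : Type*} [AddCommGroup V] [Module F V] [FiniteDimensional F V]

/-- An isometry of an alternating form that moves some `v` to a vector not orthogonal to `v` can be
multiplied by a transvection so as to enlarge its space of fixed vectors. -/
theorem exists_isometry_finrank_fixed_lt {B : LinearMap.BilinForm F V} (hB : B.IsAlt)
    {S : V →ₗ[F] V} (hS : ∀ x y, B (S x) (S y) = B x y) {v : V} (hv : B v (S v) ≠ 0) :
    ∃ T : V →ₗ[F] V, (∀ x y, B (T x) (T y) = B x y) ∧ T.det = S.det ∧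
      LinearMap.ker (S - 1) < LinearMap.ker (T - 1) := by
  set u := S v - v with hu
  have hneg : ∀ x y, B y x = -B x y := fun x y => (hB.neg_eq x y).symm
  set f : V →ₗ[F] F := (B v (S v))⁻¹ • B u with hf
  have hfx : ∀ x, f x = (B v (S v))⁻¹ * B u x := fun x => rfl
  have hfu : f u = 0 := by rw [hfx, hB u, mul_zero]
  refine ⟨LinearMap.transvection f u ∘ₗ S, fun x y => ?_, ?_, ?_⟩
  · rw [← hS x y]
    simp only [LinearMap.comp_apply, LinearMap.transvection.apply, map_add, map_smul,
      LinearMap.add_apply, LinearMap.smul_apply, smul_eq_mul, hB u, hfx, hneg u (S x)]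
    ring
  · rw [LinearMap.det_comp, LinearMap.transvection.det, hfu, add_zero, one_mul]
  · refine SetLike.lt_iff_le_and_exists.2 ⟨fun x hx => ?_, v, ?_, ?_⟩
    · have hx' : S x = x := by simpa [sub_eq_zero] using hx
      have h0 : B u x = 0 := by
        have := hS v x
        rw [hx'] at this
        simp [hu, this]
      simp [LinearMap.transvection.apply, hx', hfx, h0]
    · have h1 : B u (S v) = -B v (S v) := by simp [hu, hB (S v)]
      have h2 : f (S v) = -1 := by rw [hfx, h1, mul_neg, inv_mul_cancel₀ hv]
      simp [LinearMap.transvection.apply, h2, hu]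
    · intro h
      have h' : S v = v := by simpa [sub_eq_zero] using h
      exact hv (by rw [h', hB v])

/-- An isometry of a nondegenerate alternating form has determinant `1`. -/
theorem det_eq_one_of_isAlt (h2 : (2 : F) ≠ 0) {B : LinearMap.BilinForm F V} (hB : B.IsAlt)
    (hnd : ∀ x, (∀ y, B x y = 0) → x = 0)
    {S : V →ₗ[F] V} (hS : ∀ x y, B (S x) (S y) = B x y) : S.det = 1 := by
  obtain ⟨d, hd⟩ : ∃ d, Module.finrank F V - Module.finrank F (LinearMap.ker (S - 1)) = d :=
    ⟨_, rfl⟩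
  induction d using Nat.strong_induction_on generalizing S with
  | _ d ih =>
  by_cases hS1 : S = 1
  · simp [hS1]
  have hneg : ∀ x y, B y x = -B x y := fun x y => (hB.neg_eq x y).symm
  have key : ∀ S' : V →ₗ[F] V, (∀ x y, B (S' x) (S' y) = B x y) → S'.det = S.det →
      LinearMap.ker (S - 1) ≤ LinearMap.ker (S' - 1) → (∃ v, B v (S' v) ≠ 0) → S.det = 1 := by
    rintro S' hS' hdet hle ⟨v, hv⟩
    obtain ⟨T, hT, hTdet, hlt⟩ := exists_isometry_finrank_fixed_lt hB hS' hv
    rw [← hdet, ← hTdet]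
    refine ih _ ?_ hT rfl
    have h1 := Submodule.finrank_lt_finrank_of_lt (hle.trans_lt hlt)
    have h2 := Submodule.finrank_le (LinearMap.ker (T - 1))
    omega
  by_cases hex : ∃ v, B v (S v) ≠ 0
  · exact key S hS rfl le_rfl hex
  push Not at hex
  have hadj : ∀ v w, B v (S w) = B (S v) w := fun v w => by
    have h := hex (v + w)
    simp only [map_add, LinearMap.add_apply, hex, zero_add, add_zero] at h
    rw [hneg w (S v)]
    linear_combination h
  have hinv : ∀ v, S (S v) = v := fun v => by
    refine sub_eq_zero.1 (hnd _ fun y => ?_)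
    rw [map_sub, LinearMap.sub_apply, ← hadj, hS, sub_self]
  obtain ⟨x, hx⟩ : ∃ x, S x ≠ x := by
    by_contra! h
    exact hS1 (LinearMap.ext h)
  set v := x - S x with hv
  have hSv : S v = -v := by simp [hv, hinv]
  have hv0 : v ≠ 0 := fun h => hx (sub_eq_zero.1 h).symm
  obtain ⟨w, hw⟩ : ∃ w, B v w ≠ 0 := by
    by_contra! h
    exact hv0 (hnd _ h)
  refine key (LinearMap.transvection (B v) v ∘ₗ S) (fun x y => ?_) ?_ (fun y hy => ?_) ⟨w, ?_⟩
  · rw [← hS x y]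
    simp only [LinearMap.comp_apply, LinearMap.transvection.apply, map_add, map_smul,
      LinearMap.add_apply, LinearMap.smul_apply, smul_eq_mul, hB v, hneg v (S x)]
    ring
  · rw [LinearMap.det_comp, LinearMap.transvection.det, hB v, add_zero, one_mul]
  · have hy' : S y = y := by simpa [sub_eq_zero] using hy
    have h0 : B v y = 0 := by
      have h := hS v y
      rw [hSv, hy', map_neg, LinearMap.neg_apply] at h
      have h3 : (2 : F) * B v y = 0 := by linear_combination -h
      exact (mul_eq_zero.1 h3).resolve_left h2
    simp [LinearMap.transvection.apply, hy', h0]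
  · have h1 : B v (S w) = -B v w := by rw [hadj, hSv, map_neg, LinearMap.neg_apply]
    simp only [LinearMap.comp_apply, LinearMap.transvection.apply, map_add, map_smul, smul_eq_mul,
      hex, zero_add, h1, hneg v w]
    simpa using hw

/-- The determinant of an isometry of an alternating form is its determinant on the radical. -/
theorem det_eq_det_restrict_ker (h2 : (2 : F) ≠ 0) {B : LinearMap.BilinForm F V} (hB : B.IsAlt)
    {S : V →ₗ[F] V} (hS : ∀ x y, B (S x) (S y) = B x y)
    (hker : LinearMap.ker B ≤ (LinearMap.ker B).comap S) :
    S.det = (S.restrict hker).det := by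
  rw [LinearMap.det_eq_det_mul_det _ S hker]
  obtain ⟨s, hs⟩ := (LinearMap.ker B).mkQ.exists_rightInverse_of_surjective
    (Submodule.range_mkQ _)
  have hs' : ∀ a, (LinearMap.ker B).mkQ (s a) = a := fun a => LinearMap.congr_fun hs a
  have hl : ∀ x y, (LinearMap.ker B).mkQ x = (LinearMap.ker B).mkQ y → B x = B y :=
    fun x y h => by
      have h' := (Submodule.Quotient.eq _).1 h
      rwa [LinearMap.mem_ker, map_sub, sub_eq_zero] at h'
  have hr : ∀ x y z, (LinearMap.ker B).mkQ x = (LinearMap.ker B).mkQ y → B z x = B z y :=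
    fun x y z h => by rw [← hB.neg_eq, ← hB.neg_eq y, hl x y h]
  have hmap : ∀ a, (LinearMap.ker B).mkQ (s ((LinearMap.ker B).mapQ _ S hker a)) =
      (LinearMap.ker B).mkQ (S (s a)) := fun a => by
    rw [hs']
    conv_lhs => rw [← hs' a]
    simp
  have h1 : ((LinearMap.ker B).mapQ _ S hker).det = 1 := by
    refine det_eq_one_of_isAlt h2 (B := B.compl₁₂ s s) (fun a => hB _) (fun a ha => ?_)
      fun a b => ?_
    · rw [← hs' a]
      refine (Submodule.Quotient.mk_eq_zero _).2 (LinearMap.ext fun y => ?_)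
      rw [hr y (s ((LinearMap.ker B).mkQ y)) _ (hs' _).symm]
      exact ha _
    · simp only [LinearMap.compl₁₂_apply]
      rw [hl _ _ (hmap a), hr _ _ _ (hmap b), hS]
  rw [h1, mul_one]

end Alternating

section Chains

variable {m n : Type*} [Fintype n]

/-- The iterated linear relation `{(x, y) | A x = B y}`: starting from `W`, one repeatedly passes
to the subspace of all `x` with `A x ∈ B W`. -/
def relIter (A B : Matrix m n F) (W : Submodule F (n → F)) : ℕ → Submodule F (n → F)
  | 0 => W
  | k + 1 => ((relIter A B W k).map B.mulVecLin).comap A.mulVecLin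

theorem mem_relIter_succ {A B : Matrix m n F} {W : Submodule F (n → F)} {k : ℕ} {x : n → F} :
    x ∈ relIter A B W (k + 1) ↔ ∃ y ∈ relIter A B W k, A *ᵥ x = B *ᵥ y := by
  simp [relIter, eq_comm]

theorem mem_relIter {A B : Matrix m n F} {W : Submodule F (n → F)} {k : ℕ} {x : n → F} :
    x ∈ relIter A B W k ↔
      ∃ c : ℕ → n → F, c 0 = x ∧ c k ∈ W ∧ ∀ j < k, A *ᵥ c j = B *ᵥ c (j + 1) := by
  induction k generalizing x with
  | zero => exact ⟨fun h => ⟨fun _ => x, rfl, h, by simp⟩, by rintro ⟨c, rfl, h, -⟩; exact h⟩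
  | succ k ih =>
    rw [mem_relIter_succ]
    constructor
    · rintro ⟨y, hy, hxy⟩
      obtain ⟨c, rfl, hk, hc⟩ := ih.1 hy
      refine ⟨fun j => j.casesOn x c, rfl, hk, fun j hj => ?_⟩
      cases j with
      | zero => exact hxy
      | succ j => exact hc j (by omega)
    · rintro ⟨c, rfl, hk, hc⟩
      exact ⟨c 1, ih.2 ⟨fun j => c (j + 1), rfl, hk, fun j hj => hc (j + 1) (by omega)⟩,
        hc 0 (by omega)⟩

theorem relIter_top_antitone (A B : Matrix m n F) : Antitone (relIter A B ⊤) := by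
  refine antitone_nat_of_succ_le fun k => ?_
  induction k with
  | zero => exact le_top
  | succ k ih =>
    intro x hx
    obtain ⟨y, hy, hxy⟩ := mem_relIter_succ.1 hx
    exact mem_relIter_succ.2 ⟨y, ih hy, hxy⟩

theorem exists_relIter_top_eq (A B : Matrix m n F) :
    ∃ k, ∀ l, k ≤ l → relIter A B ⊤ k = relIter A B ⊤ l :=
  IsArtinian.monotone_stabilizes ⟨relIter A B ⊤, relIter_top_antitone A B⟩

theorem mulVec_mem_relIter [Fintype m] {A B : Matrix m n F} {S : Matrix n n F} {R : Matrix m m F}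
    (hA : A * S = R * A) (hB : B * S = R * B) {k : ℕ} {x : n → F} (hx : x ∈ relIter A B ⊤ k) :
    S *ᵥ x ∈ relIter A B ⊤ k := by
  induction k generalizing x with
  | zero => trivial
  | succ k ih =>
    obtain ⟨y, hy, hxy⟩ := mem_relIter_succ.1 hx
    refine mem_relIter_succ.2 ⟨_, ih hy, ?_⟩
    rw [mulVec_mulVec, mulVec_mulVec, hA, hB, ← mulVec_mulVec, ← mulVec_mulVec, hxy]

/-- A functional vanishing on `relIter A B ⊥ k` starts a chain of length `k` of functionals. -/
theorem exists_dual_chain_s8 [Fintype m] (A B : Matrix m n F) {k : ℕ} {p : n → F}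
    (hp : ∀ u ∈ relIter A B ⊥ k, p ⬝ᵥ u = 0) :
    ∃ (c : ℕ → n → F) (q : ℕ → m → F), c 0 = p ∧
      ∀ j < k, q j ᵥ* A = c j ∧ q j ᵥ* B = c (j + 1) := by
  classical
  induction k generalizing p with
  | zero => exact ⟨fun _ => p, fun _ => 0, rfl, by simp⟩
  | succ k ih =>
    set N := (relIter A B ⊥ k).map B.mulVecLin with hN
    have hmem : dotProductEquiv F n p ∈
        (LinearMap.ker (N.mkQ ∘ₗ A.mulVecLin)).dualAnnihilator := by
      refine (Submodule.mem_dualAnnihilator _).2 fun u hu => hp u ?_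
      rwa [LinearMap.ker_comp, Submodule.ker_mkQ] at hu
    rw [← LinearMap.range_dualMap_eq_dualAnnihilator_ker] at hmem
    obtain ⟨f, hf⟩ := hmem
    set q := (dotProductEquiv F m).symm (f ∘ₗ N.mkQ) with hq
    have hqf : ∀ w, q ⬝ᵥ w = f (N.mkQ w) := fun w =>
      LinearMap.congr_fun ((dotProductEquiv F m).apply_symm_apply (f ∘ₗ N.mkQ)) w
    have hqA : q ᵥ* A = p := by
      refine (dotProductEquiv F n).injective (LinearMap.ext fun w => ?_)
      change (q ᵥ* A) ⬝ᵥ w = _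
      rw [← hf, ← dotProduct_mulVec, hqf]
      rfl
    obtain ⟨c, q', hc, hq'⟩ := ih (p := q ᵥ* B) fun u hu => by
      rw [← dotProduct_mulVec, hqf]
      have : N.mkQ (B *ᵥ u) = 0 := by
        rw [Submodule.mkQ_apply, Submodule.Quotient.mk_eq_zero]
        exact ⟨u, hu, rfl⟩
      rw [this, map_zero]
    refine ⟨fun j => j.casesOn p c, fun j => j.casesOn q q', rfl, fun j hj => ?_⟩
    cases j with
    | zero => exact ⟨hqA, hc.symm⟩
    | succ j => exact hq' j (by omega)

variable {H K : Matrix n n F}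

theorem dotProduct_mulVec_comm_of_symm (hH : Hᵀ = H) (x y : n → F) :
    x ⬝ᵥ H *ᵥ y = y ⬝ᵥ H *ᵥ x := by
  rw [dotProduct_mulVec, ← mulVec_transpose, hH, dotProduct_comm]

theorem dotProduct_mulVec_comm_of_skew (hK : Kᵀ = -K) (x y : n → F) :
    x ⬝ᵥ K *ᵥ y = -(y ⬝ᵥ K *ᵥ x) := by
  rw [dotProduct_mulVec, ← mulVec_transpose, hK, neg_mulVec, neg_dotProduct, dotProduct_comm]

theorem chain_pairing (hH : Hᵀ = H) (hK : Kᵀ = -K) {k : ℕ} {c c' : ℕ → n → F}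
    (hc : ∀ j < k, H *ᵥ c j = K *ᵥ c (j + 1)) (hc' : ∀ j < k, H *ᵥ c' j = K *ᵥ c' (j + 1))
    {i j : ℕ} (hij : j + i ≤ k) :
    c i ⬝ᵥ H *ᵥ c' j = (-1) ^ i * (c 0 ⬝ᵥ H *ᵥ c' (j + i)) := by
  induction i generalizing j with
  | zero => simp
  | succ i ih =>
    have h := ih (j := j + 1) (by omega)
    rw [show j + (i + 1) = j + 1 + i by ring, pow_succ, mul_neg_one, neg_mul, ← h,
      hc' j (by omega), dotProduct_mulVec_comm_of_skew hK, ← hc i (by omega),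
      dotProduct_mulVec_comm_of_symm hH]

theorem mem_relIter_bot_iff {k : ℕ} {z : n → F} :
    z ∈ relIter K H ⊥ (k + 1) ↔ ∃ c : ℕ → n → F, c k = z ∧ K *ᵥ c 0 = 0 ∧
      ∀ j < k, H *ᵥ c j = K *ᵥ c (j + 1) := by
  rw [mem_relIter]
  constructor
  · rintro ⟨u, rfl, h0, hu⟩
    refine ⟨fun j => u (k - j), by simp, ?_, fun j hj => ?_⟩
    · simp only [tsub_zero]
      rw [hu k (by omega), (Submodule.mem_bot F).1 h0, mulVec_zero]
    · rw [hu (k - (j + 1)) (by omega), show k - (j + 1) + 1 = k - j by omega]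
  · rintro ⟨c, rfl, h0, hc⟩
    refine ⟨fun j => if j ≤ k then c (k - j) else 0, by simp, by simp, fun j hj => ?_⟩
    rcases Nat.lt_or_ge j k with h | h
    · simp only []
      rw [if_pos (by omega), if_pos (by omega), hc _ (by omega),
        show k - (j + 1) + 1 = k - j by omega]
    · obtain rfl : j = k := by omega
      simp [h0]

/-- `relIter H K ⊤ k` is orthogonal to `relIter K H ⊥ k`. -/
theorem orthogonal_of_mem_relIter (hH : Hᵀ = H) (hK : Kᵀ = -K) {k : ℕ} {x z : n → F}
    (hx : x ∈ relIter H K ⊤ k) (hz : z ∈ relIter K H ⊥ k) : x ⬝ᵥ H *ᵥ z = 0 := by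
  obtain ⟨c, rfl, -, hc⟩ := mem_relIter.1 hx
  obtain ⟨u, rfl, h0, hu⟩ := mem_relIter.1 hz
  have h := chain_pairing hH hK (c := c) (c' := fun j => u (k - j)) hc (fun j hj => by
    rw [hu (k - (j + 1)) (by omega), show k - (j + 1) + 1 = k - j by omega]) (i := k) (j := 0)
    (by omega)
  simp only [tsub_zero, zero_add, tsub_self, (Submodule.mem_bot F).1 h0, mulVec_zero,
    dotProduct_zero] at h
  exact (mul_eq_zero.1 h.symm).resolve_left (pow_ne_zero _ (neg_ne_zero.2 one_ne_zero))

/-- Everything orthogonal to `relIter K H ⊥ k` lies in `relIter H K ⊤ k`. -/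
theorem mem_relIter_of_orthogonal (hH : Hᵀ = H) (hK : Kᵀ = -K) {k : ℕ} {x : n → F}
    (hx : ∀ z ∈ relIter K H ⊥ k, x ⬝ᵥ H *ᵥ z = 0) : x ∈ relIter H K ⊤ k := by
  obtain ⟨p, q, hp, hq⟩ := exists_dual_chain_s8 K H (k := k) (p := x ᵥ* H)
    fun u hu => by rw [← dotProduct_mulVec, hx u hu]
  have hq' : ∀ j < k, K *ᵥ q j = -p j ∧ H *ᵥ q j = p (j + 1) := fun j hj => by
    rw [← (hq j hj).1, ← (hq j hj).2, ← mulVec_transpose, ← mulVec_transpose, hK, hH, neg_mulVec,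
      neg_neg]
    exact ⟨rfl, rfl⟩
  refine mem_relIter.2 ⟨fun j => j.casesOn x fun j => (-1 : F) ^ (j + 1) • q j, rfl, trivial,
    fun j hj => ?_⟩
  cases j with
  | zero =>
    simp only [zero_add, pow_one, mulVec_smul, (hq' 0 hj).1, hp, ← mulVec_transpose, hH]
    simp
  | succ j =>
    simp only [mulVec_smul, (hq' (j + 1) hj).1, (hq' j (by omega)).2, pow_succ]
    simp

/-- If the filtration of `ker K` drops at an even step, some chain has nonzero self-pairing. -/
theorem exists_chain_of_gap (h2 : (2 : F) ≠ 0) (hH : Hᵀ = H) (hK : Kᵀ = -K) {k : ℕ} (hk : Even k)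
    {x : n → F} (hKx : K *ᵥ x = 0) (hx : x ∈ relIter H K ⊤ k) (hx' : x ∉ relIter H K ⊤ (k + 1)) :
    ∃ c : ℕ → n → F, K *ᵥ c 0 = 0 ∧ (∀ j < k, H *ᵥ c j = K *ᵥ c (j + 1)) ∧
      c 0 ⬝ᵥ H *ᵥ c k ≠ 0 := by
  obtain ⟨z, hz, hxz⟩ : ∃ z ∈ relIter K H ⊥ (k + 1), x ⬝ᵥ H *ᵥ z ≠ 0 := by
    by_contra! h
    exact hx' (mem_relIter_of_orthogonal hH hK h)
  obtain ⟨c, rfl, -, hc⟩ := mem_relIter.1 hx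
  obtain ⟨c', rfl, hK', hc'⟩ := mem_relIter_bot_iff.1 hz
  by_cases h1 : c 0 ⬝ᵥ H *ᵥ c k = 0
  · by_cases h1' : c' 0 ⬝ᵥ H *ᵥ c' k = 0
    · refine ⟨c + c', by simp [mulVec_add, hKx, hK'],
        fun j hj => by simp [mulVec_add, hc j hj, hc' j hj], ?_⟩
      have h := chain_pairing hH hK hc hc' (i := k) (j := 0) (by omega)
      rw [hk.neg_one_pow, one_mul, zero_add, dotProduct_mulVec_comm_of_symm hH] at h
      simp only [Pi.add_apply, mulVec_add, add_dotProduct, dotProduct_add, h1, h1', h, zero_add,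
        add_zero, ← two_mul]
      exact mul_ne_zero h2 hxz
    · exact ⟨c', hK', hc', h1'⟩
  · exact ⟨c, hKx, hc, h1⟩

end Chains

section Determinant

theorem det_restrict_eq_det_restrict {V : Type*} [AddCommGroup V] [Module F V]
    [FiniteDimensional F V] (h2 : (2 : F) ≠ 0) {S : V →ₗ[F] V} {W W' : Submodule F V}
    (hW : W ≤ W.comap S) (hW' : W' ≤ W'.comap S) (hle : W' ≤ W) {B : LinearMap.BilinForm F W}
    (hB : B.IsAlt) (hS : ∀ x y, B (S.restrict hW x) (S.restrict hW y) = B x y)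
    (hker : ∀ x, B x = 0 ↔ (x : V) ∈ W') :
    (S.restrict hW).det = (S.restrict hW').det := by
  have hinv : LinearMap.ker B ≤ (LinearMap.ker B).comap (S.restrict hW) := fun x hx =>
    (hker _).2 (hW' ((hker x).1 hx))
  rw [det_eq_det_restrict_ker h2 hB hS hinv]
  let e : LinearMap.ker B ≃ₗ[F] W' :=
    { toFun := fun x => ⟨x.1.1, (hker x.1).1 x.2⟩
      invFun := fun x => ⟨⟨x.1, hle x.2⟩, (hker _).2 x.2⟩
      map_add' := fun _ _ => rfl
      map_smul' := fun _ _ => rfl }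
  rw [← LinearMap.det_conj _ e]
  rfl

variable {n : Type*} [Fintype n]

/-- The decreasing filtration of the kernel of `K` by lengths of chains. -/
def kerFiltration (H K : Matrix n n F) (k : ℕ) : Submodule F (n → F) :=
  LinearMap.ker K.mulVecLin ⊓ relIter H K ⊤ k

variable {H K : Matrix n n F}

theorem dotProduct_mulVec_isometry {S A : Matrix n n F} (hA : Sᵀ * A * S = A) (x y : n → F) :
    (S *ᵥ x) ⬝ᵥ A *ᵥ (S *ᵥ y) = x ⬝ᵥ A *ᵥ y := by
  conv_rhs => rw [← hA]
  rw [← mulVec_mulVec, ← mulVec_mulVec, dotProduct_mulVec x, vecMul_transpose]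

theorem mem_kerFiltration_iff {k : ℕ} {x : n → F} :
    x ∈ kerFiltration H K k ↔ ∃ c : ℕ → n → F, c 0 = x ∧ K *ᵥ c 0 = 0 ∧
      ∀ j < k, H *ᵥ c j = K *ᵥ c (j + 1) := by
  simp only [kerFiltration, Submodule.mem_inf, mem_relIter, LinearMap.mem_ker, mulVecLin_apply]
  constructor
  · rintro ⟨h0, c, rfl, -, hc⟩
    exact ⟨c, rfl, h0, hc⟩
  · rintro ⟨c, rfl, h0, hc⟩
    exact ⟨h0, c, rfl, trivial, hc⟩

theorem exists_linear_chain (H K : Matrix n n F) (k : ℕ) :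
    ∃ s : kerFiltration H K k →ₗ[F] (ℕ → n → F), ∀ x, s x 0 = x ∧
      ∀ j < k, H *ᵥ s x j = K *ᵥ s x (j + 1) := by
  let C : Submodule F (ℕ → n → F) :=
    { carrier := {c | K *ᵥ c 0 = 0 ∧ ∀ j < k, H *ᵥ c j = K *ᵥ c (j + 1)}
      zero_mem' := by simp
      add_mem' := by
        rintro c d ⟨hc0, hc⟩ ⟨hd0, hd⟩
        exact ⟨by simp [mulVec_add, hc0, hd0], fun j hj => by simp [mulVec_add, hc j hj, hd j hj]⟩
      smul_mem' := by
        rintro a c ⟨hc0, hc⟩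
        exact ⟨by simp [mulVec_smul, hc0], fun j hj => by simp [mulVec_smul, hc j hj]⟩ }
  let ev : C →ₗ[F] kerFiltration H K k :=
    LinearMap.codRestrict _ (LinearMap.proj 0 ∘ₗ C.subtype) fun c =>
      mem_kerFiltration_iff.2 ⟨c, rfl, c.2.1, c.2.2⟩
  have hev : LinearMap.range ev = ⊤ := LinearMap.range_eq_top.2 fun x => by
    obtain ⟨c, hx, hc⟩ := mem_kerFiltration_iff.1 x.2
    exact ⟨⟨c, hc⟩, Subtype.ext hx⟩
  obtain ⟨g, hg⟩ := ev.exists_rightInverse_of_surjective hev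
  exact ⟨C.subtype ∘ₗ g, fun x => ⟨congrArg Subtype.val (LinearMap.congr_fun hg x), (g x).2.2⟩⟩

variable [DecidableEq n] {S : Matrix n n F}

theorem mul_eq_inv_transpose_mul (hS : IsUnit S) {A : Matrix n n F} (hA : Sᵀ * A * S = A) :
    A * S = Sᵀ⁻¹ * A := by
  have hdet : IsUnit Sᵀ.det := by rwa [det_transpose, ← isUnit_iff_isUnit_det]
  conv_rhs => rw [← hA, Matrix.mul_assoc, nonsing_inv_mul_cancel_left _ _ hdet]

theorem kerFiltration_le_comap (hS : IsUnit S) (hSH : Sᵀ * H * S = H) (hSK : Sᵀ * K * S = K)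
    (k : ℕ) : kerFiltration H K k ≤ (kerFiltration H K k).comap S.mulVecLin := by
  rintro x ⟨hx, hx'⟩
  have hH := mul_eq_inv_transpose_mul hS hSH
  have hK := mul_eq_inv_transpose_mul hS hSK
  refine ⟨?_, mulVec_mem_relIter hH hK hx'⟩
  simp only [SetLike.mem_coe, LinearMap.mem_ker, mulVecLin_apply] at hx ⊢
  rw [mulVec_mulVec, hK, ← mulVec_mulVec, hx, mulVec_zero]

theorem det_restrict_kerFiltration_succ (h2 : (2 : F) ≠ 0) (hH : Hᵀ = H) (hK : Kᵀ = -K)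
    (hS : IsUnit S) (hSH : Sᵀ * H * S = H) (hSK : Sᵀ * K * S = K) {k : ℕ} (hk : Odd k) :
    (S.mulVecLin.restrict (kerFiltration_le_comap hS hSH hSK k)).det =
      (S.mulVecLin.restrict (kerFiltration_le_comap hS hSH hSK (k + 1))).det := by
  obtain ⟨s, hs⟩ := exists_linear_chain H K k
  let B : LinearMap.BilinForm F (kerFiltration H K k) := LinearMap.mk₂ F
    (fun x y => (x : n → F) ⬝ᵥ H *ᵥ s y k)
    (by intros; simp [add_dotProduct]) (by intros; simp)
    (by intros; simp [mulVec_add]) (by intros; simp [mulVec_smul])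
  have hB : ∀ x y, B x y = (x : n → F) ⬝ᵥ H *ᵥ s y k := fun x y => rfl
  -- the last entry of a chain only matters through its first entry
  have hlast : ∀ (x y : kerFiltration H K k) (c : ℕ → n → F), c 0 = y →
      (∀ j < k, H *ᵥ c j = K *ᵥ c (j + 1)) → B x y = (x : n → F) ⬝ᵥ H *ᵥ c k := by
    intro x y c h0 hc
    rw [hB, ← sub_eq_zero, ← dotProduct_sub, ← mulVec_sub]
    refine orthogonal_of_mem_relIter hH hK x.2.2 (mem_relIter.2
      ⟨fun j => s y (k - j) - c (k - j), by simp, by simp [(hs y).1, h0], fun j hj => ?_⟩)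
    rw [mulVec_sub, mulVec_sub, (hs y).2 (k - (j + 1)) (by omega), hc (k - (j + 1)) (by omega),
      show k - (j + 1) + 1 = k - j by omega]
  refine det_restrict_eq_det_restrict h2 _ _ (fun x hx => ⟨hx.1, relIter_top_antitone H K
    (Nat.le_succ k) hx.2⟩) (B := B) (fun x => ?_) (fun x y => ?_) fun x => ?_
  · have h := chain_pairing hH hK (hs x).2 (hs x).2 (i := k) (j := 0) (by omega)
    rw [hk.neg_one_pow, zero_add, dotProduct_mulVec_comm_of_symm hH, (hs x).1, ← hB] at h
    have h3 : (2 : F) * B x x = 0 := by linear_combination h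
    exact (mul_eq_zero.1 h3).resolve_left h2
  · rw [hlast _ _ (fun j => S *ᵥ s y j) (by simp [(hs y).1]) fun j hj => ?_]
    · exact dotProduct_mulVec_isometry hSH _ _
    · rw [mulVec_mulVec, mulVec_mulVec, mul_eq_inv_transpose_mul hS hSH,
        mul_eq_inv_transpose_mul hS hSK, ← mulVec_mulVec, ← mulVec_mulVec, (hs y).2 j hj]
  · constructor
    · intro hx
      refine ⟨x.2.1, mem_relIter_of_orthogonal hH hK fun z hz => ?_⟩
      obtain ⟨c, rfl, h0, hc⟩ := mem_relIter_bot_iff.1 hz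
      rw [← hlast x ⟨c 0, mem_kerFiltration_iff.2 ⟨c, rfl, h0, hc⟩⟩ c rfl hc, hx]
      rfl
    · intro hx
      ext y
      rw [hB]
      refine orthogonal_of_mem_relIter hH hK hx.2 (mem_relIter_bot_iff.2 ⟨s y, rfl, ?_, (hs y).2⟩)
      rw [(hs y).1]
      exact y.2.1

/-- If the filtration of `ker K` only drops at odd steps and reaches `0`, then all isometries have
determinant `1`. -/
theorem det_eq_one_of_kerFiltration (h2 : (2 : F) ≠ 0) (hH : Hᵀ = H) (hK : Kᵀ = -K)
    (hS : IsUnit S) (hSH : Sᵀ * H * S = H) (hSK : Sᵀ * K * S = K)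
    (heven : ∀ k, Even k → kerFiltration H K k = kerFiltration H K (k + 1))
    {l : ℕ} (hl : kerFiltration H K l = ⊥) : S.det = 1 := by
  have hcongr : ∀ {W W' : Submodule F (n → F)} (hW : W ≤ W.comap S.mulVecLin)
      (hW' : W' ≤ W'.comap S.mulVecLin), W = W' →
      (S.mulVecLin.restrict hW).det = (S.mulVecLin.restrict hW').det := by
    rintro W _ hW hW' rfl
    rfl
  have hstep : ∀ k, (S.mulVecLin.restrict (kerFiltration_le_comap hS hSH hSK 0)).det =
      (S.mulVecLin.restrict (kerFiltration_le_comap hS hSH hSK k)).det := by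
    intro k
    induction k with
    | zero => rfl
    | succ k ih =>
      rw [ih]
      rcases Nat.even_or_odd k with hk | hk
      · exact hcongr _ _ (heven k hk)
      · exact det_restrict_kerFiltration_succ h2 hH hK hS hSH hSK hk
  let B : LinearMap.BilinForm F (n → F) := LinearMap.mk₂ F (fun x y => x ⬝ᵥ K *ᵥ y)
    (by intros; simp [add_dotProduct]) (by intros; simp)
    (by intros; simp [mulVec_add]) (by intros; simp [mulVec_smul])
  have hBK : ∀ x y, B x y = x ⬝ᵥ K *ᵥ y := fun x y => rfl
  have hker : LinearMap.ker B = kerFiltration H K 0 := by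
    ext x
    simp only [LinearMap.mem_ker, kerFiltration, relIter, le_top, inf_of_le_left, mulVecLin_apply]
    constructor
    · intro hx
      refine dotProduct_eq_zero _ fun y => ?_
      rw [dotProduct_comm, dotProduct_mulVec_comm_of_skew hK, ← hBK, hx, LinearMap.zero_apply,
        neg_zero]
    · intro hx
      refine LinearMap.ext fun y => ?_
      rw [hBK, dotProduct_mulVec_comm_of_skew hK, hx, dotProduct_zero, neg_zero]
      rfl
  have hkerS : LinearMap.ker B ≤ (LinearMap.ker B).comap S.mulVecLin := by
    rw [hker]
    exact kerFiltration_le_comap hS hSH hSK 0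
  have hBalt : B.IsAlt := fun x => by
    have h := dotProduct_mulVec_comm_of_skew hK x x
    have h3 : (2 : F) * B x x = 0 := by rw [hBK]; linear_combination h
    exact (mul_eq_zero.1 h3).resolve_left h2
  have hdet : S.det = S.mulVecLin.det := by rw [← toLin'_apply', LinearMap.det_toLin']
  rw [hdet, det_eq_det_restrict_ker h2 hBalt (fun x y => dotProduct_mulVec_isometry hSK x y) hkerS,
    hcongr _ (kerFiltration_le_comap hS hSH hSK 0) hker, hstep l]
  have hsub : Subsingleton (kerFiltration H K l) := by
    rw [hl]
    infer_instance
  exact LinearMap.det_eq_one_of_subsingleton _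

end Determinant

section Retract

/-- The pair `(A₀, B₀)` is a direct summand of `(A, B)` as soon as it is a retract of it. -/
def IsPairRetract {n a b : ℕ} (A B : Matrix (Fin n) (Fin n) F) (A₀ B₀ : Matrix (Fin a) (Fin b) F) :
    Prop :=
  ∃ (U : Matrix (Fin n) (Fin b) F) (P : Matrix (Fin b) (Fin n) F)
    (Q : Matrix (Fin a) (Fin n) F) (L : Matrix (Fin n) (Fin a) F),
    P * U = 1 ∧ Q * L = 1 ∧ A * U = L * A₀ ∧ B * U = L * B₀ ∧ Q * A = A₀ * P ∧ Q * B = B₀ * P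

/-- The inclusion of the first `b` coordinates. -/
def inclMatrix (F : Type*) [Field F] {n b d : ℕ} (h : b + d = n) : Matrix (Fin n) (Fin b) F :=
  (1 : Matrix (Fin n) (Fin n) F).submatrix id
    (fun j => (finSumFinEquiv.trans (finCongr h)) (Sum.inl j))

theorem mul_inclMatrix {m : Type*} {n b d : ℕ} (h : b + d = n) (X : Matrix m (Fin n) F) :
    X * inclMatrix F h = X.submatrix id
      (fun j => (finSumFinEquiv.trans (finCongr h)) (Sum.inl j)) := by
  conv_rhs => rw [← Matrix.mul_one X]
  rfl

theorem transpose_inclMatrix_mul {m : Type*} {n b d : ℕ} (h : b + d = n) (X : Matrix (Fin n) m F) :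
    (inclMatrix F h)ᵀ * X = X.submatrix
      (fun j => (finSumFinEquiv.trans (finCongr h)) (Sum.inl j)) id := by
  rw [← transpose_inj, transpose_mul, transpose_transpose, mul_inclMatrix, transpose_submatrix]

theorem transpose_inclMatrix_mul_self {n b d : ℕ} (h : b + d = n) :
    (inclMatrix F h)ᵀ * inclMatrix F h = 1 := by
  rw [transpose_inclMatrix_mul]
  ext i j
  simp [inclMatrix, Matrix.one_apply]

theorem inclMatrix_mul_apply_inl {m : Type*} {n b d : ℕ} (h : b + d = n) (X : Matrix (Fin b) m F)
    (i : Fin b) (j : m) :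
    (inclMatrix F h * X) (finSumFinEquiv.trans (finCongr h) (Sum.inl i)) j = X i j := by
  simp [Matrix.mul_apply, inclMatrix, Matrix.one_apply]

theorem inclMatrix_mul_apply_inr {m : Type*} {n b d : ℕ} (h : b + d = n) (X : Matrix (Fin b) m F)
    (i : Fin d) (j : m) :
    (inclMatrix F h * X) (finSumFinEquiv.trans (finCongr h) (Sum.inr i)) j = 0 := by
  simp only [Matrix.mul_apply, inclMatrix, submatrix_apply, id, Matrix.one_apply,
    EmbeddingLike.apply_eq_iff_eq, reduceCtorEq, if_false, zero_mul, Finset.sum_const_zero]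

/-- Block-diagonal matrices with given first block are recognised on the first coordinates. -/
theorem exists_eq_reindex_fromBlocks_iff {n a b c d : ℕ} (hc : a + c = n) (hd : b + d = n)
    (X : Matrix (Fin n) (Fin n) F) (A₀ : Matrix (Fin a) (Fin b) F) :
    (∃ C, X = Matrix.reindex (finSumFinEquiv.trans (finCongr hc))
      (finSumFinEquiv.trans (finCongr hd)) (Matrix.fromBlocks A₀ 0 0 C)) ↔
    X * inclMatrix F hd = inclMatrix F hc * A₀ ∧
      (inclMatrix F hc)ᵀ * X = A₀ * (inclMatrix F hd)ᵀ := by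
  set ec := finSumFinEquiv.trans (finCongr hc) with hec
  set ed := finSumFinEquiv.trans (finCongr hd) with hed
  rw [← transpose_inj (A := (inclMatrix F hc)ᵀ * X), transpose_mul A₀, transpose_transpose]
  constructor
  · rintro ⟨C, rfl⟩
    constructor
    · rw [mul_inclMatrix]
      ext i j
      obtain ⟨i, rfl⟩ := ec.surjective i
      rcases i with i | i
      · rw [inclMatrix_mul_apply_inl]
        simp [← hed]
      · rw [inclMatrix_mul_apply_inr]
        simp [← hed]
    · rw [transpose_inclMatrix_mul]
      ext i j
      obtain ⟨i, rfl⟩ := ed.surjective i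
      rcases i with i | i
      · rw [inclMatrix_mul_apply_inl]
        simp [← hec]
      · rw [inclMatrix_mul_apply_inr]
        simp [← hec]
  · rintro ⟨h1, h2⟩
    rw [mul_inclMatrix] at h1
    rw [transpose_inclMatrix_mul] at h2
    refine ⟨(X.submatrix ec ed).toBlocks₂₂, ?_⟩
    rw [← Equiv.symm_apply_eq, reindex_symm]
    ext i j
    rcases i with i | i <;> rcases j with j | j
    · have := congrFun (congrFun h1 (ec (Sum.inl i))) j
      rw [inclMatrix_mul_apply_inl] at this
      simpa [← hed] using this
    · have := congrFun (congrFun h2 (ed (Sum.inr j))) i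
      rw [inclMatrix_mul_apply_inr] at this
      simpa [← hec] using this
    · have := congrFun (congrFun h1 (ec (Sum.inr i))) j
      rw [inclMatrix_mul_apply_inr] at this
      simpa [← hed] using this
    · simp [toBlocks₂₂]

theorem PairSummand.isPairRetract {n a b : ℕ} {A B : Matrix (Fin n) (Fin n) F}
    {A₀ B₀ : Matrix (Fin a) (Fin b) F} (h : PairSummand A B A₀ B₀) : IsPairRetract A B A₀ B₀ := by
  obtain ⟨c, d, hc, hd, C, D, R, S, hR, hS, hA, hB⟩ := h
  have hR' := (isUnit_iff_isUnit_det R).1 hR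
  have hS' := (isUnit_iff_isUnit_det S).1 hS
  obtain ⟨hA1, hA2⟩ := (exists_eq_reindex_fromBlocks_iff hc hd _ _).1 ⟨C, hA⟩
  obtain ⟨hB1, hB2⟩ := (exists_eq_reindex_fromBlocks_iff hc hd _ _).1 ⟨D, hB⟩
  have key1 : ∀ {X : Matrix (Fin n) (Fin n) F} {X₀ : Matrix (Fin a) (Fin b) F},
      R * X * S * inclMatrix F hd = inclMatrix F hc * X₀ →
      X * (S * inclMatrix F hd) = R⁻¹ * inclMatrix F hc * X₀ := fun {X X₀} h => by
    rw [Matrix.mul_assoc R⁻¹, ← h, Matrix.mul_assoc, Matrix.mul_assoc,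
      nonsing_inv_mul_cancel_left _ _ hR']
  have key2 : ∀ {X : Matrix (Fin n) (Fin n) F} {X₀ : Matrix (Fin a) (Fin b) F},
      (inclMatrix F hc)ᵀ * (R * X * S) = X₀ * (inclMatrix F hd)ᵀ →
      (inclMatrix F hc)ᵀ * R * X = X₀ * ((inclMatrix F hd)ᵀ * S⁻¹) := fun {X X₀} h => by
    rw [← Matrix.mul_assoc, ← h, ← Matrix.mul_assoc, mul_nonsing_inv_cancel_right _ _ hS',
      Matrix.mul_assoc]
  refine ⟨S * inclMatrix F hd, (inclMatrix F hd)ᵀ * S⁻¹, (inclMatrix F hc)ᵀ * R,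
    R⁻¹ * inclMatrix F hc, ?_, ?_, key1 hA1, key1 hB1, key2 hA2, key2 hB2⟩
  · rw [Matrix.mul_assoc, nonsing_inv_mul_cancel_left _ _ hS', transpose_inclMatrix_mul_self]
  · rw [Matrix.mul_assoc, mul_nonsing_inv_cancel_left _ _ hR', transpose_inclMatrix_mul_self]

/-- A matrix with a left inverse extends to a basis adapted to the kernel of the left inverse. -/
theorem exists_isUnit_of_mul_eq_one {n b : ℕ} {P : Matrix (Fin b) (Fin n) F}
    {U : Matrix (Fin n) (Fin b) F} (h : P * U = 1) :
    ∃ (d : ℕ) (hd : b + d = n) (S : Matrix (Fin n) (Fin n) F), IsUnit S ∧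
      S * inclMatrix F hd = U ∧ P * S = (inclMatrix F hd)ᵀ := by
  have hsurj : LinearMap.range P.mulVecLin = ⊤ := LinearMap.range_eq_top.2 fun x =>
    ⟨U *ᵥ x, by rw [mulVecLin_apply, mulVec_mulVec, h, one_mulVec]⟩
  obtain ⟨d, hdim⟩ : ∃ d, Module.finrank F (LinearMap.ker P.mulVecLin) = d := ⟨_, rfl⟩
  have hd : b + d = n := by
    have := LinearMap.finrank_range_add_finrank_ker P.mulVecLin
    rw [hsurj, finrank_top, hdim] at this
    simpa using this
  let v := Module.finBasisOfFinrankEq F _ hdim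
  set e := finSumFinEquiv.trans (finCongr hd) with he
  let S₀ : Matrix (Fin n) (Fin b ⊕ Fin d) F := fromCols U (of fun i j => (v j : Fin n → F) i)
  have hv : ∀ a : Fin d → F, (of fun i j => (v j : Fin n → F) i) *ᵥ a =
      ((∑ j, a j • v j : LinearMap.ker P.mulVecLin) : Fin n → F) := fun a => by
    ext i
    simp [mulVec, dotProduct, mul_comm]
  refine ⟨d, hd, S₀.submatrix id e.symm, ?_, ?_, ?_⟩
  · refine mulVec_injective_iff_isUnit.1
      ((injective_iff_map_eq_zero (mulVecLin (S₀.submatrix id e.symm))).2 fun a ha => ?_)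
    have ha' : S₀ *ᵥ (a ∘ e) = 0 := by
      rw [← ha, mulVecLin_apply]
      exact (submatrix_mulVec_equiv S₀ a id e.symm).symm
    rw [fromCols_mulVec, hv] at ha'
    have h1 : a ∘ e ∘ Sum.inl = 0 := by
      have := congrArg (P *ᵥ ·) ha'
      simp only [mulVec_add, mulVec_mulVec, h, one_mulVec, mulVec_zero] at this
      have h0 := (∑ j, (a ∘ e ∘ Sum.inr) j • v j : LinearMap.ker P.mulVecLin).2
      rw [LinearMap.mem_ker, mulVecLin_apply] at h0
      rw [← this]
      exact (add_eq_left.2 h0).symm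
    have h2 : ∑ j, (a ∘ e ∘ Sum.inr) j • v j = 0 := by
      have h1' : (a ∘ e) ∘ Sum.inl = 0 := h1
      rw [h1', mulVec_zero, zero_add] at ha'
      exact Subtype.ext ha'
    have h3 := Fintype.linearIndependent_iff.1 v.linearIndependent _ h2
    ext i
    obtain ⟨i, rfl⟩ := e.surjective i
    rcases i with i | i
    · exact congrFun h1 i
    · exact h3 i
  · rw [mul_inclMatrix]
    ext i j
    simp [S₀, ← he]
  · ext i j
    obtain ⟨j, rfl⟩ := e.surjective j
    have hinr : ∀ j, P *ᵥ (v j : Fin n → F) = 0 := fun j => (v j).2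
    rcases j with j | j
    · have : (P * S₀.submatrix id e.symm) i (e (Sum.inl j)) = (P * U) i j := by
        simp [Matrix.mul_apply, S₀]
      rw [this, h]
      simp [inclMatrix, ← he, Matrix.one_apply, eq_comm]
    · have : (P * S₀.submatrix id e.symm) i (e (Sum.inr j)) = (P *ᵥ (v j : Fin n → F)) i := by
        simp [Matrix.mul_apply, S₀, mulVec, dotProduct]
      rw [this, hinr]
      simp [inclMatrix, ← he]

theorem IsPairRetract.pairSummand {n a b : ℕ} {A B : Matrix (Fin n) (Fin n) F}
    {A₀ B₀ : Matrix (Fin a) (Fin b) F} (h : IsPairRetract A B A₀ B₀) : PairSummand A B A₀ B₀ := by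
  obtain ⟨U, P, Q, L, hPU, hQL, hA1, hB1, hA2, hB2⟩ := h
  obtain ⟨d, hd, S, hS, hSU, hPS⟩ := exists_isUnit_of_mul_eq_one hPU
  obtain ⟨c, hc, T, hT, hTL, hQT⟩ := exists_isUnit_of_mul_eq_one hQL
  have hT' := (isUnit_iff_isUnit_det T).1 hT
  have hQT' : (inclMatrix F hc)ᵀ * T⁻¹ = Q := by
    rw [← hQT, mul_nonsing_inv_cancel_right _ _ hT']
  have hTL' : T⁻¹ * L = inclMatrix F hc := by
    rw [← hTL, nonsing_inv_mul_cancel_left _ _ hT']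
  have key : ∀ {X : Matrix (Fin n) (Fin n) F} {X₀ : Matrix (Fin a) (Fin b) F},
      X * U = L * X₀ → Q * X = X₀ * P → ∃ C, T⁻¹ * X * S =
        Matrix.reindex (finSumFinEquiv.trans (finCongr hc))
          (finSumFinEquiv.trans (finCongr hd)) (Matrix.fromBlocks X₀ 0 0 C) := by
    intro X X₀ h1 h2
    refine (exists_eq_reindex_fromBlocks_iff hc hd _ _).2 ⟨?_, ?_⟩
    · rw [Matrix.mul_assoc, hSU, Matrix.mul_assoc, h1, ← Matrix.mul_assoc, hTL']
    · rw [← Matrix.mul_assoc, ← Matrix.mul_assoc, hQT', h2, Matrix.mul_assoc, hPS]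
  obtain ⟨C, hC⟩ := key hA1 hA2
  obtain ⟨D, hD⟩ := key hB1 hB2
  exact ⟨c, d, hc, hd, C, D, T⁻¹, S, (isUnit_nonsing_inv_iff).2 hT, hS, hC, hD⟩

/-- A nondegenerate orthogonal summand of odd dimension yields an isometry of determinant `-1`. -/
theorem not_xiMem_of_odd {ι : Type*} [Fintype ι] [DecidableEq ι] (h2 : (2 : F) ≠ 0) {n : ℕ}
    {M : Matrix (Fin n) (Fin n) F} (hodd : Odd (Fintype.card ι)) {U : Matrix (Fin n) ι F}
    {E : Matrix ι (Fin n) F} {X Y : Matrix ι ι F} (hEU : IsUnit (E * U))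
    (hX : M * U = Eᵀ * X) (hY : Mᵀ * U = Eᵀ * Y) : ¬ XiMem M := by
  have hdet := (isUnit_iff_isUnit_det _).1 hEU
  obtain ⟨E', hE', hE⟩ : ∃ E' : Matrix ι (Fin n) F, E' * U = 1 ∧ (E * U) * E' = E :=
    ⟨(E * U)⁻¹ * E, by rw [Matrix.mul_assoc, nonsing_inv_mul _ hdet],
      mul_nonsing_inv_cancel_left _ _ hdet⟩
  obtain ⟨X', hX'⟩ : ∃ X', M * U = E'ᵀ * X' :=
    ⟨(E * U)ᵀ * X, by rw [hX, ← Matrix.mul_assoc, ← transpose_mul, hE]⟩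
  obtain ⟨Y', hY'⟩ : ∃ Y', Mᵀ * U = E'ᵀ * Y' :=
    ⟨(E * U)ᵀ * Y, by rw [hY, ← Matrix.mul_assoc, ← transpose_mul, hE]⟩
  have hUE : Uᵀ * E'ᵀ = 1 := by rw [← transpose_mul, hE', transpose_one]
  have hUM : Uᵀ * M = Y'ᵀ * E' := by
    rw [← transpose_inj, transpose_mul, transpose_transpose, hY', transpose_mul,
      transpose_transpose]
  have hXY : Y'ᵀ = X' := by
    calc Y'ᵀ = Uᵀ * M * U := by rw [hUM, Matrix.mul_assoc, hE', Matrix.mul_one]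
      _ = X' := by rw [Matrix.mul_assoc, hX', ← Matrix.mul_assoc, hUE, Matrix.one_mul]
  rw [hXY] at hUM
  intro hM
  have hsq : U * E' * (U * E') = U * E' := by
    rw [Matrix.mul_assoc, ← Matrix.mul_assoc E', hE', Matrix.one_mul]
  have hunit : IsUnit (1 - (2 : F) • (U * E')) := by
    refine IsUnit.of_mul_eq_one (1 - (2 : F) • (U * E')) ?_
    simp only [sub_mul, mul_sub, Matrix.one_mul, Matrix.mul_one, smul_mul_assoc, mul_smul_comm, hsq]
    module
  have h1 : E'ᵀ * Uᵀ * M = E'ᵀ * X' * E' := by rw [Matrix.mul_assoc, hUM, Matrix.mul_assoc]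
  have h3 : M * (U * E') = E'ᵀ * X' * E' := by rw [← Matrix.mul_assoc, hX']
  have h4 : E'ᵀ * X' * E' * (U * E') = E'ᵀ * X' * E' := by
    rw [Matrix.mul_assoc, ← Matrix.mul_assoc E', hE', Matrix.one_mul]
  have hiso : (1 - (2 : F) • (U * E'))ᵀ * M * (1 - (2 : F) • (U * E')) = M := by
    rw [transpose_sub, transpose_one, transpose_smul, transpose_mul]
    simp only [sub_mul, mul_sub, Matrix.one_mul, Matrix.mul_one, smul_mul_assoc, mul_smul_comm, h1,
      h3, h4]
    module
  have hd := hM _ hunit hiso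
  rw [← smul_mul, det_one_sub_mul_comm, Matrix.mul_smul, hE', two_smul, sub_add_cancel_left,
    det_neg, det_one, hodd.neg_one_pow, mul_one] at hd
  exact h2 (by linear_combination -hd)

end Retract

section Jordan

theorem jordanBlock_one_eq (r : ℕ) : jordanBlock r (1 : F) = 1 + jordanBlock r 0 := by
  ext i j
  simp only [jordanBlock, of_apply, Matrix.add_apply, Matrix.one_apply, Fin.ext_iff]
  split_ifs <;> simp

theorem jordanBlock_zero_mulVec_apply {r : ℕ} (a : Fin r → F) (i : Fin r) :
    (jordanBlock r (0 : F) *ᵥ a) i =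
      if 1 ≤ (i : ℕ) then a ⟨i - 1, (Nat.sub_le _ _).trans_lt i.2⟩ else 0 := by
  have h : ∀ j : Fin r, jordanBlock r (0 : F) i j = if (i : ℕ) = j + 1 then 1 else 0 := fun j => by
    simp only [jordanBlock, of_apply]
    split_ifs <;> first | rfl | omega
  simp only [mulVec, dotProduct, h, ite_mul, one_mul, zero_mul]
  split_ifs with hi
  · rw [Finset.sum_eq_single ⟨i - 1, (Nat.sub_le _ _).trans_lt i.2⟩]
    · exact if_pos (Nat.sub_add_cancel hi).symm
    · intro j _ hj
      refine if_neg fun h => hj (Fin.ext ?_)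
      simp [h]
    · simp
  · exact Finset.sum_eq_zero fun j _ => if_neg (by omega)

theorem jordanBlock_zero_pow_mulVec_apply {r : ℕ} (m : ℕ) (a : Fin r → F) (i : Fin r) :
    (jordanBlock r (0 : F) ^ m *ᵥ a) i =
      if m ≤ (i : ℕ) then a ⟨i - m, (Nat.sub_le _ _).trans_lt i.2⟩ else 0 := by
  induction m generalizing i with
  | zero => simp
  | succ m ih =>
    rw [pow_succ', ← mulVec_mulVec, jordanBlock_zero_mulVec_apply]
    simp only [ih]
    have : (i : ℕ) - 1 - m = i - (m + 1) := by omega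
    simp only [this]
    split_ifs <;> first | rfl | omega

theorem jordanBlock_zero_pow_self (r : ℕ) : jordanBlock r (0 : F) ^ r = 0 := by
  refine Matrix.ext_of_mulVec_single fun j => ?_
  ext i
  rw [jordanBlock_zero_pow_mulVec_apply, if_neg (by omega), zero_mulVec, Pi.zero_apply]

theorem jordanBlock_zero_pow_mulVec_single {k j : ℕ} (hj : j < k + 1) :
    jordanBlock (k + 1) (0 : F) ^ j *ᵥ Pi.single 0 1 = Pi.single ⟨j, hj⟩ 1 := by
  ext i
  rw [jordanBlock_zero_pow_mulVec_apply]
  simp only [Pi.single_apply, Fin.ext_iff, Fin.val_zero]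
  split_ifs <;> first | rfl | omega

/-- A matrix whose kernel is stable under the nilpotent Jordan block is invertible as soon as it
does not annihilate the eigenvector of the block. -/
theorem isUnit_of_mulVec_jordanBlock {k : ℕ} {X : Matrix (Fin (k + 1)) (Fin (k + 1)) F}
    (hX : ∀ a, X *ᵥ a = 0 → X *ᵥ (jordanBlock (k + 1) (0 : F) *ᵥ a) = 0)
    (hlast : X *ᵥ Pi.single (Fin.last k) 1 ≠ 0) : IsUnit X := by
  refine mulVec_injective_iff_isUnit.1 ((injective_iff_map_eq_zero X.mulVecLin).2 fun a ha => ?_)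
  rw [mulVecLin_apply] at ha
  have hpow : ∀ m, X *ᵥ (jordanBlock (k + 1) (0 : F) ^ m *ᵥ a) = 0 := fun m => by
    induction m with
    | zero => rwa [pow_zero, one_mulVec]
    | succ m ih => rw [pow_succ', ← mulVec_mulVec]; exact hX _ ih
  have hzero : ∀ m (hm : m < k + 1), a ⟨m, hm⟩ = 0 := fun m => by
    induction m using Nat.strong_induction_on with
    | _ m ih =>
      intro hm
      have hpowa : jordanBlock (k + 1) (0 : F) ^ (k - m) *ᵥ a =
          a ⟨m, hm⟩ • Pi.single (Fin.last k) 1 := by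
        ext i
        rw [jordanBlock_zero_pow_mulVec_apply, Pi.smul_apply, Pi.single_apply, smul_eq_mul]
        simp only [Fin.ext_iff, Fin.val_last]
        split_ifs with h h' h'
        · rw [mul_one]
          congr 2
          omega
        · rw [mul_zero]
          exact ih _ (by omega) _
        · omega
        · rw [mul_zero]
      have h := hpow (k - m)
      rw [hpowa, mulVec_smul] at h
      exact (smul_eq_zero.1 h).resolve_right hlast
  exact funext fun i => hzero i i.2

/-- The kernel element of a chain gives rise to an orthogonal summand. -/
theorem exists_mul_eq_of_chain {n k : ℕ} {H K : Matrix (Fin n) (Fin n) F} (hH : Hᵀ = H)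
    (hK : Kᵀ = -K) {c : ℕ → Fin n → F} (hc0 : K *ᵥ c 0 = 0)
    (hc : ∀ j < k, H *ᵥ c j = K *ᵥ c (j + 1)) (hne : c 0 ⬝ᵥ H *ᵥ c k ≠ 0) :
    ∃ U : Matrix (Fin n) (Fin (k + 1)) F, K * U = H * U * jordanBlock (k + 1) (0 : F) ∧
      IsUnit (Uᵀ * H * U) := by
  obtain ⟨U, hU⟩ : ∃ U : Matrix (Fin n) (Fin (k + 1)) F, ∀ j, U *ᵥ Pi.single j 1 = c (k - j) :=
    ⟨of fun i j => c (k - j) i, fun j => by ext i; simp⟩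
  have hKU : K * U = H * U * jordanBlock (k + 1) (0 : F) := by
    refine Matrix.ext_of_mulVec_single fun j => ?_
    rw [← mulVec_mulVec, ← mulVec_mulVec, ← mulVec_mulVec, hU,
      ← jordanBlock_zero_pow_mulVec_single j.2, mulVec_mulVec _ (jordanBlock _ _), ← pow_succ']
    obtain ⟨j, hj⟩ := j
    rcases Nat.lt_or_ge j k with h | h
    · rw [jordanBlock_zero_pow_mulVec_single (Nat.succ_lt_succ h), hU,
        hc _ (by simp; omega)]
      congr 2
      simp
      omega
    · obtain rfl : j = k := by omega
      rw [jordanBlock_zero_pow_self, zero_mulVec, mulVec_zero]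
      simpa using hc0
  refine ⟨U, hKU, isUnit_of_mulVec_jordanBlock (fun a ha => ?_) fun h => hne ?_⟩
  · have : Uᵀ * H * U * jordanBlock (k + 1) (0 : F) =
        -((jordanBlock (k + 1) (0 : F))ᵀ * (Uᵀ * H * U)) := by
      calc Uᵀ * H * U * jordanBlock (k + 1) (0 : F) = Uᵀ * (K * U) := by
            rw [hKU]; simp only [Matrix.mul_assoc]
        _ = -((K * U)ᵀ * U) := by
            rw [transpose_mul, hK, Matrix.mul_neg, Matrix.neg_mul, neg_neg, Matrix.mul_assoc]
        _ = _ := by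
            rw [hKU, transpose_mul, transpose_mul, hH]; simp only [Matrix.mul_assoc]
    rw [mulVec_mulVec, this, neg_mulVec, ← mulVec_mulVec, ha, mulVec_zero, neg_zero]
  · have h0 := congrFun h 0
    rw [Matrix.mul_assoc, ← mulVec_mulVec, ← mulVec_mulVec, hU] at h0
    have h1 : (Uᵀ *ᵥ (H *ᵥ c (k - (Fin.last k : Fin (k + 1))))) 0 =
        (U *ᵥ Pi.single 0 1) ⬝ᵥ H *ᵥ c 0 := by
      simp [mulVec, Matrix.col]
      rfl
    rw [h1, hU] at h0
    rw [← dotProduct_mulVec_comm_of_symm hH]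
    simpa using h0

variable {n : ℕ} {M : Matrix (Fin n) (Fin n) F}

theorem two_smul_mul_of_mul_eq {b : Type*} [Fintype b] [DecidableEq b] {U : Matrix (Fin n) b F}
    {N : Matrix b b F}
    (hU : (M - Mᵀ) * U = (M + Mᵀ) * U * N) :
    (2 : F) • (M * U) = (M + Mᵀ) * U * (1 + N) ∧ (2 : F) • (Mᵀ * U) = (M + Mᵀ) * U * (1 - N) := by
  constructor
  · rw [Matrix.mul_add, ← hU, Matrix.mul_one]
    simp only [Matrix.add_mul, Matrix.sub_mul]
    module
  · rw [Matrix.mul_sub, ← hU, Matrix.mul_one]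
    simp only [Matrix.add_mul, Matrix.sub_mul]
    module

theorem not_xiMem_of_chain {k : ℕ} (h2 : (2 : F) ≠ 0) (hk : Even k)
    {c : ℕ → Fin n → F} (hc0 : (M - Mᵀ) *ᵥ c 0 = 0)
    (hc : ∀ j < k, (M + Mᵀ) *ᵥ c j = (M - Mᵀ) *ᵥ c (j + 1))
    (hne : c 0 ⬝ᵥ (M + Mᵀ) *ᵥ c k ≠ 0) : ¬ XiMem M := by
  have hH : (M + Mᵀ)ᵀ = M + Mᵀ := by rw [transpose_add, transpose_transpose, add_comm]
  have hK : (M - Mᵀ)ᵀ = -(M - Mᵀ) := by rw [transpose_sub, transpose_transpose, neg_sub]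
  obtain ⟨U, hU, hunit⟩ := exists_mul_eq_of_chain hH hK hc0 hc hne
  obtain ⟨h1, h3⟩ := two_smul_mul_of_mul_eq hU
  refine not_xiMem_of_odd (E := ((M + Mᵀ) * U)ᵀ) (U := U)
    (X := (2 : F)⁻¹ • (1 + jordanBlock (k + 1) (0 : F)))
    (Y := (2 : F)⁻¹ • (1 - jordanBlock (k + 1) (0 : F)))
    h2 ?_ ?_ ?_ ?_
  · rw [Fintype.card_fin]
    exact hk.add_one
  · rwa [transpose_mul, hH]
  · rw [transpose_transpose, Matrix.mul_smul, ← h1, inv_smul_smul₀ h2]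
  · rw [transpose_transpose, Matrix.mul_smul, ← h3, inv_smul_smul₀ h2]

/-- The Cayley transform `(1 + N)(1 - N)⁻¹` of the nilpotent Jordan block `N` is similar to
`1 + N`. -/
theorem exists_isUnit_cayley (h2 : (2 : F) ≠ 0) (k : ℕ) :
    ∃ T : Matrix (Fin (k + 1)) (Fin (k + 1)) F, IsUnit T ∧
      (1 + jordanBlock (k + 1) (0 : F)) * T =
        (1 - jordanBlock (k + 1) (0 : F)) * T * (1 + jordanBlock (k + 1) (0 : F)) := by
  set N := jordanBlock (k + 1) (0 : F) with hN
  have hnil : IsNilpotent N := ⟨k + 1, jordanBlock_zero_pow_self _⟩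
  have hcomm : Commute N (1 - N) := (Commute.one_right N).sub_right (Commute.refl N)
  let t : ℕ → Fin (k + 1) → F := fun j =>
    ((2 : F) ^ j • ((1 - N) ^ (k - j) * N ^ j)) *ᵥ Pi.single 0 1
  obtain ⟨T, hT⟩ : ∃ T : Matrix (Fin (k + 1)) (Fin (k + 1)) F,
      ∀ j : Fin (k + 1), T *ᵥ Pi.single j 1 = t j :=
    ⟨of fun i j => t j i, fun j => by ext i; simp⟩
  have hTN : (1 - N) * T * N = (2 : F) • (N * T) := by
    refine Matrix.ext_of_mulVec_single fun j => ?_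
    rw [smul_mulVec, ← mulVec_mulVec _ N, hT,
      ← mulVec_mulVec, ← mulVec_mulVec, ← jordanBlock_zero_pow_mulVec_single j.2, ← hN,
      mulVec_mulVec _ N, ← pow_succ']
    obtain ⟨j, hj⟩ := j
    rcases Nat.lt_or_ge j k with h | h
    · rw [jordanBlock_zero_pow_mulVec_single (Nat.succ_lt_succ h), hT, mulVec_mulVec, mulVec_mulVec,
        ← smul_mulVec]
      congr 1
      obtain ⟨m, rfl⟩ : ∃ m, k = j + 1 + m := ⟨k - (j + 1), by omega⟩
      rw [show j + 1 + m - (j + 1) = m by omega, show j + 1 + m - j = m + 1 by omega,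
        Matrix.mul_smul, Matrix.mul_smul, smul_smul, ← pow_succ', ← Matrix.mul_assoc,
        ← Matrix.mul_assoc, ← pow_succ', (hcomm.pow_right _).eq, Matrix.mul_assoc _ N, ← pow_succ']
    · obtain rfl : j = k := by omega
      rw [jordanBlock_zero_pow_self, zero_mulVec, mulVec_zero, mulVec_mulVec, Matrix.mul_smul,
        Nat.sub_self, pow_zero, Matrix.one_mul, ← pow_succ', jordanBlock_zero_pow_self, smul_zero,
        zero_mulVec, smul_zero, mulVec_zero]
  refine ⟨T, isUnit_of_mulVec_jordanBlock (fun a ha => ?_) ?_, ?_⟩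
  · have h := congrArg (· *ᵥ a) hTN
    simp only [smul_mulVec, ← mulVec_mulVec, ha, mulVec_zero, smul_zero] at h
    exact (mulVec_injective_iff_isUnit.2 hnil.isUnit_one_sub) (h.trans (mulVec_zero _).symm)
  · rw [hT, Fin.val_last]
    simp only [t, Nat.sub_self, pow_zero, Matrix.one_mul, smul_mulVec, hN,
      jordanBlock_zero_pow_mulVec_single k.lt_succ_self]
    intro h
    exact one_ne_zero (α := F) (Pi.single_eq_zero_iff.1
      ((smul_eq_zero.1 h).resolve_left (pow_ne_zero _ h2)))
  · rw [Matrix.mul_add, hTN, Matrix.mul_one, Matrix.add_mul, Matrix.sub_mul, Matrix.one_mul]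
    module

theorem isPairRetract_of_chain {k : ℕ} (h2 : (2 : F) ≠ 0)
    {c : ℕ → Fin n → F} (hc0 : (M - Mᵀ) *ᵥ c 0 = 0)
    (hc : ∀ j < k, (M + Mᵀ) *ᵥ c j = (M - Mᵀ) *ᵥ c (j + 1))
    (hne : c 0 ⬝ᵥ (M + Mᵀ) *ᵥ c k ≠ 0) :
    IsPairRetract Mᵀ M (1 : Matrix (Fin (k + 1)) (Fin (k + 1)) F) (jordanBlock (k + 1) 1) := by
  have hH : (M + Mᵀ)ᵀ = M + Mᵀ := by rw [transpose_add, transpose_transpose, add_comm]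
  have hK : (M - Mᵀ)ᵀ = -(M - Mᵀ) := by rw [transpose_sub, transpose_transpose, neg_sub]
  obtain ⟨U, hU, hunit⟩ := exists_mul_eq_of_chain hH hK hc0 hc hne
  obtain ⟨h1, h3⟩ := two_smul_mul_of_mul_eq hU
  obtain ⟨T, hT, hTJ⟩ := exists_isUnit_cayley h2 k
  rw [← jordanBlock_one_eq] at hTJ h1
  have hnil : IsNilpotent (jordanBlock (k + 1) (0 : F)) := ⟨k + 1, jordanBlock_zero_pow_self _⟩
  set J := jordanBlock (k + 1) (1 : F) with hJ
  set N := jordanBlock (k + 1) (0 : F) with hN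
  obtain ⟨V, hV⟩ : ∃ V, V = U * T := ⟨_, rfl⟩
  have hMV : M * V = Mᵀ * V * J := by
    refine smul_right_injective _ h2 ?_
    calc (2 : F) • (M * V) = (2 : F) • (M * U) * T := by rw [hV, smul_mul, Matrix.mul_assoc]
      _ = (2 : F) • (Mᵀ * U) * T * J := by
        rw [h1, h3, Matrix.mul_assoc, hTJ]; simp only [Matrix.mul_assoc]
      _ = _ := by rw [hV]; simp only [smul_mul, Matrix.mul_assoc]
  obtain ⟨G, hG⟩ : ∃ G, G = Vᵀ * Mᵀ * V := ⟨_, rfl⟩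
  have hGunit : IsUnit G := by
    have : (2 : F) • G = Tᵀ * (Uᵀ * (M + Mᵀ) * U) * (1 - N) * T := by
      calc (2 : F) • G = Tᵀ * Uᵀ * ((2 : F) • (Mᵀ * U)) * T := by
            rw [hG, hV, transpose_mul]
            simp only [smul_mul, Matrix.mul_smul, Matrix.mul_assoc]
        _ = _ := by rw [h3]; simp only [Matrix.mul_assoc]
    have h : IsUnit ((2 : F) • G) := by
      rw [this]
      exact ((((isUnit_transpose T).2 hT).mul hunit).mul hnil.isUnit_one_sub).mul hT
    simpa [Units.smul_def, smul_smul, h2] using h.smul (Units.mk0 (2 : F) h2)⁻¹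
  have hGdet := (isUnit_iff_isUnit_det G).1 hGunit
  have hVM : Vᵀ * Mᵀ = Jᵀ * (Vᵀ * M) := by
    rw [← transpose_inj, transpose_mul, transpose_transpose, transpose_transpose, hMV,
      transpose_mul, transpose_mul, transpose_transpose, transpose_transpose]
  have hJG : Jᵀ * G * J = G := by
    conv_rhs => rw [hG, hVM]
    rw [Matrix.mul_assoc Jᵀ (Vᵀ * M), Matrix.mul_assoc Vᵀ, hMV, hG]
    simp only [Matrix.mul_assoc]
  have hJG' : J * G⁻¹ * Jᵀ = G⁻¹ := by
    have h : J * (G⁻¹ * Jᵀ * G) = 1 := by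
      rw [mul_eq_one_comm, Matrix.mul_assoc, Matrix.mul_assoc, ← Matrix.mul_assoc Jᵀ, hJG,
        nonsing_inv_mul _ hGdet]
    rw [← mul_nonsing_inv_cancel_right G (J * G⁻¹ * Jᵀ) hGdet, Matrix.mul_assoc J,
      Matrix.mul_assoc J, h, Matrix.one_mul]
  refine ⟨V, G⁻¹ * (Vᵀ * Mᵀ), G⁻¹ * Vᵀ, Mᵀ * V, ?_, ?_, ?_, hMV, ?_, ?_⟩
  · rw [Matrix.mul_assoc, ← hG, nonsing_inv_mul _ hGdet]
  · rw [Matrix.mul_assoc, ← Matrix.mul_assoc Vᵀ, ← hG, nonsing_inv_mul _ hGdet]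
  · rw [Matrix.mul_one]
  · rw [Matrix.one_mul, Matrix.mul_assoc]
  · rw [hVM, ← Matrix.mul_assoc J, ← Matrix.mul_assoc (J * G⁻¹), hJG', Matrix.mul_assoc]

theorem IsPairRetract.not_xiMem_of_jordanBlock {k : ℕ} (h2 : (2 : F) ≠ 0) (hk : Even k)
    (h : IsPairRetract Mᵀ M (1 : Matrix (Fin (k + 1)) (Fin (k + 1)) F)
      (jordanBlock (k + 1) 1)) : ¬ XiMem M := by
  have hH : (M + Mᵀ)ᵀ = M + Mᵀ := by rw [transpose_add, transpose_transpose, add_comm]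
  have hK : (M - Mᵀ)ᵀ = -(M - Mᵀ) := by rw [transpose_sub, transpose_transpose, neg_sub]
  obtain ⟨U, P, Q, L, hPU, -, hA1, hB1, hA2, hB2⟩ := h
  rw [jordanBlock_one_eq] at hB1 hB2
  have hnil : IsNilpotent (jordanBlock (k + 1) (0 : F)) := ⟨k + 1, jordanBlock_zero_pow_self _⟩
  set N := jordanBlock (k + 1) (0 : F) with hN
  obtain ⟨Z, hZ⟩ : ∃ Z, Z = (2 : F) • (1 : Matrix (Fin (k + 1)) (Fin (k + 1)) F) + N := ⟨_, rfl⟩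
  have hZunit : IsUnit Z := by
    rw [hZ]
    refine hnil.isUnit_add_left_of_commute ?_ ((Commute.one_right N).smul_right _)
    exact isUnit_one.smul (Units.mk0 (2 : F) h2)
  have hNZ : Commute N Z := hZ ▸ ((Commute.one_right N).smul_right _).add_right (Commute.refl N)
  have hKU : (M - Mᵀ) * U = L * N := by
    rw [Matrix.sub_mul, hB1, hA1, ← Matrix.mul_sub, add_sub_cancel_left]
  have hHU : (M + Mᵀ) * U = L * Z := by
    rw [Matrix.add_mul, hB1, hA1, ← Matrix.mul_add, hZ, two_smul]
    congr 1
    abel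
  have hQK : Q * (M - Mᵀ) = N * P := by
    rw [Matrix.mul_sub, hB2, hA2, ← Matrix.sub_mul, add_sub_cancel_left]
  have hQH : Q * (M + Mᵀ) = Z * P := by
    rw [Matrix.mul_add, hB2, hA2, ← Matrix.add_mul, hZ, two_smul]
    congr 1
    abel
  suffices h : _ ∧ _ ∧ _ by
    obtain ⟨c, hc0, hc, hne⟩ := exists_chain_of_gap h2 hH hK hk
      (x := U *ᵥ (N ^ k *ᵥ Pi.single 0 1)) h.1 h.2.1 h.2.2
    exact not_xiMem_of_chain h2 hk hc0 hc hne
  refine ⟨?_, ?_, ?_⟩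
  · rw [mulVec_mulVec, hKU, ← mulVec_mulVec, mulVec_mulVec _ N, ← pow_succ', hN,
      jordanBlock_zero_pow_self, zero_mulVec, mulVec_zero]
  · refine mem_relIter.2 ⟨fun i => U *ᵥ ((Z ^ i * N ^ (k - i)) *ᵥ Pi.single 0 1), ?_,
      Submodule.mem_top, fun j hj => ?_⟩
    · simp
    · obtain ⟨m, rfl⟩ : ∃ m, k = j + 1 + m := ⟨k - (j + 1), by omega⟩
      beta_reduce
      rw [mulVec_mulVec, mulVec_mulVec _ (M - Mᵀ), hHU, hKU, mulVec_mulVec,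
        mulVec_mulVec, Matrix.mul_assoc, Matrix.mul_assoc, show j + 1 + m - (j + 1) = m by omega,
        show j + 1 + m - j = m + 1 by omega]
      congr 2
      rw [← Matrix.mul_assoc, ← Matrix.mul_assoc, ← pow_succ', (hNZ.pow_right _).eq,
        Matrix.mul_assoc _ N, ← pow_succ']
  · intro hx
    obtain ⟨d, hd0, -, hd⟩ := mem_relIter.1 hx
    have hd' : ∀ j < k + 1, Z *ᵥ (P *ᵥ d j) = N *ᵥ (P *ᵥ d (j + 1)) := fun j hj => by
      rw [mulVec_mulVec, mulVec_mulVec, ← hQH, ← hQK, ← mulVec_mulVec, ← mulVec_mulVec, hd j hj]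
    have hpow : ∀ j ≤ k + 1, Z ^ j *ᵥ (P *ᵥ d 0) = N ^ j *ᵥ (P *ᵥ d j) := fun j => by
      induction j with
      | zero => intro; simp
      | succ j ih =>
        intro hj
        rw [pow_succ', ← mulVec_mulVec, ih (by omega), mulVec_mulVec, ← (hNZ.pow_left j).eq,
          ← mulVec_mulVec, hd' j (by omega), mulVec_mulVec, ← pow_succ]
    have h0 := hpow (k + 1) le_rfl
    rw [hN, jordanBlock_zero_pow_self, zero_mulVec, hd0, mulVec_mulVec _ P, hPU, one_mulVec] at h0
    have h3 := mulVec_injective_iff_isUnit.2 (hZunit.pow (k + 1)) (h0.trans (mulVec_zero _).symm)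
    rw [hN, jordanBlock_zero_pow_mulVec_single k.lt_succ_self] at h3
    exact one_ne_zero (α := F) (Pi.single_eq_zero_iff.1 h3)

end Jordan

section Singular

variable {n : ℕ}

/-- The coefficients `v 0, …, v (t - 1)` of a polynomial vector killed by the pencil `B - xA`. -/
def IsClosedChain (A B : Matrix (Fin n) (Fin n) F) (t : ℕ) (v : ℕ → Fin n → F) : Prop :=
  B *ᵥ v 0 = 0 ∧ (∀ i, B *ᵥ v (i + 1) = A *ᵥ v i) ∧ ∀ i, t ≤ i → v i = 0

theorem exists_isClosedChain {A B : Matrix (Fin n) (Fin n) F} {W W' : Submodule F (Fin n → F)}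
    (hA : ∀ x ∈ W, A *ᵥ x ∈ W') (hB : ∀ x ∈ W, B *ᵥ x ∈ W')
    (hlt : Module.finrank F W' < Module.finrank F W) :
    ∃ t v, v ≠ 0 ∧ IsClosedChain A B t v := by
  obtain ⟨t, ht⟩ : ∃ t, t = Module.finrank F W' + 1 := ⟨_, rfl⟩
  let f : W →ₗ[F] W' := A.mulVecLin.restrict hA
  let g : W →ₗ[F] W' := B.mulVecLin.restrict hB
  let x : ℕ → (Fin t → W) →ₗ[F] W := fun i => if h : i < t then LinearMap.proj ⟨i, h⟩ else 0
  let φ : (Fin t → W) →ₗ[F] (Fin (t + 1) → W') := LinearMap.pi fun i =>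
    g ∘ₗ x i - if (i : ℕ) = 0 then 0 else f ∘ₗ x (i - 1)
  have hdim : Module.finrank F (Fin (t + 1) → W') < Module.finrank F (Fin t → W) := by
    rw [Module.finrank_pi_fintype, Module.finrank_pi_fintype]
    simp only [Finset.sum_const, Finset.card_univ, Fintype.card_fin, smul_eq_mul]
    nlinarith
  obtain ⟨a, ha, hne⟩ := Submodule.exists_mem_ne_zero_of_ne_bot (φ.ker_ne_bot_of_finrank_lt hdim)
  have hx : ∀ i (h : i < t), x i a = a ⟨i, h⟩ := fun i h => by simp [x, h]
  have hx' : ∀ i, t ≤ i → x i a = 0 := fun i h => by simp [x, h.not_gt]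
  have hφ : ∀ i (h : i < t + 1), (g (x i a) - if i = 0 then 0 else f (x (i - 1) a)) = 0 :=
    fun i h => by
      have h0 := congrFun (LinearMap.mem_ker.1 ha) ⟨i, h⟩
      simp only [φ, LinearMap.pi_apply, LinearMap.sub_apply, Pi.zero_apply] at h0
      refine Eq.trans ?_ h0
      split_ifs <;> rfl
  refine ⟨t, fun i => x i a, fun h => hne ?_, ?_, fun i => ?_, fun i hi => ?_⟩
  · ext1 i
    rw [← hx i i.2]
    exact Subtype.ext (congrFun h i)
  · have h0 := hφ 0 (by omega)
    rw [if_pos rfl, sub_zero] at h0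
    exact congrArg Subtype.val h0
  · rcases Nat.lt_or_ge i t with h | h
    · have h0 := hφ (i + 1) (by omega)
      rw [if_neg i.succ_ne_zero, sub_eq_zero] at h0
      exact congrArg Subtype.val h0
    · beta_reduce
      rw [hx' i h, hx' (i + 1) (by omega), Submodule.coe_zero, mulVec_zero, mulVec_zero]
  · beta_reduce
    rw [hx' i hi, Submodule.coe_zero]

variable {A B : Matrix (Fin n) (Fin n) F} {t : ℕ} {v : ℕ → Fin n → F}

/-- The leading vector of a shortest closed chain can be separated from its other vectors. -/
theorem IsClosedChain.exists_dotProduct_eq_one {s : ℕ} (hv : IsClosedChain A B (s + 1) v)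
    (hne : v ≠ 0) (hmin : ∀ w, IsClosedChain A B s w → w = 0) :
    ∃ p : Fin n → F, (∀ u ∈ relIter A B ⊥ s, p ⬝ᵥ u = 0) ∧ p ⬝ᵥ v 0 = 1 ∧
      ∀ i, p ⬝ᵥ v (i + 1) = 0 := by
  obtain ⟨hv0, hv1, hv2⟩ := hv
  have hvs : v s ≠ 0 := fun h => hne <| hmin v ⟨hv0, hv1, fun i hi => by
    obtain rfl | hi := hi.eq_or_lt
    · exact h
    · exact hv2 i hi⟩
  have hnot : v 0 ∉ relIter A B ⊥ s ⊔ Submodule.span F (Set.range fun i : Fin s => v (i + 1)) := by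
    intro hmem
    obtain ⟨u₀, hu₀, y, hy, hsum⟩ := Submodule.mem_sup.1 hmem
    obtain ⟨a, rfl⟩ := (Submodule.mem_span_range_iff_exists_fun F).1 hy
    obtain ⟨u, rfl, hus, hu⟩ := mem_relIter.1 hu₀
    rw [Submodule.mem_bot] at hus
    obtain ⟨u', hu'⟩ : ∃ u' : ℕ → Fin n → F, u' = fun j => if j < s then u j else 0 := ⟨_, rfl⟩
    have hu'1 : ∀ j, B *ᵥ u' (j + 1) = A *ᵥ u' j := fun j => by
      rcases Nat.lt_trichotomy (j + 1) s with h | h | h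
      · simp only [hu', if_pos h, if_pos (Nat.lt_of_succ_lt h)]
        exact (hu j (by omega)).symm
      · simp only [hu', h, if_neg s.lt_irrefl, if_pos (show j < s by omega)]
        rw [hu j (by omega), h, hus]
      · simp only [hu', if_neg h.not_gt, if_neg (show ¬ j < s by omega), mulVec_zero]
    have hu'0 : u' 0 = u 0 := by
      rcases s.eq_zero_or_pos with h | h
      · subst h
        simp [hu', hus]
      · simp [hu', h]
    obtain ⟨z, hz⟩ : ∃ z : ℕ → Fin n → F,
        z = fun j => v j - u' j - ∑ i : Fin s, a i • v (j + (i + 1)) := ⟨_, rfl⟩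
    have hz0 : z 0 = 0 := by
      simp only [hz, hu'0, zero_add]
      rw [← hsum]
      abel
    have hz1 : ∀ j, B *ᵥ z (j + 1) = A *ᵥ z j := fun j => by
      simp only [hz, mulVec_sub, mulVec_sum, mulVec_smul, hv1, hu'1]
      simp only [show ∀ i, j + 1 + i = j + i + 1 by intro i; omega, hv1]
    have hzs : z s = v s := by
      simp only [hz, hu', if_neg s.lt_irrefl, sub_zero]
      rw [Finset.sum_eq_zero fun i _ => by rw [hv2 _ (by omega), smul_zero], sub_zero]
    have hw := hmin (fun j => z (j + 1)) ⟨by rw [hz1, hz0, mulVec_zero], fun j => hz1 (j + 1),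
      fun j hj => by
        simp only [hz, hu', if_neg (show ¬ j + 1 < s by omega), sub_zero]
        rw [hv2 _ (by omega), Finset.sum_eq_zero fun i _ => by rw [hv2 _ (by omega), smul_zero],
          sub_zero]⟩
    refine hvs ?_
    rw [← hzs]
    cases s with
    | zero => exact hz0
    | succ s => exact congrFun hw s
  obtain ⟨f, hf, hle⟩ := Submodule.exists_le_ker_of_notMem hnot
  have hp : ∀ w, (dotProductEquiv F (Fin n)).symm f ⬝ᵥ w = f w := fun w =>
    LinearMap.congr_fun ((dotProductEquiv F (Fin n)).apply_symm_apply f) w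
  refine ⟨(f (v 0))⁻¹ • (dotProductEquiv F (Fin n)).symm f, fun u hu => ?_, ?_, fun i => ?_⟩
  · rw [smul_dotProduct, hp, LinearMap.mem_ker.1 (hle (Submodule.mem_sup_left hu)), smul_zero]
  · rw [smul_dotProduct, hp, smul_eq_mul, inv_mul_cancel₀ hf]
  · rw [smul_dotProduct, hp]
    rcases Nat.lt_or_ge i s with h | h
    · rw [LinearMap.mem_ker.1 (hle (Submodule.mem_sup_right (Submodule.subset_span ⟨⟨i, h⟩, rfl⟩))),
        smul_zero]
    · rw [hv2 (i + 1) (by omega), map_zero, smul_zero]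

theorem mul_Fmat_apply {m : Type*} (L : Matrix m (Fin (t - 1)) F) (i : m) (j : Fin t) :
    (L * (Fmat t : Matrix (Fin (t - 1)) (Fin t) F)) i j =
      if h : (j : ℕ) < t - 1 then L i ⟨j, h⟩ else 0 := by
  simp only [Matrix.mul_apply, Fmat, of_apply, mul_ite, mul_one, mul_zero]
  split_ifs with h
  · rw [Finset.sum_eq_single ⟨j, h⟩ (fun l _ hl => if_neg fun h => hl (Fin.ext h.symm))
      (by simp), if_pos rfl]
  · exact Finset.sum_eq_zero fun l _ => if_neg (by omega)

theorem mul_Gmat_apply {m : Type*} (L : Matrix m (Fin (t - 1)) F) (i : m) (j : Fin t) :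
    (L * (Gmat t : Matrix (Fin (t - 1)) (Fin t) F)) i j =
      if h : 1 ≤ (j : ℕ) then L i ⟨j - 1, by omega⟩ else 0 := by
  simp only [Matrix.mul_apply, Gmat, of_apply, mul_ite, mul_one, mul_zero]
  split_ifs with h
  · rw [Finset.sum_eq_single ⟨j - 1, by omega⟩
      (fun l _ hl => if_neg fun h => hl (Fin.ext (by simp only; omega))) (by simp),
      if_pos (by simp only; omega)]
  · exact Finset.sum_eq_zero fun l _ => if_neg (by omega)

theorem Fmat_mul_apply {m : Type*} (P : Matrix (Fin t) m F) (i : Fin (t - 1)) (j : m) :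
    ((Fmat t : Matrix (Fin (t - 1)) (Fin t) F) * P) i j = P ⟨i, by omega⟩ j := by
  simp only [Matrix.mul_apply, Fmat, of_apply, ite_mul, one_mul, zero_mul]
  rw [Finset.sum_eq_single ⟨i, by omega⟩ (fun l _ hl => if_neg fun h => hl (Fin.ext h))
    (by simp), if_pos rfl]

theorem Gmat_mul_apply {m : Type*} (P : Matrix (Fin t) m F) (i : Fin (t - 1)) (j : m) :
    ((Gmat t : Matrix (Fin (t - 1)) (Fin t) F) * P) i j = P ⟨i + 1, by omega⟩ j := by
  simp only [Matrix.mul_apply, Gmat, of_apply, ite_mul, one_mul, zero_mul]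
  rw [Finset.sum_eq_single ⟨i + 1, by omega⟩ (fun l _ hl => if_neg fun h => hl (Fin.ext h))
    (by simp), if_pos rfl]

theorem IsClosedChain.isPairRetract {s : ℕ} (hv : IsClosedChain A B (s + 1) v)
    (hne : v ≠ 0) (hmin : ∀ w, IsClosedChain A B s w → w = 0) :
    IsPairRetract A B (Fmat (s + 1) : Matrix (Fin (s + 1 - 1)) (Fin (s + 1)) F)
      (Gmat (s + 1)) := by
  obtain ⟨p, hp, hp0, hp1⟩ := hv.exists_dotProduct_eq_one hne hmin
  obtain ⟨hv0, hv1, hv2⟩ := hv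
  obtain ⟨c, q, hc, hq⟩ := exists_dual_chain_s8 A B hp
  have hcv : ∀ j ≤ s, ∀ i, c j ⬝ᵥ v i = if j = i then 1 else 0 := fun j => by
    induction j with
    | zero =>
      intro _ i
      rw [hc]
      cases i with
      | zero => rw [hp0, if_pos rfl]
      | succ i => rw [hp1, if_neg i.succ_ne_zero.symm]
    | succ j ih =>
      intro hj i
      rw [← (hq j (by omega)).2, ← dotProduct_mulVec]
      cases i with
      | zero => rw [hv0, dotProduct_zero, if_neg j.succ_ne_zero]
      | succ i =>
        rw [hv1, dotProduct_mulVec, (hq j (by omega)).1, ih (by omega)]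
        simp
  have hAv : ∀ i (j : Fin (s + 1)), (A * of fun i (j : Fin (s + 1)) => v j i) i j = (A *ᵥ v j) i :=
    fun _ _ => rfl
  have hBv : ∀ i (j : Fin (s + 1)), (B * of fun i (j : Fin (s + 1)) => v j i) i j = (B *ᵥ v j) i :=
    fun _ _ => rfl
  refine ⟨of fun i j => v j i, of fun j => c j, of fun j => q j,
    of fun i (j : Fin (s + 1 - 1)) => (A *ᵥ v j) i, ?_, ?_, ?_, ?_, ?_, ?_⟩
  · ext i j
    change c i ⬝ᵥ v j = _
    rw [hcv i (by omega), Matrix.one_apply]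
    simp only [Fin.ext_iff]
  · ext i j
    change q i ⬝ᵥ (A *ᵥ v j) = _
    rw [dotProduct_mulVec, (hq i (by omega)).1, hcv i (by omega), Matrix.one_apply]
    simp only [Fin.ext_iff]
  · ext i j
    rw [mul_Fmat_apply, hAv]
    split_ifs with h
    · rfl
    · rw [← hv1, hv2 _ (by omega), mulVec_zero, Pi.zero_apply]
  · ext i j
    rw [mul_Gmat_apply, hBv]
    split_ifs with h
    · rw [of_apply, ← hv1, Nat.sub_add_cancel h]
    · rw [show (j : ℕ) = 0 by omega, hv0, Pi.zero_apply]
  · ext i j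
    rw [Fmat_mul_apply]
    exact congrFun (hq i (by omega)).1 j
  · ext i j
    rw [Gmat_mul_apply]
    exact congrFun (hq i (by omega)).2 j

theorem exists_isPairRetract_of_isClosedChain (h : ∃ t v, v ≠ 0 ∧ IsClosedChain A B t v) :
    ∃ t, 1 ≤ t ∧ IsPairRetract A B (Fmat t : Matrix (Fin (t - 1)) (Fin t) F) (Gmat t) := by
  classical
  obtain ⟨v, hne, hv⟩ := Nat.find_spec h
  obtain ⟨t, ht⟩ : ∃ t, t = Nat.find h := ⟨_, rfl⟩
  have hmin : ∀ s < t, ∀ w, IsClosedChain A B s w → w = 0 := fun s hs w hw => by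
    by_contra h0
    exact Nat.find_min h (ht ▸ hs) ⟨w, h0, hw⟩
  rw [← ht] at hv
  cases t with
  | zero => exact absurd (funext fun i => hv.2.2 i (Nat.zero_le i)) hne
  | succ s => exact ⟨s + 1, by omega, hv.isPairRetract hne (hmin s s.lt_succ_self)⟩

theorem IsPairRetract.not_xiMem_of_Fmat {M : Matrix (Fin n) (Fin n) F} (h2 : (2 : F) ≠ 0)
    (ht : 1 ≤ t) (h : IsPairRetract Mᵀ M (Fmat t : Matrix (Fin (t - 1)) (Fin t) F) (Gmat t)) :
    ¬ XiMem M := by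
  obtain ⟨U, P, Q, L, hPU, hQL, hA1, hB1, hA2, hB2⟩ := h
  have hMQ : M * Qᵀ = Pᵀ * (Fmat t : Matrix (Fin (t - 1)) (Fin t) F)ᵀ := by
    rw [← transpose_mul, ← hA2, transpose_mul, transpose_transpose]
  have hMQ' : Mᵀ * Qᵀ = Pᵀ * (Gmat t : Matrix (Fin (t - 1)) (Fin t) F)ᵀ := by
    rw [← transpose_mul, hB2, transpose_mul]
  obtain ⟨X, hX⟩ : ∃ X, X = Lᵀ * U := ⟨_, rfl⟩
  have hXFG : (Xᵀ * (Fmat t : Matrix (Fin (t - 1)) (Fin t) F))ᵀ =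
      Xᵀ * (Gmat t : Matrix (Fin (t - 1)) (Fin t) F) := by
    rw [transpose_mul, transpose_transpose, hX, ← Matrix.mul_assoc, ← transpose_mul, ← hA1,
      transpose_mul, transpose_transpose, transpose_mul, transpose_transpose, Matrix.mul_assoc,
      Matrix.mul_assoc, hB1]
  have hrec : ∀ a b : Fin t, (if h : (a : ℕ) < t - 1 then X ⟨a, h⟩ b else 0) =
      if h : 1 ≤ (b : ℕ) then X ⟨b - 1, by omega⟩ a else 0 := fun a b => by
    have := congrFun (congrFun hXFG a) b
    rwa [transpose_apply, mul_Fmat_apply, mul_Gmat_apply] at this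
  have hX0 : ∀ b a (hb : b < t - 1) (ha : a < t), X ⟨b, hb⟩ ⟨a, ha⟩ = 0 := fun b => by
    induction b with
    | zero =>
      intro a hb ha
      have h := hrec ⟨0, by omega⟩ ⟨a, ha⟩
      rw [dif_pos hb] at h
      rw [h]
      split_ifs with h1
      · have h' := hrec ⟨a - 1, by omega⟩ ⟨0, by omega⟩
        rw [dif_pos (show a - 1 < t - 1 by simp only at h1; omega), dif_neg (by simp)] at h'
        exact h'
      · rfl
    | succ b ih =>
      intro a hb ha
      have h := hrec ⟨b + 1, by omega⟩ ⟨a, ha⟩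
      rw [dif_pos hb] at h
      rw [h]
      split_ifs with h1
      · have h' := hrec ⟨a - 1, by omega⟩ ⟨b + 1, by omega⟩
        rw [dif_pos (show a - 1 < t - 1 by simp only at h1; omega), dif_pos (by simp)] at h'
        exact h'.trans (ih _ _ _)
      · rfl
  have hX0' : Lᵀ * U = 0 := by
    rw [← hX]
    ext i j
    exact hX0 i j i.2 j.2
  refine not_xiMem_of_odd (ι := Fin t ⊕ Fin (t - 1)) (U := fromCols U Qᵀ) (E := fromRows P Lᵀ)
    (X := fromBlocks 0 (Fmat t)ᵀ (Gmat t) 0) (Y := fromBlocks 0 (Gmat t)ᵀ (Fmat t) 0)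
    h2 ?_ ?_ ?_ ?_
  · rw [Fintype.card_sum, Fintype.card_fin, Fintype.card_fin]
    exact ⟨t - 1, by omega⟩
  · rw [fromRows_mul_fromCols, hX0', hPU, isUnit_iff_isUnit_det, det_fromBlocks_zero₂₁,
      ← transpose_mul, hQL, transpose_one, det_one, det_one, mul_one]
    exact isUnit_one
  · rw [transpose_fromRows, transpose_transpose, mul_fromCols, fromCols_mul_fromBlocks, hB1, hMQ]
    simp
  · rw [transpose_fromRows, transpose_transpose, mul_fromCols, fromCols_mul_fromBlocks, hA1, hMQ']
    simp

end Singular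

section Main

variable {n : ℕ} {M : Matrix (Fin n) (Fin n) F}

/-- If the kernel filtration of the skew part does not exhaust its kernel, the pencil is
singular. -/
theorem exists_isPairRetract_of_kerFiltration_ne_bot (h2 : (2 : F) ≠ 0) {k : ℕ}
    (hk : relIter (M + Mᵀ) (M - Mᵀ) ⊤ k = relIter (M + Mᵀ) (M - Mᵀ) ⊤ (k + 1))
    (hne : kerFiltration (M + Mᵀ) (M - Mᵀ) k ≠ ⊥) :
    ∃ t, 1 ≤ t ∧ IsPairRetract Mᵀ M (Fmat t : Matrix (Fin (t - 1)) (Fin t) F) (Gmat t) := by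
  set W := relIter (M + Mᵀ) (M - Mᵀ) ⊤ k with hW
  have hKW : ∀ x ∈ W, (M - Mᵀ) *ᵥ x ∈ W.map (M - Mᵀ).mulVecLin := fun x hx => ⟨x, hx, rfl⟩
  have hHW : ∀ x ∈ W, (M + Mᵀ) *ᵥ x ∈ W.map (M - Mᵀ).mulVecLin := fun x hx => by
    obtain ⟨y, hy, hxy⟩ := mem_relIter_succ.1 (hk ▸ hx)
    rw [hxy]
    exact hKW y hy
  have hMW : ∀ x ∈ W, M *ᵥ x ∈ W.map (M - Mᵀ).mulVecLin := fun x hx => by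
    have h := Submodule.smul_mem _ (2 : F)⁻¹ (add_mem (hHW x hx) (hKW x hx))
    rwa [← add_mulVec, add_add_sub_cancel, ← two_smul F M, smul_mulVec, inv_smul_smul₀ h2] at h
  have hMW' : ∀ x ∈ W, Mᵀ *ᵥ x ∈ W.map (M - Mᵀ).mulVecLin := fun x hx => by
    have h := sub_mem (hMW x hx) (hKW x hx)
    rwa [← sub_mulVec, sub_sub_cancel] at h
  have hlt : Module.finrank F (W.map (M - Mᵀ).mulVecLin) < Module.finrank F W := by
    have hrank := LinearMap.finrank_range_add_finrank_ker ((M - Mᵀ).mulVecLin.domRestrict W)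
    rw [LinearMap.range_domRestrict] at hrank
    obtain ⟨x, hx, hx0⟩ := Submodule.exists_mem_ne_zero_of_ne_bot hne
    have : (LinearMap.ker ((M - Mᵀ).mulVecLin.domRestrict W)) ≠ ⊥ := fun h =>
      hx0 (congrArg Subtype.val ((Submodule.eq_bot_iff _).1 h ⟨x, hx.2⟩ hx.1))
    have := Submodule.one_le_finrank_iff.2 this
    omega
  obtain ⟨t, v, hv, hchain⟩ := exists_isClosedChain hMW' hMW hlt
  exact exists_isPairRetract_of_isClosedChain ⟨t, v, hv, hchain⟩

theorem exists_isPairRetract_of_not_xiMem (h2 : (2 : F) ≠ 0) (hM : ¬ XiMem M) :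
    (∃ k, Even k ∧ IsPairRetract Mᵀ M (1 : Matrix (Fin (k + 1)) (Fin (k + 1)) F)
      (jordanBlock (k + 1) 1)) ∨
    ∃ t, 1 ≤ t ∧ IsPairRetract Mᵀ M (Fmat t : Matrix (Fin (t - 1)) (Fin t) F) (Gmat t) := by
  by_contra! ⟨hodd, hsing⟩
  refine hM fun S hS hSM => ?_
  have hSM' : Sᵀ * Mᵀ * S = Mᵀ := by
    conv_rhs => rw [← hSM]
    rw [transpose_mul, transpose_mul, transpose_transpose, Matrix.mul_assoc]
  have hH : (M + Mᵀ)ᵀ = M + Mᵀ := by rw [transpose_add, transpose_transpose, add_comm]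
  have hK : (M - Mᵀ)ᵀ = -(M - Mᵀ) := by rw [transpose_sub, transpose_transpose, neg_sub]
  obtain ⟨l, hl⟩ := exists_relIter_top_eq (M + Mᵀ) (M - Mᵀ)
  refine det_eq_one_of_kerFiltration h2 hH hK hS ?_ ?_ (fun k hk => ?_) (l := l) ?_
  · rw [Matrix.mul_add, Matrix.add_mul, hSM, hSM']
  · rw [Matrix.mul_sub, Matrix.sub_mul, hSM, hSM']
  · refine le_antisymm (fun x hx => ⟨hx.1, ?_⟩)
      (inf_le_inf_left _ (relIter_top_antitone _ _ k.le_succ))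
    by_contra hx'
    obtain ⟨c, hc0, hc, hne⟩ := exists_chain_of_gap h2 hH hK hk hx.1 hx.2 hx'
    exact hodd k hk (isPairRetract_of_chain h2 hc0 hc hne)
  · by_contra hne
    obtain ⟨t, ht, h⟩ := exists_isPairRetract_of_kerFiltration_ne_bot h2 (hl _ l.le_succ) hne
    exact hsing t ht h

end Main

/-- `M ∉ Ξ_n(F)` iff `(Mᵀ, M)` has a direct summand for equivalence that is
either `(I_r, J_r(1))` with `r` odd, or `(F_t, G_t)` for some `t ≥ 1`. -/
theorem stmt_8 {F : Type*} [Field F] (hchar : (2 : F) ≠ 0) {n : ℕ}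
    (M : Matrix (Fin n) (Fin n) F) :
    ¬ XiMem M ↔
      (∃ r : ℕ, Odd r ∧
        PairSummand Mᵀ M (1 : Matrix (Fin r) (Fin r) F) (jordanBlock r (1 : F))) ∨
      (∃ t : ℕ, 1 ≤ t ∧
        PairSummand Mᵀ M (Fmat t : Matrix (Fin (t - 1)) (Fin t) F) (Gmat t)) := by
  constructor
  · intro hM
    rcases exists_isPairRetract_of_not_xiMem hchar hM with ⟨k, hk, h⟩ | ⟨t, ht, h⟩
    · exact Or.inl ⟨k + 1, hk.add_one, h.pairSummand⟩
    · exact Or.inr ⟨t, ht, h.pairSummand⟩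
  · rintro (⟨r, hr, h⟩ | ⟨t, ht, h⟩)
    · obtain ⟨k, rfl⟩ : ∃ k, r = k + 1 := Nat.exists_eq_succ_of_ne_zero hr.pos.ne'
      exact h.isPairRetract.not_xiMem_of_jordanBlock hchar (by simpa [Nat.odd_add_one] using hr)
    · exact h.isPairRetract.not_xiMem_of_Fmat hchar ht
end
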